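/- Let A_S be an Artin group of large type. Then every subset B of A_S is contained in a unique minimal parabolic subgroup of A_S: there is a parabolic subgroup P of A_S with B ⊆ P such that P ⊆ Q for every parabolic subgroup Q of A_S containing B, and such a P is unique (it is called the parabolic closure of B). -/

import Mathlib

/-- The alternating word `sts⋯` of length `k` in the free group on `S`. -/
def braidWord {S : Type*} (k : ℕ) (s t : S) : FreeGroup S :=
  ((List.range k).map fun i => FreeGroup.of (if i % 2 = 0 then s else t)).prod

/-- The braid relations of the Artin group with Coxeter-type matrix `M`
(`M s t = ⊤` means no relation). -/
def artinRels {S : Type*} (M : S → S → ℕ∞) : Set (FreeGroup S) :=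
  { r | ∃ s t : S, s ≠ t ∧ ∃ k : ℕ, M s t = (k : ℕ∞) ∧
      r = braidWord k s t * (braidWord k t s)⁻¹ }

/-- The Artin group associated to the matrix `M`. -/
abbrev ArtinGroup {S : Type*} (M : S → S → ℕ∞) : Type _ := PresentedGroup (artinRels M)

/-- The standard parabolic subgroup `A_X` generated by the images of elements of `X ⊆ S`. -/
def StandardParabolic {S : Type*} (M : S → S → ℕ∞) (X : Set S) : Subgroup (ArtinGroup M) :=
  Subgroup.closure ((fun s => (PresentedGroup.of s : ArtinGroup M)) '' X)

/-- The conjugate `g H g⁻¹` of a subgroup. -/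
def conjSubgroup {G : Type*} [Group G] (g : G) (H : Subgroup G) : Subgroup G :=
  H.map (MulAut.conj g).toMonoidHom

/-- A parabolic subgroup: a conjugate of a standard parabolic subgroup. -/
def IsParabolic {S : Type*} (M : S → S → ℕ∞) (P : Subgroup (ArtinGroup M)) : Prop :=
  ∃ (g : ArtinGroup M) (X : Set S), P = conjSubgroup g (StandardParabolic M X)

universe u

/-! ### Coxeter quotients -/

/-- A group generated by involutions `σ s`, with products of the exact orders prescribed by `M`
and with an inversion cocycle `n` valued in `ZMod 2`. -/
structure CoxeterModel {S : Type*} (M : S → S → ℕ∞) (W : Type*) [Group W] where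
  σ : S → W
  closure_range : Subgroup.closure (Set.range σ) = ⊤
  inj : Function.Injective σ
  sq : ∀ s, σ s * σ s = 1
  pow : ∀ s t, s ≠ t → ∀ m : ℕ, M s t = m → (σ s * σ t) ^ m = 1
  order : ∀ s t, s ≠ t → ∀ k : ℕ, (σ s * σ t) ^ k = 1 → k = 0 ∨ ∃ m : ℕ, M s t = m ∧ m ∣ k
  n : W → W → ZMod 2
  n_mul : ∀ u v r, n (u * v) r = n u r + n v (u⁻¹ * r * u)
  n_gen_self : ∀ s, n (σ s) (σ s) = 1
  n_gen_of_ne : ∀ s r, r ≠ σ s → n (σ s) r = 0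

section Reflections

open Module Polynomial.Chebyshev

variable {V : Type*} [AddCommGroup V] [Module ℝ V] {x y : V} {f g : Dual ℝ V}

lemma chebyshev_S_eval_eq (θ : ℝ) (h : Real.sin θ ≠ 0) (n : ℤ) :
    (S ℝ n).eval (2 * Real.cos θ) = Real.sin ((n + 1) * θ) / Real.sin θ := by
  rw [eq_div_iff h, S_two_mul_real_cos]

lemma reflection_pair_pow_eq_one (hf : f x = 2) (hg : g y = 2) (m : ℕ) (hm : 3 ≤ m)
    (h : f y * g x - 2 = 2 * Real.cos (2 * (Real.pi / m))) :
    (reflection hf * reflection hg) ^ m = 1 := by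
  have hm0 : (0 : ℝ) < m := by positivity
  have hm3 : (3 : ℝ) ≤ m := by exact_mod_cast hm
  have hlt : 2 * (Real.pi / m) < Real.pi := by
    rw [← mul_div_assoc, div_lt_iff₀ hm0]; nlinarith [Real.pi_pos]
  have hs : Real.sin (2 * (Real.pi / m)) ≠ 0 :=
    (Real.sin_pos_of_pos_of_lt_pi (by positivity) hlt).ne'
  ext z
  rw [reflection_mul_reflection_pow_apply hf hg m z _ h.symm]
  obtain ⟨j, hj⟩ | ⟨j, hj⟩ := Nat.even_or_odd m
  · have hk : ((m : ℤ) - 2) / 2 = j - 1 ∧ ((m : ℤ) - 1) / 2 = j - 1 := by omega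
    have h0 : (S ℝ ((j : ℤ) - 1)).eval (2 * Real.cos (2 * (Real.pi / m))) = 0 := by
      rw [chebyshev_S_eval_eq _ hs]
      have : (((j : ℤ) - 1 : ℤ) + 1 : ℝ) * (2 * (Real.pi / m)) = Real.pi := by
        push_cast
        have : (m : ℝ) = j + j := by exact_mod_cast hj
        field_simp
        linarith
      rw [this]; simp
    rw [hk.1, hk.2, h0]; simp
  · have hk : ((m : ℤ) - 2) / 2 = j - 1 ∧ ((m : ℤ) - 1) / 2 = j ∧ ((m : ℤ) - 3) / 2 = j - 1 ∧
        (m : ℤ) / 2 = j := by omega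
    have h0 : (S ℝ (j : ℤ)).eval (2 * Real.cos (2 * (Real.pi / m))) +
        (S ℝ ((j : ℤ) - 1)).eval (2 * Real.cos (2 * (Real.pi / m))) = 0 := by
      rw [chebyshev_S_eval_eq _ hs, chebyshev_S_eval_eq _ hs, ← add_div]
      have hmj : (m : ℝ) = 2 * j + 1 := by exact_mod_cast hj
      have e1 : (((j : ℤ) : ℝ) + 1) * (2 * (Real.pi / m)) = Real.pi + Real.pi / m := by
        push_cast; field_simp; rw [hmj]; ring
      have e2 : (((j : ℤ) - 1 : ℤ) + 1 : ℝ) * (2 * (Real.pi / m)) = Real.pi - Real.pi / m := by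
        push_cast; field_simp; rw [hmj]; ring
      rw [e1, e2, Real.sin_pi_sub, Real.sin_add]; simp
    rw [hk.1, hk.2.1, hk.2.2.1, hk.2.2.2, h0]; simp

lemma dvd_of_reflection_pair_pow_eq_one (hf : f x = 2) (hg : g y = 2) (m : ℕ) (hm : 3 ≤ m)
    (h : f y * g x - 2 = 2 * Real.cos (2 * (Real.pi / m))) (hli : LinearIndependent ℝ ![x, y])
    (hgx : g x ≠ 0) (k : ℕ) (hk : (reflection hf * reflection hg) ^ k = 1) : m ∣ k := by
  have hm0 : (0 : ℝ) < m := by positivity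
  have hm3 : (3 : ℝ) ≤ m := by exact_mod_cast hm
  have hlt : 2 * (Real.pi / m) < Real.pi := by
    rw [← mul_div_assoc, div_lt_iff₀ hm0]; nlinarith [Real.pi_pos]
  have hs : Real.sin (2 * (Real.pi / m)) ≠ 0 :=
    (Real.sin_pos_of_pos_of_lt_pi (by positivity) hlt).ne'
  have e := reflection_mul_reflection_pow_apply_self hf hg k _ h.symm
  rw [hk, LinearEquiv.coe_one, id] at e
  rw [LinearIndependent.pair_iff] at hli
  have := hli (_ - 1) _ (by rw [sub_smul, sub_add_eq_add_sub, ← e]; simp)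
  obtain ⟨e1, e2⟩ := this
  have e3 : (S ℝ ((k : ℤ) - 1)).eval (2 * Real.cos (2 * (Real.pi / m))) = 0 := by
    simpa [hgx] using e2
  rw [e3, add_zero, sub_eq_zero] at e1
  rw [chebyshev_S_eval_eq _ hs, div_eq_iff hs, zero_mul] at e3
  rw [chebyshev_S_eval_eq _ hs, div_eq_iff hs, one_mul] at e1
  push_cast at e3 e1
  rw [sub_add_cancel] at e3
  rw [add_mul, one_mul, Real.sin_add, e3, zero_mul, zero_add] at e1
  have hc : Real.cos (k * (2 * (Real.pi / m))) = 1 := by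
    exact mul_right_cancel₀ hs (by linarith)
  rw [Real.cos_eq_one_iff] at hc
  obtain ⟨z, hz⟩ := hc
  have : (z : ℝ) * m = k := by
    have hp := Real.pi_pos
    field_simp at hz
    linarith
  have : z * m = k := by exact_mod_cast this
  exact Int.natCast_dvd_natCast.mp ⟨z, by rw [← this, mul_comm]⟩

lemma eq_zero_of_reflection_pair_pow_eq_one (hf : f x = 2) (hg : g y = 2)
    (h : f y * g x - 2 = 2) (hli : LinearIndependent ℝ ![x, y])
    (hgx : g x ≠ 0) (k : ℕ) (hk : (reflection hf * reflection hg) ^ k = 1) : k = 0 := by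
  have e := reflection_mul_reflection_pow_apply_self hf hg k _ h.symm
  rw [hk, LinearEquiv.coe_one, id] at e
  rw [LinearIndependent.pair_iff] at hli
  have := hli (_ - 1) _ (by rw [sub_smul, sub_add_eq_add_sub, ← e]; simp)
  obtain ⟨e1, e2⟩ := this
  have e3 : (S ℝ ((k : ℤ) - 1)).eval 2 = 0 := by
    simpa [hgx] using e2
  rw [S_eval_two] at e3
  push_cast at e3
  exact_mod_cast (by linarith : (k : ℝ) = 0)

end Reflections

namespace CoxeterSystem

variable {B W : Type*} [Group W] {C : CoxeterMatrix B} (cs : CoxeterSystem C W)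

open scoped Classical in
/-- The involution of `W × ZMod 2` attached to a simple reflection. -/
noncomputable def parityPerm (i : B) : Equiv.Perm (W × ZMod 2) :=
  Function.Involutive.toPerm
    (fun p => (cs.simple i * p.1 * cs.simple i, p.2 + if p.1 = cs.simple i then 1 else 0)) (by
      rintro ⟨r, ε⟩
      have h : cs.simple i * r * cs.simple i = cs.simple i ↔ r = cs.simple i := by
        rw [mul_eq_right, mul_eq_one_iff_inv_eq, cs.inv_simple, eq_comm]
      ext
      · simp [mul_assoc]
      · simp only [h]
        split_ifs
        · rw [add_assoc, CharTwo.add_self_eq_zero, add_zero]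
        · simp)

open scoped Classical in
lemma parityPerm_apply (i : B) (p : W × ZMod 2) : cs.parityPerm i p =
    (cs.simple i * p.1 * cs.simple i, p.2 + if p.1 = cs.simple i then 1 else 0) := rfl

open scoped Classical in
lemma parityPerm_mul_pow_apply (i j : B) (k : ℕ) (r : W) (ε : ZMod 2) :
    ((cs.parityPerm i * cs.parityPerm j) ^ k) (r, ε) =
      ((cs.simple i * cs.simple j) ^ k * r * ((cs.simple i * cs.simple j) ^ k)⁻¹,
        ε + ∑ a ∈ Finset.range (2 * k),
          if r = cs.simple j * (cs.simple i * cs.simple j) ^ a then 1 else 0) := by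
  set z := cs.simple i * cs.simple j with hz
  have hzinv : z⁻¹ = cs.simple j * cs.simple i := by simp [hz]
  have hconj : ∀ k : ℕ, (z ^ k)⁻¹ * cs.simple j = cs.simple j * z ^ k := by
    intro k
    have : SemiconjBy (cs.simple j) z z⁻¹ := by simp [SemiconjBy, hz, mul_assoc]
    rw [← inv_pow]
    exact (this.pow_right k).symm
  induction k with
  | zero => simp
  | succ k ih =>
    rw [pow_succ', Equiv.Perm.mul_apply, ih, Equiv.Perm.mul_apply]
    have e1 : z ^ k * r * (z ^ k)⁻¹ = cs.simple j ↔ r = cs.simple j * z ^ (2 * k) := by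
      rw [mul_inv_eq_iff_eq_mul, ← eq_inv_mul_iff_mul_eq, ← mul_assoc, hconj, two_mul, pow_add,
        mul_assoc]
    have e2 : cs.simple j * (z ^ k * r * (z ^ k)⁻¹) * cs.simple j = cs.simple i ↔
        r = cs.simple j * z ^ (2 * k + 1) := by
      have : r = cs.simple j * z ^ (2 * k + 1) ↔ r = (z ^ (k + 1))⁻¹ * cs.simple j * z ^ k := by
        rw [hconj, mul_assoc, ← pow_add, show k + 1 + k = 2 * k + 1 by ring]
      have h (X : W) : cs.simple j * X * cs.simple j = cs.simple i ↔ z * X = cs.simple j := by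
        constructor
        · intro h
          simpa [hz, mul_assoc] using congrArg (fun w => cs.simple i * w * cs.simple j) h
        · intro h
          simpa [hz, mul_assoc] using congrArg (fun w => cs.simple i * w * cs.simple j) h
      rw [this, h, mul_assoc _⁻¹, eq_inv_mul_iff_mul_eq, ← mul_inv_eq_iff_eq_mul]
      simp only [pow_succ', mul_assoc]
    simp only [parityPerm_apply, e1, e2]
    rw [show 2 * (k + 1) = 2 * k + 1 + 1 by ring, Finset.sum_range_succ, Finset.sum_range_succ]
    ext
    · simp [hz, pow_succ', mul_assoc]
    · simp only [add_assoc]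

lemma parityPerm_isLiftable : C.IsLiftable cs.parityPerm := by
  classical
  intro i j
  ext1 ⟨r, ε⟩
  rw [parityPerm_mul_pow_apply, two_mul, Finset.sum_range_add]
  simp [pow_add, cs.simple_mul_simple_pow, CharTwo.add_self_eq_zero]

/-- The inversion cocycle: the parity of the number of occurrences of `r` among the left
inversions of a word for `w`. -/
noncomputable def inversionParity (w r : W) : ZMod 2 :=
  (cs.lift ⟨_, cs.parityPerm_isLiftable⟩ w⁻¹ (r, 0)).2

lemma lift_parityPerm_apply (w r : W) (ε : ZMod 2) :
    cs.lift ⟨_, cs.parityPerm_isLiftable⟩ w (r, ε) =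
      (w * r * w⁻¹, ε + (cs.lift ⟨_, cs.parityPerm_isLiftable⟩ w (r, 0)).2) := by
  classical
  induction w using cs.simple_induction_left generalizing r ε with
  | one => simp
  | mul_simple_left w i ih =>
    rw [map_mul, Equiv.Perm.mul_apply, Equiv.Perm.mul_apply, ih, ih r 0, lift_apply_simple]
    simp [parityPerm_apply, mul_assoc, add_assoc]

lemma inversionParity_mul (u v r : W) : cs.inversionParity (u * v) r =
    cs.inversionParity u r + cs.inversionParity v (u⁻¹ * r * u) := by
  rw [inversionParity, mul_inv_rev, map_mul, Equiv.Perm.mul_apply, lift_parityPerm_apply _ u⁻¹,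
    lift_parityPerm_apply]
  simp [inversionParity]

end CoxeterSystem

section Existence

variable {S : Type u} (M : S → S → ℕ∞) (hsymm : ∀ s t, M s t = M t s)
  (hlarge : ∀ s t, s ≠ t → 3 ≤ M s t)

open scoped Classical in
/-- The Coxeter matrix attached to `M`, with `0` in place of `⊤`. -/
noncomputable def coxeterMatrixOf : CoxeterMatrix S where
  M := Matrix.of fun s t => if s = t then 1 else (M s t).toNat
  isSymm := by ext s t; simp [hsymm s t, eq_comm]
  diagonal s := by simp
  off_diagonal s t h := by
    have := hlarge s t h
    simp only [Matrix.of_apply, h, if_false]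
    intro e
    cases hM : M s t with
    | top => simp [hM] at e
    | coe m => rw [hM] at e this; norm_cast at this; simp at e; omega

open scoped Classical in
/-- The Gram matrix of the geometric representation. -/
noncomputable def cosineMatrix (s t : S) : ℝ :=
  if s = t then 2 else if M s t = ⊤ then -2 else -2 * Real.cos (Real.pi / (M s t).toNat)

/-- The form dual to a simple root. -/
noncomputable def simpleCoroot (s : S) : Module.Dual ℝ (S →₀ ℝ) :=
  Finsupp.linearCombination ℝ (cosineMatrix M s)

lemma simpleCoroot_single (s t : S) :
    simpleCoroot M s (Finsupp.single t 1) = cosineMatrix M s t := by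
  simp [simpleCoroot]

lemma simpleCoroot_self (s : S) : simpleCoroot M s (Finsupp.single s 1) = 2 := by
  simp [simpleCoroot, cosineMatrix]

lemma linearIndependent_single_pair {s t : S} (h : s ≠ t) :
    LinearIndependent ℝ ![(Finsupp.single s 1 : S →₀ ℝ), Finsupp.single t 1] := by
  rw [LinearIndependent.pair_iff]
  intro a b e
  have h1 := DFunLike.congr_fun e s
  have h2 := DFunLike.congr_fun e t
  simp [h, h.symm] at h1 h2
  exact ⟨h1, h2⟩

include hsymm in
lemma simpleCoroot_pair_of_coe {s t : S} (h : s ≠ t) {m : ℕ} (hm : M s t = m) :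
    simpleCoroot M s (Finsupp.single t 1) * simpleCoroot M t (Finsupp.single s 1) - 2 =
      2 * Real.cos (2 * (Real.pi / m)) := by
  rw [simpleCoroot_single, simpleCoroot_single, cosineMatrix, cosineMatrix, if_neg h,
    if_neg h.symm, ← hsymm s t, hm, if_neg (ENat.natCast_ne_top m), ENat.toNat_natCast, Real.cos_two_mul]
  ring

include hsymm in
lemma simpleCoroot_pair_of_top {s t : S} (h : s ≠ t) (hm : M s t = ⊤) :
    simpleCoroot M s (Finsupp.single t 1) * simpleCoroot M t (Finsupp.single s 1) - 2 = 2 := by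
  rw [simpleCoroot_single, simpleCoroot_single, cosineMatrix, cosineMatrix, if_neg h,
    if_neg h.symm, ← hsymm s t, hm, if_pos rfl]
  norm_num

include hlarge in
lemma three_le_of_eq_coe {s t : S} (h : s ≠ t) {m : ℕ} (hm : M s t = m) : 3 ≤ m := by
  have := hlarge s t h
  rw [hm] at this
  exact_mod_cast this

include hlarge in
lemma simpleCoroot_single_ne_zero {s t : S} (h : s ≠ t) :
    simpleCoroot M s (Finsupp.single t 1) ≠ 0 := by
  rw [simpleCoroot_single, cosineMatrix, if_neg h]
  split_ifs with ht
  · norm_num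
  · obtain ⟨m, hm⟩ := ENat.ne_top_iff_exists.1 ht
    have h3 := three_le_of_eq_coe M hlarge h hm.symm
    have hm3 : (3 : ℝ) ≤ m := by exact_mod_cast h3
    rw [← hm, ENat.toNat_natCast]
    have := Real.cos_pos_of_mem_Ioo (x := Real.pi / m)
      ⟨by have := Real.pi_pos; have : 0 < Real.pi / m := by positivity
          linarith, by
        apply div_lt_div_of_pos_left Real.pi_pos <;> linarith⟩
    simp [this.ne']

lemma coxeterMatrixOf_apply {s t : S} (h : s ≠ t) :
    coxeterMatrixOf M hsymm hlarge s t = (M s t).toNat := by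
  simp [coxeterMatrixOf, h]

lemma simpleCoroot_isLiftable : (coxeterMatrixOf M hsymm hlarge).IsLiftable
    (fun s => Module.reflection (simpleCoroot_self M s)) := by
  intro s t
  obtain rfl | h := eq_or_ne s t
  · ext1 x
    simpa using Module.involutive_reflection (simpleCoroot_self M s) x
  · rw [coxeterMatrixOf_apply M hsymm hlarge h]
    cases hM : M s t with
    | top => simp
    | coe m =>
      exact reflection_pair_pow_eq_one _ _ m (three_le_of_eq_coe M hlarge h hM)
        (simpleCoroot_pair_of_coe M hsymm h hM)

/-- The Coxeter group attached to `M` is a Coxeter model. -/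
noncomputable def coxeterModelOf : CoxeterModel M (coxeterMatrixOf M hsymm hlarge).Group :=
  let cs := (coxeterMatrixOf M hsymm hlarge).toCoxeterSystem
  have order : ∀ s t, s ≠ t → ∀ k : ℕ, (cs.simple s * cs.simple t) ^ k = 1 →
      k = 0 ∨ ∃ m : ℕ, M s t = m ∧ m ∣ k := by
    intro s t h k hk
    have := congrArg (cs.lift ⟨_, simpleCoroot_isLiftable M hsymm hlarge⟩) hk
    rw [map_pow, map_mul, map_one, cs.lift_apply_simple, cs.lift_apply_simple] at this
    cases hM : M s t with
    | top =>
      left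
      exact eq_zero_of_reflection_pair_pow_eq_one _ _
        (simpleCoroot_pair_of_top M hsymm h hM) (linearIndependent_single_pair h)
        (simpleCoroot_single_ne_zero M hlarge h.symm) k this
    | coe m =>
      right
      exact ⟨m, rfl, dvd_of_reflection_pair_pow_eq_one _ _ m
        (three_le_of_eq_coe M hlarge h hM)
        (simpleCoroot_pair_of_coe M hsymm h hM) (linearIndependent_single_pair h)
        (simpleCoroot_single_ne_zero M hlarge h.symm) k this⟩
  { σ := cs.simple
    closure_range := cs.subgroup_closure_range_simple
    inj := fun s t hst => by
      by_contra h
      rcases order s t h 1 (by rw [hst, pow_one, cs.simple_mul_simple_self]) with h1 | ⟨m, hm, h1⟩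
      · omega
      · have := three_le_of_eq_coe M hlarge h hm
        have := Nat.le_of_dvd one_pos h1
        omega
    sq := cs.simple_mul_simple_self
    pow := fun s t h m hm => by
      have := cs.simple_mul_simple_pow s t
      rwa [coxeterMatrixOf_apply M hsymm hlarge h, hm, ENat.toNat_natCast] at this
    order := order
    n := cs.inversionParity
    n_mul := cs.inversionParity_mul
    n_gen_self := fun s => by
      simp [CoxeterSystem.inversionParity, cs.inv_simple, cs.lift_apply_simple,
        CoxeterSystem.parityPerm_apply]
    n_gen_of_ne := fun s r h => by
      simp [CoxeterSystem.inversionParity, cs.inv_simple, cs.lift_apply_simple,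
        CoxeterSystem.parityPerm_apply, h] }

end Existence

/-! ### Alternating products and Artin groups -/

/-- The product `f (k-1) ⋯ f 1 f 0`. -/
def revProd {G : Type*} [Monoid G] (f : ℕ → G) : ℕ → G
  | 0 => 1
  | k + 1 => f k * revProd f k

/-- The alternating product `⋯ b a b a` with `k` factors. -/
def altProd {G : Type*} [Monoid G] (k : ℕ) (a b : G) : G :=
  revProd (fun i => if i % 2 = 0 then a else b) k

section AltProd

variable {G H : Type*} [Monoid G] [Monoid H]

lemma revProd_congr {f g : ℕ → G} {k : ℕ} (h : ∀ i < k, f i = g i) :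
    revProd f k = revProd g k := by
  induction k with
  | zero => rfl
  | succ k ih => rw [revProd, revProd, h k (by omega), ih fun i hi => h i (by omega)]

lemma map_revProd (φ : G →* H) (f : ℕ → G) (k : ℕ) :
    φ (revProd f k) = revProd (fun i => φ (f i)) k := by
  induction k with
  | zero => simp [revProd]
  | succ k ih => simp [revProd, ih]

lemma map_altProd (φ : G →* H) (k : ℕ) (a b : G) :
    φ (altProd k a b) = altProd k (φ a) (φ b) := by
  rw [altProd, map_revProd]
  congr 1
  ext i
  split_ifs <;> rfl

lemma revProd_add (f : ℕ → G) (k l : ℕ) :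
    revProd f (k + l) = revProd (fun i => f (k + i)) l * revProd f k := by
  induction l with
  | zero => simp [revProd]
  | succ l ih => rw [← add_assoc, revProd, ih, revProd, mul_assoc]

lemma revProd_eq_one {f : ℕ → G} {k : ℕ} (h : ∀ i < k, f i = 1) : revProd f k = 1 := by
  induction k with
  | zero => rfl
  | succ k ih => rw [revProd, h k (by omega), ih fun i hi => h i (by omega), one_mul]

lemma revProd_eq_single {f : ℕ → G} {k j : ℕ} (hj : j < k) (h : ∀ i < k, i ≠ j → f i = 1) :
    revProd f k = f j := by
  obtain ⟨l, rfl⟩ := Nat.exists_eq_add_of_lt hj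
  rw [show j + l + 1 = j + 1 + l by ring, revProd_add, revProd, revProd_eq_one, revProd_eq_one]
  · simp
  · intro i hi; exact h i (by omega) (by omega)
  · intro i hi; exact h _ (by omega) (by omega)

/-- Only one factor in each block of length `n` is nontrivial. -/
lemma revProd_blocks {f : ℕ → G} {n i₀ : ℕ} (h0 : i₀ < n) (k : ℕ)
    (h : ∀ i < n * k, i % n ≠ i₀ → f i = 1) :
    revProd f (n * k) = revProd (fun j => f (i₀ + n * j)) k := by
  induction k with
  | zero => rfl
  | succ k ih =>
    rw [mul_add, mul_one, revProd_add, ih, revProd, revProd_eq_single h0, add_comm]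
    · intro i hi hne
      apply h _ (by rw [mul_add]; omega)
      rwa [Nat.mul_add_mod, Nat.mod_eq_of_lt hi]
    · intro i hi
      exact h i (by rw [mul_add]; omega)

lemma altProd_succ (k : ℕ) (a b : G) : altProd (k + 1) a b =
    (if k % 2 = 0 then a else b) * altProd k a b := rfl

lemma altProd_add (k l : ℕ) (a b : G) : altProd (k + l) a b =
    (if k % 2 = 0 then altProd l a b else altProd l b a) * altProd k a b := by
  rw [altProd, revProd_add]
  split_ifs with h
  all_goals
    congr 1
    apply revProd_congr
    intro i _
    simp only [Nat.add_mod k i, h]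
    rcases Nat.mod_two_eq_zero_or_one i with h1 | h1 <;>
      rcases Nat.mod_two_eq_zero_or_one k with h2 | h2 <;> simp_all

lemma altProd_mul_comm {m : ℕ} {a b : G} (h : altProd m a b = altProd m b a) (q : ℕ) :
    altProd (m * q) a b = altProd (m * q) b a := by
  induction q with
  | zero => rfl
  | succ q ih => rw [mul_add, mul_one, altProd_add, altProd_add _ _ b a, ih, h]

lemma altProd_two_mul (k : ℕ) (a b : G) : altProd (2 * k) a b = (b * a) ^ k := by
  induction k with
  | zero => simp [altProd, revProd]
  | succ k ih =>
    rw [show 2 * (k + 1) = 2 * k + 1 + 1 by ring, altProd_succ, altProd_succ, ih, pow_succ',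
      if_neg (by omega), if_pos (by omega), mul_assoc]

lemma altProd_succ_right (k : ℕ) (a b : G) : altProd (k + 1) a b = altProd k b a * a := by
  rw [add_comm, altProd_add]
  simp [altProd, revProd]

lemma prod_range_alt (k : ℕ) (a b : G) :
    ((List.range k).map fun i => if i % 2 = 0 then a else b).prod =
      if k % 2 = 0 then altProd k b a else altProd k a b := by
  induction k with
  | zero => simp [altProd, revProd]
  | succ k ih =>
    rw [List.range_succ, List.map_append, List.prod_append, ih]
    rcases Nat.mod_two_eq_zero_or_one k with h | h
    · simp [h, show (k + 1) % 2 = 1 by omega, altProd_succ_right]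
    · simp [h, show (k + 1) % 2 = 0 by omega, altProd_succ_right]

end AltProd

lemma lift_braidWord {S G : Type*} [Group G] (f : S → G) (k : ℕ) (s t : S) :
    FreeGroup.lift f (braidWord k s t) =
      if k % 2 = 0 then altProd k (f t) (f s) else altProd k (f s) (f t) := by
  rw [← prod_range_alt, braidWord, map_list_prod, List.map_map]
  congr 2
  ext i
  simp only [Function.comp_apply]
  split_ifs <;> simp

namespace ArtinGroup

variable {S : Type*} {M : S → S → ℕ∞}

/-- The standard generators. -/
def gen (M : S → S → ℕ∞) (s : S) : ArtinGroup M := PresentedGroup.of s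

lemma altProd_gen {s t : S} (h : s ≠ t) {m : ℕ} (hm : M s t = m) :
    altProd m (gen M s) (gen M t) = altProd m (gen M t) (gen M s) := by
  have h1 : PresentedGroup.mk (artinRels M) (braidWord m s t * (braidWord m t s)⁻¹) = 1 :=
    PresentedGroup.one_of_mem ⟨s, t, h, m, hm, rfl⟩
  have h2 : PresentedGroup.mk (artinRels M) = FreeGroup.lift (gen M) := by
    ext s; simp [gen, PresentedGroup.of]
  rw [h2, map_mul, map_inv, mul_inv_eq_one, lift_braidWord, lift_braidWord] at h1
  split_ifs at h1
  exacts [h1.symm, h1]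

/-- The universal property of Artin groups. -/
def lift {G : Type*} [Group G] (f : S → G) (hf : ∀ s t, s ≠ t → ∀ m : ℕ, M s t = m →
    altProd m (f s) (f t) = altProd m (f t) (f s)) : ArtinGroup M →* G :=
  PresentedGroup.toGroup (f := f) (by
    rintro _ ⟨s, t, hst, m, hm, rfl⟩
    rw [map_mul, map_inv, mul_inv_eq_one, lift_braidWord, lift_braidWord]
    split_ifs
    exacts [(hf s t hst m hm).symm, hf s t hst m hm])

@[simp]
lemma lift_gen {G : Type*} [Group G] (f : S → G) (hf : ∀ s t, s ≠ t → ∀ m : ℕ, M s t = m →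
    altProd m (f s) (f t) = altProd m (f t) (f s)) (s : S) : lift f hf (gen M s) = f s :=
  PresentedGroup.toGroup.of _

lemma closure_gen : Subgroup.closure (Set.range (gen M)) = ⊤ :=
  PresentedGroup.closure_range_of _

/-- The standard parabolic subgroup. -/
abbrev par (M : S → S → ℕ∞) (X : Set S) : Subgroup (ArtinGroup M) := StandardParabolic M X

lemma par_eq (X : Set S) : par M X = Subgroup.closure (gen M '' X) := rfl

lemma par_univ : par M Set.univ = ⊤ := by
  rw [par_eq, Set.image_univ, closure_gen]

lemma par_empty : par M ∅ = ⊥ := by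
  rw [par_eq, Set.image_empty, Subgroup.closure_empty]

lemma par_mono {X Y : Set S} (h : X ⊆ Y) : par M X ≤ par M Y :=
  Subgroup.closure_mono (Set.image_mono h)

lemma gen_mem_par {X : Set S} {s : S} (h : s ∈ X) : gen M s ∈ par M X :=
  Subgroup.subset_closure ⟨s, h, rfl⟩

/-- The homomorphism from the Artin group of a subset of the generators. -/
def incl (M : S → S → ℕ∞) (Y : Set S) : ArtinGroup (fun a b : Y => M a b) →* ArtinGroup M :=
  lift (fun s => gen M s) fun _ _ h _ hm => altProd_gen (Subtype.coe_injective.ne h) hm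

@[simp]
lemma incl_gen (Y : Set S) (s : Y) : incl M Y (gen _ s) = gen M s := lift_gen _ _ _

lemma map_incl_par (Y : Set S) (Z : Set Y) :
    (par (fun a b : Y => M a b) Z).map (incl M Y) = par M (Subtype.val '' Z) := by
  rw [par_eq, par_eq, MonoidHom.map_closure]
  congr 1
  ext x
  simp [Set.mem_image, incl_gen]

lemma range_incl (Y : Set S) : (incl M Y).range = par M Y := by
  rw [MonoidHom.range_eq_map, ← par_univ, map_incl_par, Set.image_univ, Subtype.range_coe]

end ArtinGroup

/-! ### Minimal coset representatives -/

namespace CoxeterModel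

variable {S W : Type*} [Group W] {M : S → S → ℕ∞} (K : CoxeterModel M W)

/-- Standard parabolic subgroups of the Coxeter group. -/
def par (Y : Set S) : Subgroup W := Subgroup.closure (K.σ '' Y)

/-- The element given by a word. -/
def word (l : List S) : W := (l.map K.σ).prod

/-- `w` is reduced on the right with respect to `Y`. -/
def IsRed (Y : Set S) (w : W) : Prop := ∀ t ∈ Y, K.n w⁻¹ (K.σ t) = 0

variable {K} {Y : Set S}

lemma inv_σ (s : S) : (K.σ s)⁻¹ = K.σ s := inv_eq_of_mul_eq_one_left (K.sq s)

lemma n_one (r : W) : K.n 1 r = 0 := by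
  have := K.n_mul 1 1 r
  simpa using this

lemma word_cons (s : S) (l : List S) : K.word (s :: l) = K.σ s * K.word l := by simp [word]

lemma word_append (l l' : List S) : K.word (l ++ l') = K.word l * K.word l' := by simp [word]

lemma σ_mem_par {s : S} (h : s ∈ Y) : K.σ s ∈ K.par Y := Subgroup.subset_closure ⟨s, h, rfl⟩

lemma par_mono {X Y : Set S} (h : X ⊆ Y) : K.par X ≤ K.par Y :=
  Subgroup.closure_mono (Set.image_mono h)

lemma exists_word {w : W} (h : w ∈ K.par Y) : ∃ l : List S, (∀ s ∈ l, s ∈ Y) ∧ K.word l = w := by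
  induction h using Subgroup.closure_induction with
  | mem x hx => obtain ⟨s, hs, rfl⟩ := hx; exact ⟨[s], by simpa using hs, by simp [word]⟩
  | one => exact ⟨[], by simp, rfl⟩
  | mul x y _ _ hx hy =>
    obtain ⟨l, hl, rfl⟩ := hx
    obtain ⟨l', hl', rfl⟩ := hy
    exact ⟨l ++ l', by simpa [or_imp, forall_and] using ⟨hl, hl'⟩, word_append l l'⟩
  | inv x _ hx =>
    obtain ⟨l, hl, rfl⟩ := hx
    refine ⟨l.reverse, by simpa using hl, ?_⟩
    rw [word, word, List.prod_inv_reverse, List.map_map, List.map_reverse]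
    congr 3
    ext s
    simp [inv_σ]

/-- The deletion property. -/
lemma exists_shorter_word (l : List S) (r : W) (h : K.n (K.word l) r ≠ 0) :
    ∃ l' : List S, l'.length < l.length ∧ (∀ s ∈ l', s ∈ l) ∧ r * K.word l = K.word l' := by
  induction l generalizing r with
  | nil => simp [word, n_one] at h
  | cons s l ih =>
    by_cases hr : r = K.σ s
    · exact ⟨l, by simp, by simp +contextual, by rw [word_cons, hr, ← mul_assoc, K.sq, one_mul]⟩
    · rw [word_cons, K.n_mul, K.n_gen_of_ne s r hr, zero_add, inv_σ] at h
      obtain ⟨l', h1, h2, h3⟩ := ih _ h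
      refine ⟨s :: l', by simpa using h1, ?_, ?_⟩
      · simpa using fun a ha => Or.inr (h2 a ha)
      · rw [word_cons, word_cons, ← h3]
        simp only [← mul_assoc, K.sq, one_mul]

variable (K Y) in
/-- Every coset of a standard parabolic contains an element inverted by none of its elements. -/
lemma exists_rep (w : W) : ∃ v ∈ K.par Y, ∀ r ∈ K.par Y, K.n (v * w) r = 0 := by
  classical
  have hne : ∃ N : ℕ, ∃ l : List S, l.length = N ∧ ∃ v ∈ K.par Y, v * w = K.word l := by
    obtain ⟨l, -, hl⟩ := exists_word (K := K) (Y := Set.univ) (w := w)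
      (by rw [par, Set.image_univ, K.closure_range]; trivial)
    exact ⟨_, l, rfl, 1, one_mem _, by rw [hl, one_mul]⟩
  obtain ⟨l, hl, v, hv, e⟩ := Nat.find_spec hne
  refine ⟨v, hv, fun r hr => ?_⟩
  by_contra hn
  rw [e] at hn
  obtain ⟨l', h1, -, h3⟩ := exists_shorter_word l r hn
  exact Nat.find_min hne (hl ▸ h1) ⟨l', rfl, r * v, mul_mem hr hv, by rw [← h3, ← e, mul_assoc]⟩

lemma eq_one_of_red_left {v w : W} (hv : v ∈ K.par Y) (hw : ∀ r ∈ K.par Y, K.n w r = 0)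
    (h : ∀ t ∈ Y, K.n (v * w) (K.σ t) = 0) : v = 1 := by
  classical
  have hne : ∃ N : ℕ, ∃ l : List S, l.length = N ∧ (∀ s ∈ l, s ∈ Y) ∧ K.word l = v := by
    obtain ⟨l, h1, h2⟩ := exists_word hv
    exact ⟨_, l, rfl, h1, h2⟩
  obtain ⟨l, hl, hlY, rfl⟩ := Nat.find_spec hne
  cases l with
  | nil => rfl
  | cons t l =>
    exfalso
    have htY : t ∈ Y := hlY t (by simp)
    have h1 := h t htY
    rw [K.n_mul, hw _ (mul_mem (mul_mem (inv_mem hv) (σ_mem_par htY)) hv), add_zero, word_cons,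
      K.n_mul, K.n_gen_self, inv_σ, mul_assoc, K.sq, mul_one] at h1
    have h2 : K.n (K.word l) (K.σ t) ≠ 0 := fun h0 => by rw [h0] at h1; simp at h1
    obtain ⟨l', h3, h4, h5⟩ := exists_shorter_word l _ h2
    refine Nat.find_min hne (m := l'.length) ?_ ⟨l', rfl, fun s hs => hlY s ?_, ?_⟩
    · rw [← hl]; simp; omega
    · simp [h4 s hs]
    · rw [word_cons, h5]

lemma red_unique {w v : W} (hw : K.IsRed Y w) (hv : v ∈ K.par Y) (h : K.IsRed Y (w * v)) :
    v = 1 := by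
  obtain ⟨x, hx, hx'⟩ := exists_rep K Y w⁻¹
  have h1 : x⁻¹ = 1 := eq_one_of_red_left (inv_mem hx) hx' (by rw [inv_mul_cancel_left]; exact hw)
  have h2 : v⁻¹ * x⁻¹ = 1 := eq_one_of_red_left (mul_mem (inv_mem hv) (inv_mem hx)) hx' (by
    intro t ht
    have := h t ht
    rw [mul_inv_rev] at this
    rwa [mul_assoc, inv_mul_cancel_left])
  rw [h1, mul_one, inv_eq_one] at h2
  exact h2

lemma red_ext {w w' : W} (hw : K.IsRed Y w) (hw' : K.IsRed Y w') (h : w⁻¹ * w' ∈ K.par Y) :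
    w = w' := by
  have := red_unique hw h (by simpa using hw')
  rw [inv_mul_eq_one] at this
  exact this

lemma red_one : K.IsRed Y 1 := fun t _ => by rw [inv_one, n_one]

variable (K Y) in
lemma exists_red (w : W) : ∃ w', K.IsRed Y w' ∧ w⁻¹ * w' ∈ K.par Y := by
  obtain ⟨v, hv, h⟩ := exists_rep K Y w⁻¹
  refine ⟨w * v⁻¹, fun t ht => ?_, by simpa using hv⟩
  rw [mul_inv_rev, inv_inv]
  exact h _ (σ_mem_par ht)

lemma red_gen_mul {w : W} (hw : K.IsRed Y w) (s : S) :
    (∃ t ∈ Y, K.σ s * w = w * K.σ t) ∨ K.IsRed Y (K.σ s * w) := by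
  by_cases h : ∃ t ∈ Y, K.σ s * w = w * K.σ t
  · exact Or.inl h
  · refine Or.inr fun t ht => ?_
    rw [mul_inv_rev, K.n_mul, hw t ht, zero_add, inv_inv, inv_σ]
    apply K.n_gen_of_ne
    intro e
    exact h ⟨t, ht, by rw [← e]; group⟩

lemma mem_of_σ_mem_par {s : S} (h : K.σ s ∈ K.par Y) : s ∈ Y := by
  by_contra hs
  have h1 : K.IsRed Y (1 * K.σ s) := by
    intro t ht
    rw [one_mul, inv_σ]
    exact K.n_gen_of_ne _ _ fun e => hs (K.inj e ▸ ht)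
  have := red_unique red_one h h1
  have h2 := K.n_gen_self s
  rw [this, n_one] at h2
  exact zero_ne_one h2

lemma σ_ne_one (s : S) : K.σ s ≠ 1 := by
  intro h
  have h2 := K.n_gen_self s
  rw [h, n_one] at h2
  exact zero_ne_one h2

lemma exists_red_of_word {X : Set S} (l : List S) (hl : ∀ s ∈ l, s ∈ X) :
    ∃ w ∈ K.par X, ∃ v ∈ K.par (X ∩ Y), K.IsRed Y w ∧ K.word l = w * v := by
  induction l with
  | nil => exact ⟨1, one_mem _, 1, one_mem _, red_one, by simp [word]⟩
  | cons s l ih =>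
    obtain ⟨w, hw, v, hv, hr, e⟩ := ih fun t ht => hl t (by simp [ht])
    have hs : s ∈ X := hl s (by simp)
    rcases red_gen_mul hr s with ⟨t, ht, h⟩ | h
    · refine ⟨w, hw, K.σ t * v, mul_mem (σ_mem_par ⟨?_, ht⟩) hv, hr, ?_⟩
      · apply mem_of_σ_mem_par (K := K)
        rw [show K.σ t = w⁻¹ * (K.σ s * w) by rw [h]; group]
        exact mul_mem (inv_mem hw) (mul_mem (σ_mem_par hs) hw)
      · rw [word_cons, e, ← mul_assoc, h, mul_assoc]
    · exact ⟨K.σ s * w, mul_mem (σ_mem_par hs) hw, v, hv, h, by rw [word_cons, e, mul_assoc]⟩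

lemma par_inter {X : Set S} {w : W} (hX : w ∈ K.par X) (hY : w ∈ K.par Y) :
    w ∈ K.par (X ∩ Y) := by
  obtain ⟨l, hl, rfl⟩ := exists_word hX
  obtain ⟨w, hw, v, hv, hr, e⟩ := exists_red_of_word (K := K) (Y := Y) l hl
  rw [e] at hY ⊢
  have hvY : v ∈ K.par Y := par_mono Set.inter_subset_right hv
  have hwY : w ∈ K.par Y := (mul_mem_cancel_right hvY).1 hY
  have : w = 1 := red_unique (red_one (K := K)) hwY (by simpa using hr)
  rw [this, one_mul]
  exact hv

end CoxeterModel

/-! ### The retraction onto a standard parabolic subgroup -/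

namespace CoxeterModel

open ArtinGroup

variable {S W : Type*} [Group W] {M : S → S → ℕ∞} (K : CoxeterModel M W) (Y : Set S)

lemma altProd_mul_altProd_σ (k : ℕ) (a b : S) : altProd k (K.σ a) (K.σ b) *
    (if k % 2 = 0 then altProd k (K.σ b) (K.σ a) else altProd k (K.σ a) (K.σ b)) = 1 := by
  induction k generalizing a b with
  | zero => simp [altProd, revProd]
  | succ k ih =>
    have h1 := ih b a
    have h2 (x y : W) (h : x * y = 1) : (x * K.σ a) * (K.σ a * y) = 1 := by
      rw [mul_assoc, ← mul_assoc (K.σ a), K.sq, one_mul, h]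
    rcases Nat.mod_two_eq_zero_or_one k with hk | hk
    · have e := altProd_succ k (K.σ a) (K.σ b)
      rw [if_pos hk] at e h1
      rw [if_neg (by omega)]
      nth_rewrite 1 [altProd_succ_right]
      rw [e, h2 _ _ h1]
    · have e := altProd_succ k (K.σ b) (K.σ a)
      rw [if_neg (by omega)] at e h1
      rw [if_pos (by omega), altProd_succ_right k (K.σ a), e, h2 _ _ h1]

lemma altProd_σ {s t : S} (h : s ≠ t) {m : ℕ} (hm : M s t = m) :
    altProd m (K.σ s) (K.σ t) = altProd m (K.σ t) (K.σ s) := by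
  have h1 : altProd (m + m) (K.σ t) (K.σ s) = 1 := by
    rw [← two_mul, altProd_two_mul, K.pow s t h m hm]
  rw [altProd_add] at h1
  have h2 := K.altProd_mul_altProd_σ m s t
  have h3 := K.altProd_mul_altProd_σ m t s
  split_ifs at h1 h2 h3
  · exact mul_right_cancel (h2.trans h1.symm)
  · exact mul_right_cancel (h1.trans h3.symm)

/-- The projection to the Coxeter group. -/
def proj : ArtinGroup M →* W := ArtinGroup.lift K.σ fun _ _ h _ hm => K.altProd_σ h hm

@[simp]
lemma proj_gen (s : S) : K.proj (gen M s) = K.σ s := lift_gen _ _ _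

/-- The Artin group on a subset of the generators. -/
abbrev ASub (M : S → S → ℕ∞) (Y : Set S) := ArtinGroup (fun a b : Y => M a b)

/-- Reduced coset representatives. -/
abbrev Rep := {w : W // K.IsRed Y w}

variable {Y} in
open scoped Classical in
/-- The action of a generator on cosets. -/
noncomputable def step (s : S) (w : K.Rep Y) : K.Rep Y :=
  if h : ∃ t ∈ Y, K.σ s * w = w * K.σ t then w
  else ⟨K.σ s * w, (red_gen_mul w.2 s).resolve_left h⟩

variable {Y} in
open scoped Classical in
/-- The output of the transducer. -/
noncomputable def out (s : S) (w : K.Rep Y) : ASub M Y :=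
  if h : ∃ t : Y, K.σ s * w = w * K.σ t then gen _ h.choose else 1

/-- The Coxeter image of the element of a sub-Artin group. -/
def projSub : ASub M Y →* W := K.proj.comp (incl M Y)

variable {K Y}

lemma step_of_loop {s : S} {w : K.Rep Y} {t : Y} (h : K.σ s * w = w * K.σ t) :
    K.step s w = w := dif_pos ⟨t, t.2, h⟩

lemma out_of_loop {s : S} {w : K.Rep Y} {t : Y} (h : K.σ s * w = w * K.σ t) :
    K.out s w = gen _ t := by
  have h0 : ∃ t : Y, K.σ s * w = w * K.σ t := ⟨t, h⟩
  rw [out, dif_pos h0]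
  congr 1
  have := h.symm.trans h0.choose_spec
  exact (Subtype.ext (K.inj (mul_left_cancel this))).symm

lemma step_of_not_loop {s : S} {w : K.Rep Y} (h : ¬ ∃ t : Y, K.σ s * w = w * K.σ t) :
    (K.step s w : W) = K.σ s * w := by
  rw [step, dif_neg]
  rintro ⟨t, ht, h'⟩
  exact h ⟨⟨t, ht⟩, h'⟩

lemma out_of_not_loop {s : S} {w : K.Rep Y} (h : ¬ ∃ t : Y, K.σ s * w = w * K.σ t) :
    K.out s w = 1 := dif_neg h

lemma step_mul_out (s : S) (w : K.Rep Y) :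
    (K.step s w : W) * K.projSub Y (K.out s w) = K.σ s * w := by
  by_cases h : ∃ t : Y, K.σ s * w = w * K.σ t
  · obtain ⟨t, h⟩ := h
    rw [step_of_loop h, out_of_loop h, h]
    simp [projSub]
  · rw [step_of_not_loop h, out_of_not_loop h, map_one, mul_one]

lemma loop_step_iff (s : S) (w : K.Rep Y) :
    (∃ t : Y, K.σ s * K.step s w = K.step s w * K.σ t) ↔ ∃ t : Y, K.σ s * w = w * K.σ t := by
  by_cases h : ∃ t : Y, K.σ s * w = w * K.σ t
  · obtain ⟨t, h'⟩ := h
    rw [step_of_loop h']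
  · rw [step_of_not_loop h]
    refine iff_of_false ?_ h
    rintro ⟨t, ht⟩
    refine h ⟨t, ?_⟩
    rw [← mul_assoc, K.sq, one_mul] at ht
    nth_rewrite 2 [ht]
    rw [mul_assoc _ _ (K.σ t), K.sq, mul_one]

lemma step_step (s : S) (w : K.Rep Y) : K.step s (K.step s w) = w := by
  by_cases h : ∃ t : Y, K.σ s * w = w * K.σ t
  · obtain ⟨t, h⟩ := h
    rw [step_of_loop h, step_of_loop h]
  · have h' := h
    rw [← loop_step_iff] at h'
    ext
    rw [step_of_not_loop h', step_of_not_loop h, ← mul_assoc, K.sq, one_mul]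

lemma out_step (s : S) (w : K.Rep Y) : K.out s (K.step s w) = K.out s w := by
  by_cases h : ∃ t : Y, K.σ s * w = w * K.σ t
  · obtain ⟨t, h⟩ := h
    rw [step_of_loop h]
  · have h' := h
    rw [← loop_step_iff] at h'
    rw [out_of_not_loop h, out_of_not_loop h']

variable (K Y) in
/-- A generator acts on the induced set. -/
noncomputable def perm (s : S) : Equiv.Perm (K.Rep Y × ASub M Y) where
  toFun p := (K.step s p.1, K.out s p.1 * p.2)
  invFun p := (K.step s p.1, (K.out s p.1)⁻¹ * p.2)
  left_inv p := by simp [step_step, out_step]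
  right_inv p := by simp [step_step, out_step]

lemma perm_apply (s : S) (p : K.Rep Y × ASub M Y) :
    K.perm Y s p = (K.step s p.1, K.out s p.1 * p.2) := rfl

lemma loop_iff_mem_par (s : S) (w : K.Rep Y) :
    (∃ t : Y, K.σ s * w = w * K.σ t) ↔ (w : W)⁻¹ * (K.σ s * w) ∈ K.par Y := by
  constructor
  · rintro ⟨t, h⟩
    rw [h, inv_mul_cancel_left]
    exact σ_mem_par t.2
  · intro h
    by_contra hn
    have h1 := step_of_not_loop hn
    have h2 := red_ext w.2 (K.step s w).2 (by rwa [h1])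
    rw [h1, eq_comm, mul_eq_right] at h2
    exact σ_ne_one s h2

variable (K Y) in
/-- The reduced representative of a coset. -/
noncomputable def repOf (w : W) : K.Rep Y :=
  ⟨(exists_red K Y w).choose, (exists_red K Y w).choose_spec.1⟩

lemma repOf_spec (w : W) : w⁻¹ * K.repOf Y w ∈ K.par Y := (exists_red K Y w).choose_spec.2

lemma repOf_eq {w : W} {r : K.Rep Y} (h : w⁻¹ * r ∈ K.par Y) : K.repOf Y w = r := by
  refine Subtype.ext (red_ext (K.repOf Y w).2 r.2 ?_)
  have := mul_mem (inv_mem (K.repOf_spec (Y := Y) w)) h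
  simpa [mul_assoc] using this

lemma repOf_coe (r : K.Rep Y) : K.repOf Y r = r :=
  repOf_eq (by rw [inv_mul_cancel]; exact one_mem _)

lemma repOf_eq_iff {w w' : W} : K.repOf Y w = K.repOf Y w' ↔ w⁻¹ * w' ∈ K.par Y := by
  constructor
  · intro h
    have := mul_mem (K.repOf_spec (Y := Y) w) (inv_mem (K.repOf_spec (Y := Y) w'))
    rw [h] at this
    simpa [mul_assoc] using this
  · intro h
    apply repOf_eq
    have := mul_mem h (K.repOf_spec (Y := Y) w')
    simpa [mul_assoc] using this

lemma projSub_mem (a : ASub M Y) : K.projSub Y a ∈ K.par Y := by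
  have h : a ∈ Subgroup.closure (Set.range (gen fun a b : Y => M a b)) := by
    rw [closure_gen]; trivial
  induction h using Subgroup.closure_induction with
  | mem x hx => obtain ⟨t, rfl⟩ := hx; simpa [projSub] using σ_mem_par t.2
  | one => simp
  | mul x y _ _ hx hy => rw [map_mul]; exact mul_mem hx hy
  | inv x _ hx => rw [map_inv]; exact inv_mem hx

lemma step_repOf (s : S) (w : W) : K.step s (K.repOf Y w) = K.repOf Y (K.σ s * w) := by
  symm
  apply repOf_eq
  have h1 := step_mul_out s (K.repOf Y w)
  rw [← eq_mul_inv_iff_mul_eq] at h1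
  rw [h1, mul_inv_rev]
  have := mul_mem (K.repOf_spec (Y := Y) w) (inv_mem (projSub_mem (K.out s (K.repOf Y w))))
  simpa [mul_assoc] using this

lemma loop_repOf (s : S) (w : W) :
    (∃ t : Y, K.σ s * K.repOf Y w = K.repOf Y w * K.σ t) ↔ w⁻¹ * (K.σ s * w) ∈ K.par Y := by
  rw [loop_iff_mem_par, ← repOf_eq_iff, ← repOf_eq_iff, repOf_coe, ← step_repOf, ← step_repOf,
    repOf_coe]

end CoxeterModel

namespace CoxeterModel

open ArtinGroup

variable {S W : Type*} [Group W] {M : S → S → ℕ∞} (K : CoxeterModel M W) (Y : Set S)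

/-- The alternating sequence of two letters, indexed by the integers. -/
def altSeq (s t : S) (i : ℤ) : S := if i % 2 = 0 then s else t

/-- The bi-infinite path in the dihedral orbit. -/
def dihedralPath (s t : S) (w : W) (i : ℤ) : W :=
  (if i % 2 = 0 then 1 else K.σ s) * (K.σ t * K.σ s) ^ (i / 2) * w

/-- The outputs along the bi-infinite path. -/
noncomputable def pathOut (s t : S) (w : W) (i : ℤ) : ASub M Y :=
  K.out (altSeq s t i) (K.repOf Y (K.dihedralPath s t w i))

variable {K Y} {s t : S} {w : W}

lemma dihedralPath_zero : K.dihedralPath s t w 0 = w := by simp [dihedralPath]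

lemma dihedralPath_succ (i : ℤ) :
    K.dihedralPath s t w (i + 1) = K.σ (altSeq s t i) * K.dihedralPath s t w i := by
  rcases Int.emod_two_eq_zero_or_one i with h | h
  · rw [dihedralPath, dihedralPath, altSeq, if_neg (by omega), if_pos h, if_pos h,
      show (i + 1) / 2 = i / 2 by omega]
    group
  · rw [dihedralPath, dihedralPath, altSeq, if_pos (by omega), if_neg (by omega), if_neg (by omega),
      show (i + 1) / 2 = 1 + i / 2 by omega, zpow_add]
    simp [mul_assoc]

lemma dihedralPath_add (i d : ℤ) : K.dihedralPath s t w (i + 2 * d) =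
    K.dihedralPath s t w i * (w⁻¹ * (K.σ t * K.σ s) ^ d * w) := by
  rw [dihedralPath, dihedralPath, show (i + 2 * d) % 2 = i % 2 by omega,
    show (i + 2 * d) / 2 = i / 2 + d by omega, zpow_add]
  group

lemma zpow_mul_σ (d : ℤ) : (K.σ t * K.σ s) ^ d * K.σ s = K.σ s * (K.σ t * K.σ s) ^ (-d) := by
  have h : K.σ s * (K.σ t * K.σ s) * (K.σ s)⁻¹ = (K.σ t * K.σ s)⁻¹ := by
    rw [mul_inv_rev, inv_σ, inv_σ, mul_assoc, mul_assoc, K.sq, mul_one]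
  have h2 : K.σ s * (K.σ t * K.σ s) ^ (-d) * (K.σ s)⁻¹ = (K.σ t * K.σ s) ^ d := by
    rw [← conj_zpow, h, inv_zpow, zpow_neg, inv_inv]
  rw [← h2, inv_mul_cancel_right]

lemma dihedralPath_conj (i : ℤ) : (K.dihedralPath s t w i)⁻¹ *
    (K.σ (altSeq s t i) * K.dihedralPath s t w i) =
      w⁻¹ * (K.σ s * (K.σ t * K.σ s) ^ i) * w := by
  rw [← dihedralPath_succ]
  obtain ⟨q, hq⟩ : ∃ q, q = (K.σ t * K.σ s) ^ (i / 2) := ⟨_, rfl⟩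
  have key : q⁻¹ * (K.σ s * q) = K.σ s * (q * q) := by
    have := K.zpow_mul_σ (s := s) (t := t) (-(i / 2))
    rw [neg_neg, zpow_neg, ← hq] at this
    rw [← mul_assoc, this]
    simp only [mul_assoc]
  rcases Int.emod_two_eq_zero_or_one i with h | h
  · have e : (K.σ t * K.σ s) ^ i = q * q := by
      rw [hq, ← zpow_add]; congr 1; omega
    rw [e, ← key, dihedralPath, dihedralPath, if_neg (c := (i + 1) % 2 = 0) (by omega), if_pos h,
      show (i + 1) / 2 = i / 2 by omega, ← hq]
    simp [mul_assoc]
  · have e : (K.σ t * K.σ s) ^ i = q * q * (K.σ t * K.σ s) := by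
      rw [hq, ← zpow_add, ← zpow_add_one]; congr 1; omega
    rw [e, ← mul_assoc (K.σ s), ← key, dihedralPath, dihedralPath,
      if_neg (c := i % 2 = 0) (by omega), if_pos (c := (i + 1) % 2 = 0) (by omega),
      show (i + 1) / 2 = i / 2 + 1 by omega, zpow_add_one, ← hq]
    simp [mul_assoc, inv_σ]

lemma revProd_step_forward (h : ASub M Y) (k : ℕ) :
    revProd (fun i => K.perm Y (altSeq s t i)) k (K.repOf Y w, h) =
      (K.repOf Y (K.dihedralPath s t w k), revProd (fun i => K.pathOut Y s t w i) k * h) := by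
  induction k with
  | zero => simp [revProd, dihedralPath_zero]
  | succ k ih =>
    rw [revProd, Equiv.Perm.mul_apply, ih, perm_apply, step_repOf, ← dihedralPath_succ, revProd,
      mul_assoc]
    simp [pathOut]

lemma revProd_step_backward (h : ASub M Y) (k : ℕ) :
    revProd (fun i => K.perm Y (altSeq s t (-1 - i))) k (K.repOf Y w, h) =
      (K.repOf Y (K.dihedralPath s t w (-k)),
        revProd (fun i => K.pathOut Y s t w (-1 - i)) k * h) := by
  induction k with
  | zero => simp [revProd, dihedralPath_zero]
  | succ k ih =>
    have e : K.repOf Y (K.dihedralPath s t w (-k)) = K.step (altSeq s t (-1 - k))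
        (K.repOf Y (K.dihedralPath s t w (-(k + 1 : ℕ)))) := by
      rw [step_repOf, show (-1 - k : ℤ) = -(k + 1 : ℕ) by push_cast; ring, ← dihedralPath_succ]
      congr 2; push_cast; ring
    rw [revProd, Equiv.Perm.mul_apply, ih, perm_apply, e, step_step, out_step, revProd,
      mul_assoc, pathOut]
    congr 4
    push_cast; ring_nf

lemma revProd_mul_projSub (k : ℕ) : (K.repOf Y (K.dihedralPath s t w k) : W) *
    K.projSub Y (revProd (fun i => K.pathOut Y s t w i) k) =
      revProd (fun i => K.σ (altSeq s t i)) k * K.repOf Y w := by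
  induction k with
  | zero => simp [revProd, dihedralPath_zero]
  | succ k ih =>
    rw [revProd, revProd, map_mul, mul_assoc, ← ih, ← mul_assoc, ← mul_assoc]
    congr 1
    rw [pathOut, ← step_mul_out, step_repOf, ← dihedralPath_succ]
    simp

lemma pathOut_eq_one {i : ℤ} (h : w⁻¹ * (K.σ s * (K.σ t * K.σ s) ^ i) * w ∉ K.par Y) :
    K.pathOut Y s t w i = 1 := by
  apply out_of_not_loop
  rwa [loop_repOf, dihedralPath_conj]

lemma exists_pathOut_eq {i : ℤ} (h : w⁻¹ * (K.σ s * (K.σ t * K.σ s) ^ i) * w ∈ K.par Y) :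
    ∃ r, K.pathOut Y s t w i = gen _ r := by
  rw [← dihedralPath_conj, ← loop_repOf] at h
  obtain ⟨r, hr⟩ := h
  exact ⟨r, out_of_loop hr⟩

lemma altSeq_add (i d : ℤ) : altSeq s t (i + 2 * d) = altSeq s t i := by
  rw [altSeq, altSeq, show (i + 2 * d) % 2 = i % 2 by omega]

lemma pathOut_add {i d : ℤ} (h : w⁻¹ * (K.σ t * K.σ s) ^ d * w ∈ K.par Y) :
    K.pathOut Y s t w (i + 2 * d) = K.pathOut Y s t w i := by
  rw [pathOut, pathOut, altSeq_add]
  congr 1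
  symm
  rw [repOf_eq_iff, dihedralPath_add, inv_mul_cancel_left]
  exact h

lemma exists_modulus (K : CoxeterModel M W) (Y : Set S) (s t : S) (w : W) :
    ∃ g : ℤ, ∀ d, w⁻¹ * (K.σ t * K.σ s) ^ d * w ∈ K.par Y ↔ g ∣ d := by
  let H : AddSubgroup ℤ :=
    { carrier := {d | w⁻¹ * (K.σ t * K.σ s) ^ d * w ∈ K.par Y}
      zero_mem' := by simp
      add_mem' := fun {a b} ha hb => by
        have := mul_mem (s := K.par Y) ha hb
        have e : w⁻¹ * (K.σ t * K.σ s) ^ a * w * (w⁻¹ * (K.σ t * K.σ s) ^ b * w) =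
          w⁻¹ * (K.σ t * K.σ s) ^ (a + b) * w := by rw [zpow_add]; group
        rwa [e] at this
      neg_mem' := fun {a} ha => by
        have := (K.par Y).inv_mem ha
        have e : (w⁻¹ * (K.σ t * K.σ s) ^ a * w)⁻¹ =
          w⁻¹ * (K.σ t * K.σ s) ^ (-a) * w := by rw [zpow_neg]; group
        rwa [e] at this }
  obtain ⟨g, hg⟩ := Int.subgroup_cyclic H
  refine ⟨g, fun d => ?_⟩
  rw [← Int.mem_zmultiples_iff, AddSubgroup.zmultiples_eq_closure, ← hg]
  rfl

lemma mem_par_add {i d : ℤ} (h : w⁻¹ * (K.σ t * K.σ s) ^ d * w ∈ K.par Y) :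
    w⁻¹ * (K.σ s * (K.σ t * K.σ s) ^ (i + d)) * w ∈ K.par Y ↔
      w⁻¹ * (K.σ s * (K.σ t * K.σ s) ^ i) * w ∈ K.par Y := by
  rw [← mul_mem_cancel_right (y := w⁻¹ * (K.σ s * (K.σ t * K.σ s) ^ i) * w) h, zpow_add]
  apply iff_of_eq
  congr 1
  group

lemma mem_par_sub {i j : ℤ} (h : w⁻¹ * (K.σ s * (K.σ t * K.σ s) ^ i) * w ∈ K.par Y)
    (h' : w⁻¹ * (K.σ s * (K.σ t * K.σ s) ^ j) * w ∈ K.par Y) :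
    w⁻¹ * (K.σ t * K.σ s) ^ (j - i) * w ∈ K.par Y := by
  have h1 := mul_mem h h'
  have e : w⁻¹ * (K.σ s * (K.σ t * K.σ s) ^ i) * w * (w⁻¹ * (K.σ s * (K.σ t * K.σ s) ^ j) * w) =
      w⁻¹ * (K.σ t * K.σ s) ^ (j - i) * w := by
    have h2 := K.zpow_mul_σ (s := s) (t := t) i
    calc _ = w⁻¹ * K.σ s * ((K.σ t * K.σ s) ^ i * K.σ s) * (K.σ t * K.σ s) ^ j * w := by
          simp [mul_assoc]
      _ = w⁻¹ * (K.σ s * K.σ s) * ((K.σ t * K.σ s) ^ (-i) * (K.σ t * K.σ s) ^ j) * w := by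
          rw [h2]; simp only [mul_assoc]
      _ = _ := by rw [K.sq, ← zpow_add, mul_one, neg_add_eq_sub]
  rwa [e] at h1

lemma perm_braid (s t : S) (hst : s ≠ t) {m : ℕ} (hm : M s t = m) :
    altProd m (K.perm Y s) (K.perm Y t) = altProd m (K.perm Y t) (K.perm Y s) := by
  rcases Nat.eq_zero_or_pos m with rfl | hm0
  · rfl
  have hz : (K.σ t * K.σ s) ^ (m : ℤ) = 1 := by
    have := K.pow s t hst m hm
    rw [← inv_inj, ← inv_pow, mul_inv_rev, inv_σ, inv_σ, inv_one] at this
    exact_mod_cast this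
  ext1 ⟨r, h⟩
  obtain ⟨w, rfl⟩ : ∃ w, K.repOf Y w = r := ⟨r, repOf_coe r⟩
  have e1 : altProd m (K.perm Y s) (K.perm Y t) =
      revProd (fun i => K.perm Y (altSeq s t i)) m := by
    apply revProd_congr
    intro i _
    rw [altSeq]
    split_ifs <;> first | rfl | omega
  have e2 : altProd m (K.perm Y t) (K.perm Y s) =
      revProd (fun i => K.perm Y (altSeq s t (-1 - i))) m := by
    apply revProd_congr
    intro i _
    rw [altSeq]
    split_ifs <;> first | rfl | omega
  rw [e1, e2, revProd_step_forward, revProd_step_backward]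
  have e3 : K.repOf Y (K.dihedralPath s t w m) = K.repOf Y (K.dihedralPath s t w (-m)) := by
    rw [show (m : ℤ) = -m + 2 * m by ring, dihedralPath_add, hz, mul_one, inv_mul_cancel, mul_one]
    congr 3; ring
  rw [e3]
  congr 2
  obtain ⟨g, hg⟩ := exists_modulus K Y s t w
  by_cases hL : ∃ j : ℤ, w⁻¹ * (K.σ s * (K.σ t * K.σ s) ^ j) * w ∈ K.par Y
  swap
  · push Not at hL
    rw [revProd_eq_one fun i _ => pathOut_eq_one (hL _),
      revProd_eq_one fun i _ => pathOut_eq_one (hL _)]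
  obtain ⟨j, hj⟩ := hL
  have hgm : g ∣ m := by
    rw [← hg, hz]; simp
  obtain ⟨n, hn⟩ : ∃ n : ℕ, n = g.natAbs := ⟨_, rfl⟩
  have hg' : ∀ d, w⁻¹ * (K.σ t * K.σ s) ^ d * w ∈ K.par Y ↔ (n : ℤ) ∣ d := by
    intro d
    rw [hg, hn, Int.natAbs_dvd]
  have hnm : n ∣ m := by
    rw [hn, ← Int.natCast_dvd_natCast, Int.natAbs_dvd]; exact hgm
  have hn0 : 0 < n := Nat.pos_of_dvd_of_pos hnm hm0
  have hn0' : (n : ℤ) ≠ 0 := by exact_mod_cast hn0.ne'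
  obtain ⟨k, rfl⟩ := hnm
  have hk0 : k ≠ 0 := by rintro rfl; simp at hm0
  obtain ⟨i₀, hi⟩ := Int.eq_ofNat_of_zero_le (Int.emod_nonneg j hn0')
  have hi0 : i₀ < n := by
    have := Int.emod_lt_of_pos j (show (0 : ℤ) < n by exact_mod_cast hn0)
    omega
  have hij : (n : ℤ) ∣ i₀ - j := by
    have := Int.emod_add_mul_ediv j n
    exact ⟨-(j / n), by rw [← hi]; linarith⟩
  have hL0 : w⁻¹ * (K.σ s * (K.σ t * K.σ s) ^ (i₀ : ℤ)) * w ∈ K.par Y := by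
    rw [show (i₀ : ℤ) = j + (i₀ - j) by ring, mem_par_add]
    · exact hj
    · rwa [hg']
  have hL1 : w⁻¹ * (K.σ s * (K.σ t * K.σ s) ^ (i₀ + n : ℤ)) * w ∈ K.par Y := by
    rw [mem_par_add]
    · exact hL0
    · rw [hg']
  have hone : ∀ i : ℤ, ¬ (n : ℤ) ∣ i - i₀ → K.pathOut Y s t w i = 1 := by
    intro i h
    apply pathOut_eq_one
    intro h'
    exact h ((hg' _).1 (mem_par_sub hL0 h'))
  have hper : ∀ i d : ℤ, K.pathOut Y s t w (i + 2 * (n * d)) = K.pathOut Y s t w i :=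
    fun i d => pathOut_add (by rw [hg']; exact Int.dvd_mul_right _ _)
  have hF : ∀ q, revProd (fun i : ℕ => K.pathOut Y s t w i) (n * q) =
      altProd q (K.pathOut Y s t w i₀) (K.pathOut Y s t w (i₀ + n)) := by
    intro q
    rw [revProd_blocks hi0]
    · apply revProd_congr
      intro i _
      split_ifs with h
      · rw [← hper i₀ (i / 2 : ℕ)]
        congr 1
        push_cast
        rw [mul_left_comm, show (2 * ((i : ℤ) / 2)) = i by omega]
      · rw [← hper (i₀ + n) (i / 2 : ℕ)]
        congr 1
        push_cast
        have : (i : ℤ) = 1 + 2 * ((i : ℤ) / 2) := by omega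
        nth_rewrite 1 [this]
        ring
    · intro i _ h
      apply hone
      intro h'
      apply h
      have h2 : (i : ℤ) % n = i₀ % n := 
        Int.emod_eq_emod_iff_emod_sub_eq_zero.2 (Int.emod_eq_zero_of_dvd h')
      have h3 : i % n = i₀ % n := by exact_mod_cast h2
      rw [h3, Nat.mod_eq_of_lt hi0]
  have hB : revProd (fun i : ℕ => K.pathOut Y s t w (-1 - i)) (n * k) =
      altProd k (K.pathOut Y s t w (i₀ + n)) (K.pathOut Y s t w i₀) := by
    rw [revProd_blocks (i₀ := n - 1 - i₀) (by omega)]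
    · apply revProd_congr
      intro i _
      have e : (-1 - ((n - 1 - i₀ + n * i : ℕ) : ℤ)) = i₀ - n - n * i := by
        push_cast [Nat.sub_sub, Nat.cast_sub (show 1 + i₀ ≤ n by omega)]; ring
      rw [e]
      split_ifs with h
      · rw [← hper _ (i / 2 + 1 : ℕ)]
        congr 1
        push_cast
        have : (i : ℤ) = 2 * ((i : ℤ) / 2) := by omega
        nth_rewrite 1 [this]
        ring
      · rw [← hper _ (i / 2 + 1 : ℕ)]
        congr 1
        push_cast
        have : (i : ℤ) = 1 + 2 * ((i : ℤ) / 2) := by omega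
        nth_rewrite 1 [this]
        ring
    · intro i _ h
      apply hone
      intro h'
      apply h
      obtain ⟨c, hc⟩ := h'
      have h2 : (i : ℤ) = (n - 1 - i₀ : ℕ) + n * (-c - 1) := by
        push_cast [Nat.sub_sub, Nat.cast_sub (show 1 + i₀ ≤ n by omega)]
        linarith
      have h3 : ((i % n : ℕ) : ℤ) = ((n - 1 - i₀ : ℕ) : ℤ) := by
        rw [Int.natCast_mod, h2, Int.add_mul_emod_self_left]
        apply Int.emod_eq_of_lt <;> omega
      exact_mod_cast h3
  rw [hF, hB]
  obtain ⟨a, ha⟩ := exists_pathOut_eq hL0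
  obtain ⟨b, hb⟩ := exists_pathOut_eq hL1
  have hP := revProd_mul_projSub (K := K) (Y := Y) (s := s) (t := t) (w := w) (n * (2 * k))
  rw [hF, ha, hb] at hP
  rw [ha, hb]
  by_cases hab : a = b
  · rw [hab]
  have hab' : (b : S) ≠ a := fun h => hab (Subtype.ext h.symm)
  have e4 : revProd (fun i : ℕ => K.σ (altSeq s t i)) (n * (2 * k)) = 1 := by
    have : revProd (fun i : ℕ => K.σ (altSeq s t i)) (n * (2 * k)) =
        altProd (2 * (n * k)) (K.σ s) (K.σ t) := by
      rw [show n * (2 * k) = 2 * (n * k) by ring]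
      apply revProd_congr
      intro i _
      rw [altSeq]
      split_ifs <;> first | rfl | omega
    rw [this, altProd_two_mul]
    exact_mod_cast hz
  have e5 : K.repOf Y (K.dihedralPath s t w (n * (2 * k) : ℕ)) = K.repOf Y w := by
    have := dihedralPath_add (K := K) (s := s) (t := t) (w := w) 0 (n * k : ℕ)
    rw [hz, mul_one, inv_mul_cancel, mul_one, dihedralPath_zero] at this
    rw [← this]
    congr 2
    push_cast; ring
  rw [e4, e5, one_mul, mul_eq_left, map_altProd, altProd_two_mul] at hP
  simp only [projSub, MonoidHom.comp_apply, incl_gen, proj_gen] at hP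
  obtain h | ⟨m', hm', q, rfl⟩ := K.order b a hab' k hP
  · exact absurd h hk0
  · exact (altProd_mul_comm (altProd_gen (fun h => hab h.symm) hm') q).symm

end CoxeterModel

namespace CoxeterModel

open ArtinGroup

variable {S W : Type*} [Group W] {M : S → S → ℕ∞} (K : CoxeterModel M W) (Y : Set S)

/-- The action of the Artin group induced from a standard parabolic subgroup. -/
noncomputable def act : ArtinGroup M →* Equiv.Perm (K.Rep Y × ASub M Y) :=
  ArtinGroup.lift (K.perm Y) fun s t h _ hm => perm_braid s t h hm

/-- The trivial coset. -/
def base : K.Rep Y := ⟨1, red_one⟩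

variable {K Y}

lemma act_gen (s : S) (w : K.Rep Y) (h : ASub M Y) :
    K.act Y (gen M s) (w, h) = (K.step s w, K.out s w * h) := by
  rw [act, lift_gen, perm_apply]

lemma act_gen_inv (s : S) (w : K.Rep Y) (h : ASub M Y) :
    K.act Y (gen M s)⁻¹ (w, h) = (K.step s w, (K.out s w)⁻¹ * h) := by
  rw [map_inv, act, lift_gen]
  rfl

lemma par_induction {X : Set S} {p : ArtinGroup M → Prop} (h1 : p 1)
    (hg : ∀ s ∈ X, ∀ a, p a → p (gen M s * a)) (hi : ∀ s ∈ X, ∀ a, p a → p ((gen M s)⁻¹ * a))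
    {a : ArtinGroup M} (ha : a ∈ ArtinGroup.par M X) : p a := by
  rw [par_eq] at ha
  induction ha using Subgroup.closure_induction_left with
  | one => exact h1
  | mul_left x hx y _ hy => obtain ⟨s, hs, rfl⟩ := hx; exact hg s hs y hy
  | inv_mul_cancel x hx y _ hy => obtain ⟨s, hs, rfl⟩ := hx; exact hi s hs y hy

lemma artin_induction {p : ArtinGroup M → Prop} (h1 : p 1)
    (hg : ∀ s, ∀ a, p a → p (gen M s * a)) (hi : ∀ s, ∀ a, p a → p ((gen M s)⁻¹ * a))
    (a : ArtinGroup M) : p a :=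
  par_induction (X := Set.univ) h1 (fun s _ => hg s) (fun s _ => hi s) (by rw [par_univ]; trivial)

lemma act_mul_right (a : ArtinGroup M) (w : K.Rep Y) (h h' : ASub M Y) :
    K.act Y a (w, h * h') = ((K.act Y a (w, h)).1, (K.act Y a (w, h)).2 * h') := by
  induction a using artin_induction with
  | h1 => simp
  | hg s a ih => rw [map_mul, Equiv.Perm.mul_apply, Equiv.Perm.mul_apply, ih, act_gen]
                 conv_rhs => rw [← Prod.mk.eta (p := K.act Y a (w, h)), act_gen]
                 simp only [mul_assoc]
  | hi s a ih => rw [map_mul, Equiv.Perm.mul_apply, Equiv.Perm.mul_apply, ih, act_gen_inv]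
                 conv_rhs => rw [← Prod.mk.eta (p := K.act Y a (w, h)), act_gen_inv]
                 simp only [mul_assoc]

lemma act_fst (a : ArtinGroup M) (w : K.Rep Y) (h : ASub M Y) :
    (K.act Y a (w, h)).1 = K.repOf Y (K.proj a * w) := by
  induction a using artin_induction with
  | h1 => simp [repOf_coe]
  | hg s a ih =>
    rw [map_mul, Equiv.Perm.mul_apply, ← Prod.mk.eta (p := K.act Y a (w, h)), act_gen, ih,
      step_repOf, map_mul, proj_gen, mul_assoc]
  | hi s a ih =>
    rw [map_mul, Equiv.Perm.mul_apply, ← Prod.mk.eta (p := K.act Y a (w, h)), act_gen_inv, ih,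
      step_repOf, map_mul, map_inv, proj_gen, inv_σ, mul_assoc]

lemma act_incl (b h : ASub M Y) : K.act Y (incl M Y b) (K.base Y, h) = (K.base Y, b * h) := by
  have hl (s : Y) : K.σ s * K.base Y = K.base Y * K.σ s := by simp [base]
  induction b using artin_induction with
  | h1 => simp
  | hg s a ih =>
    rw [map_mul, incl_gen, map_mul, Equiv.Perm.mul_apply, ih, act_gen, step_of_loop (hl s),
      out_of_loop (hl s), mul_assoc]
  | hi s a ih =>
    rw [map_mul, map_inv, incl_gen, map_mul, Equiv.Perm.mul_apply, ih, act_gen_inv,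
      step_of_loop (hl s), out_of_loop (hl s), mul_assoc]

lemma incl_injective (K : CoxeterModel M W) (Y : Set S) : Function.Injective (incl M Y) := by
  intro a b h
  have h1 := act_incl (K := K) a 1
  rw [h, act_incl] at h1
  simpa using congrArg Prod.snd h1.symm

lemma exists_incl {Y : Set S} {z : ArtinGroup M} (hz : z ∈ ArtinGroup.par M Y) :
    ∃ b, incl M Y b = z := by
  rwa [← range_incl] at hz

lemma out_mem {X : Set S} {w : K.Rep Y} (hw : (w : W) ∈ K.par X) {s : S} (hs : s ∈ X) :
    (K.step s w : W) ∈ K.par X ∧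
      K.out s w ∈ ArtinGroup.par (fun a b : Y => M a b) (Subtype.val ⁻¹' X) := by
  by_cases h : ∃ t : Y, K.σ s * w = w * K.σ t
  · obtain ⟨t, h⟩ := h
    rw [step_of_loop h, out_of_loop h]
    refine ⟨hw, gen_mem_par ?_⟩
    apply mem_of_σ_mem_par (K := K)
    rw [eq_comm, ← eq_inv_mul_iff_mul_eq] at h
    rw [h]
    exact mul_mem (inv_mem hw) (mul_mem (σ_mem_par hs) hw)
  · rw [step_of_not_loop h, out_of_not_loop h]
    exact ⟨mul_mem (σ_mem_par hs) hw, one_mem _⟩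

lemma act_mem {X : Set S} {a : ArtinGroup M} (ha : a ∈ ArtinGroup.par M X) {w : K.Rep Y}
    (hw : (w : W) ∈ K.par X) (h : ASub M Y) : ((K.act Y a (w, h)).1 : W) ∈ K.par X ∧
      (K.act Y a (w, h)).2 * h⁻¹ ∈ ArtinGroup.par (fun a b : Y => M a b) (Subtype.val ⁻¹' X) := by
  refine par_induction (p := fun a => ((K.act Y a (w, h)).1 : W) ∈ K.par X ∧ (K.act Y a (w, h)).2 *
    h⁻¹ ∈ ArtinGroup.par (fun a b : Y => M a b) (Subtype.val ⁻¹' X)) ?_ ?_ ?_ ha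
  · simpa using hw
  · intro s hs a ih
    rw [map_mul, Equiv.Perm.mul_apply, ← Prod.mk.eta (p := K.act Y a (w, h)), act_gen]
    have := out_mem ih.1 hs
    exact ⟨this.1, by rw [mul_assoc]; exact mul_mem this.2 ih.2⟩
  · intro s hs a ih
    rw [map_mul, Equiv.Perm.mul_apply, ← Prod.mk.eta (p := K.act Y a (w, h)), act_gen_inv]
    have := out_mem ih.1 hs
    exact ⟨this.1, by rw [mul_assoc]; exact mul_mem (inv_mem this.2) ih.2⟩

lemma act_one_mem {X : Set S} {a : ArtinGroup M} (ha : a ∈ ArtinGroup.par M X) {p : ASub M Y}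
    (h : K.act Y a (K.base Y, 1) = (K.base Y, p)) :
    p ∈ ArtinGroup.par (fun a b : Y => M a b) (Subtype.val ⁻¹' X) := by
  have := (act_mem (K := K) (Y := Y) ha (w := K.base Y) (one_mem _) 1).2
  rwa [h, inv_one, mul_one] at this

lemma incl_mem {X : Set S} {p : ASub M Y}
    (h : p ∈ ArtinGroup.par (fun a b : Y => M a b) (Subtype.val ⁻¹' X)) :
    incl M Y p ∈ ArtinGroup.par M (X ∩ Y) := by
  have := Subgroup.mem_map_of_mem (incl M Y) h
  rwa [map_incl_par, Subtype.image_preimage_coe, Set.inter_comm] at this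

lemma mem_par_inter (K : CoxeterModel M W) {X Y : Set S} {z : ArtinGroup M} (hX : z ∈ ArtinGroup.par M X)
    (hY : z ∈ ArtinGroup.par M Y) : z ∈ ArtinGroup.par M (X ∩ Y) := by
  obtain ⟨b, rfl⟩ := exists_incl hY
  have h := act_incl (K := K) b 1
  rw [mul_one] at h
  exact incl_mem (act_one_mem hX h)

lemma exists_eq_mk {α β : Type*} {q : α × β} {a : α} (h : q.1 = a) : ∃ b, q = (a, b) :=
  ⟨q.2, by rw [← h]⟩

lemma exists_mul_of_mem_par (K : CoxeterModel M W) {X Y Z : Set S} {x y : ArtinGroup M}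
    (hx : x ∈ ArtinGroup.par M X)
    (hy : y ∈ ArtinGroup.par M Y) (hz : x * y ∈ ArtinGroup.par M Z) :
    ∃ x' ∈ ArtinGroup.par M (X ∩ Z), ∃ y' ∈ ArtinGroup.par M (Y ∩ Z), x * y = x' * y' := by
  obtain ⟨c, hc⟩ := exists_incl hz
  have h1 : K.act Z (x * y) (K.base Z, 1) = (K.base Z, c) := by rw [← hc, act_incl, mul_one]
  have h2 : K.act Z y (K.base Z, 1) = K.act Z x⁻¹ (K.base Z, c) := by
    rw [← h1, ← Equiv.Perm.mul_apply, ← map_mul, inv_mul_cancel_left]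
  have h3 := (act_mem (K := K) (Y := Z) hy (w := K.base Z) (one_mem _) 1).1
  have h4 := (act_mem (K := K) (Y := Z) (inv_mem hx) (w := K.base Z) (one_mem _) c).1
  rw [← h2] at h4
  have h5 := par_inter h4 h3
  obtain ⟨b, hb, hb'⟩ : ∃ b ∈ ArtinGroup.par M (X ∩ Y),
      K.proj b = (K.act Z y (K.base Z, 1)).1 := by
    have : (ArtinGroup.par M (X ∩ Y)).map K.proj = K.par (X ∩ Y) := by
      rw [par_eq, MonoidHom.map_closure, ← Set.image_comp, par]
      congr 1
      ext; simp
    rw [← this] at h5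
    exact h5
  have h6 : (K.act Z (b⁻¹ * y) (K.base Z, 1)).1 = K.base Z := by
    rw [map_mul, Equiv.Perm.mul_apply, ← Prod.mk.eta (p := K.act Z y (K.base Z, 1)), act_fst,
      map_inv, hb', inv_mul_cancel]
    exact repOf_coe (K.base Z)
  obtain ⟨p, hp⟩ : ∃ p, K.act Z (b⁻¹ * y) (K.base Z, 1) = (K.base Z, p) :=
    exists_eq_mk h6
  have hby : b⁻¹ * y ∈ ArtinGroup.par M Y :=
    mul_mem (inv_mem (ArtinGroup.par_mono Set.inter_subset_right hb)) hy
  have h7 := act_one_mem hby hp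
  have h8 : K.act Z (x * b) (K.base Z, p) = (K.base Z, c) := by
    rw [← hp, ← Equiv.Perm.mul_apply, ← map_mul, mul_assoc, mul_inv_cancel_left, h1]
  have h9 : K.act Z (x * b) (K.base Z, 1) = (K.base Z, c * p⁻¹) := by
    have := act_mul_right (K := K) (x * b) (K.base Z) p p⁻¹
    rwa [mul_inv_cancel, h8] at this
  have h10 := act_one_mem (mul_mem hx (ArtinGroup.par_mono Set.inter_subset_left hb)) h9
  refine ⟨_, incl_mem h10, _, incl_mem h7, ?_⟩
  rw [← map_mul, inv_mul_cancel_right, hc]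

lemma exists_conj_par (K : CoxeterModel M W) {X Y : Set S} {g : ArtinGroup M}
    (h : conjSubgroup g (ArtinGroup.par M X) ≤ ArtinGroup.par M Y) :
    ∃ p ∈ ArtinGroup.par M Y, ∃ Z ⊆ Y,
      conjSubgroup g (ArtinGroup.par M X) = conjSubgroup p (ArtinGroup.par M Z) := by
  obtain ⟨⟨w, p⟩, hp⟩ : ∃ q, K.act Y g⁻¹ (K.base Y, 1) = q := ⟨_, rfl⟩
  have key : ∀ s ∈ X, ∃ t ∈ Y, g * gen M s * g⁻¹ = (incl M Y p)⁻¹ * gen M t * incl M Y p := by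
    intro s hs
    obtain ⟨b, hb⟩ := exists_incl (h (Subgroup.mem_map_of_mem _ (gen_mem_par hs)))
    replace hb : incl M Y b = g * gen M s * g⁻¹ := hb
    have h1 : K.act Y (gen M s) (w, p) = (w, p * b) := by
      have e : gen M s * g⁻¹ = g⁻¹ * incl M Y b := by rw [hb]; group
      rw [← hp, ← Equiv.Perm.mul_apply, ← map_mul, e, map_mul, Equiv.Perm.mul_apply, act_incl,
        mul_one]
      have := act_mul_right (K := K) g⁻¹ (K.base Y) 1 b
      rwa [one_mul, hp] at this
    rw [act_gen, Prod.mk.injEq] at h1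
    by_cases hl : ∃ t : Y, K.σ s * w = w * K.σ t
    · obtain ⟨t, ht⟩ := hl
      refine ⟨t, t.2, ?_⟩
      rw [out_of_loop ht] at h1
      rw [← hb, mul_assoc, eq_inv_mul_iff_mul_eq, ← incl_gen, ← map_mul, ← map_mul, h1.2]
    · have := step_of_not_loop hl
      rw [h1.1, eq_comm, mul_eq_right] at this
      exact absurd this (σ_ne_one s)
  choose! f hf hf' using key
  refine ⟨(incl M Y p)⁻¹, inv_mem ?_, f '' X, by rintro _ ⟨s, hs, rfl⟩; exact hf s hs, ?_⟩
  · rw [← range_incl]; exact ⟨p, rfl⟩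
  · rw [conjSubgroup, conjSubgroup, par_eq, par_eq, MonoidHom.map_closure, MonoidHom.map_closure]
    congr 1
    rw [← Set.image_comp, ← Set.image_comp, ← Set.image_comp]
    apply Set.image_congr
    intro s hs
    simpa using hf' s hs

end CoxeterModel

/-! ### A local-to-global principle for simply connected graphs -/

namespace SimpleGraph

variable {V : Type u}

/-- Equal or adjacent. -/
def Near (G : SimpleGraph V) (a b : V) : Prop := a = b ∨ G.Adj a b

/-- No vertex link contains an induced cycle of length four or five. -/
structure LocallyLarge (G : SimpleGraph V) : Prop where
  four : ∀ x a b c d, G.Adj x a → G.Adj x b → G.Adj x c → G.Adj x d →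
    G.Adj a b → G.Adj b c → G.Adj c d → G.Adj d a → G.Near a c ∨ G.Near b d
  five : ∀ x a b c d e, G.Adj x a → G.Adj x b → G.Adj x c → G.Adj x d → G.Adj x e →
    G.Adj a b → G.Adj b c → G.Adj c d → G.Adj d e → G.Adj e a →
    G.Near a c ∨ G.Near a d ∨ G.Near b d ∨ G.Near b e ∨ G.Near c e

/-- There is no induced cycle of length four or five. -/
structure FiveLarge (G : SimpleGraph V) : Prop where
  four : ∀ a b c d, G.Adj a b → G.Adj b c → G.Adj c d → G.Adj d a → G.Near a c ∨ G.Near b d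
  five : ∀ a b c d e, G.Adj a b → G.Adj b c → G.Adj c d → G.Adj d e → G.Adj e a →
    G.Near a c ∨ G.Near a d ∨ G.Near b d ∨ G.Near b e ∨ G.Near c e

/-- A covering of the flag complex of a graph. -/
structure FlagCovering (G : SimpleGraph V) (T : Type u) where
  f : T → V
  adj : T → T → Prop
  symm : ∀ p q, adj p q → adj q p
  map_adj : ∀ p q, adj p q → G.Adj (f p) (f q)
  lift : ∀ p w, G.Adj (f p) w → ∃ q, adj p q ∧ f q = w
  lift_unique : ∀ p q q', adj p q → adj p q' → f q = f q' → q = q'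
  lift_adj : ∀ p q q', adj p q → adj p q' → G.Adj (f q) (f q') → adj q q'

/-- Coverings of the flag complex have sections. -/
def FlagSimplyConnected (G : SimpleGraph V) : Prop :=
  ∀ (T : Type u) (c : FlagCovering G T) (t : T),
    ∃ σ : V → T, σ (c.f t) = t ∧ (∀ v, c.f (σ v) = v) ∧ ∀ v w, G.Adj v w → c.adj (σ v) (σ w)

/-- A sphere in the space of combinatorial geodesics. -/
structure Layer (V : Type u) where
  P : Type u
  f : P → V
  adj : P → P → Prop
  pred : P → Set V

namespace Layer

variable (G : SimpleGraph V) (L : Layer V)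

/-- `w` is a neighbour leading to the next sphere. -/
def New (p : L.P) (w : V) : Prop :=
  G.Adj (L.f p) w ∧ w ∉ L.pred p ∧ ¬ ∃ q, L.adj p q ∧ L.f q = w

/-- Points of the sphere lying under a point of the next sphere. -/
def cl (p : L.P) (w : V) : Set L.P := {q | (q = p ∨ L.adj p q) ∧ G.Adj (L.f q) w}

/-- The next sphere. -/
def next : Layer V where
  P := {x : V × Set L.P // ∃ p, L.New G p x.1 ∧ x.2 = L.cl G p x.1}
  f x := x.1.1
  adj x y := G.Adj x.1.1 y.1.1 ∧ (x.1.2 ∩ y.1.2).Nonempty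
  pred x := L.f '' x.1.2

/-- The inductive invariants of the construction. -/
structure Good : Prop where
  symm : ∀ p q, L.adj p q → L.adj q p
  map_adj : ∀ p q, L.adj p q → G.Adj (L.f p) (L.f q)
  pred_adj : ∀ p, ∀ a ∈ L.pred p, G.Adj (L.f p) a
  sib_unique : ∀ p q q', L.adj p q → L.adj p q' → L.f q = L.f q' → q = q'
  sib_adj : ∀ p q q', L.adj p q → L.adj p q' → G.Adj (L.f q) (L.f q') → L.adj q q'
  pred_ne : ∀ p q a, a ∈ L.pred p → L.adj p q → a ≠ L.f q
  pred_near : ∀ p a b, a ∈ L.pred p → b ∈ L.pred p → G.Near a b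
  pred_of_adj : ∀ p q a, a ∈ L.pred p → L.adj p q → G.Adj a (L.f q) → a ∈ L.pred q
  common_pred : ∀ p q, L.adj p q → ∃ a, a ∈ L.pred p ∧ a ∈ L.pred q
  not_new : ∀ p a w, a ∈ L.pred p → G.Adj w a → G.Adj w (L.f p) →
    w ∈ L.pred p ∨ ∃ q, L.adj p q ∧ L.f q = w

variable {G L}

lemma New.mem_cl {p : L.P} {w : V} (hw : L.New G p w) : p ∈ L.cl G p w := ⟨Or.inl rfl, hw.1⟩

lemma next_nonempty (x : (L.next G).P) : x.1.2.Nonempty := by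
  obtain ⟨⟨w, C⟩, q, hq, hC⟩ := x
  dsimp only at hq hC ⊢
  subst hC
  exact ⟨q, hq.mem_cl⟩

namespace Good

variable (h : L.Good G) (hG : G.LocallyLarge)
include h

lemma new_not_adj {p : L.P} {w a : V} (hw : L.New G p w) (ha : a ∈ L.pred p) :
    ¬ G.Near a w := by
  rintro (rfl | h1)
  · exact hw.2.1 ha
  · rcases h.not_new p a w ha h1.symm hw.1.symm with h2 | h2
    · exact hw.2.1 h2
    · exact hw.2.2 h2

lemma new_of_mem {p q : L.P} {w : V} (hw : L.New G p w) (hq : q ∈ L.cl G p w) :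
    L.New G q w := by
  obtain ⟨rfl | hpq, hqw⟩ := hq
  · exact hw
  refine ⟨hqw, fun h1 => ?_, ?_⟩
  · exact hw.2.1 (h.pred_of_adj q p w h1 (h.symm _ _ hpq) hw.1.symm)
  · rintro ⟨r, hr, rfl⟩
    exact hw.2.2 ⟨r, h.sib_adj q p r (h.symm _ _ hpq) hr hw.1, rfl⟩

lemma new_of_mem_next (x : (L.next G).P) {p : L.P} (hp : p ∈ x.1.2) : L.New G p x.1.1 := by
  obtain ⟨⟨w, C⟩, q, hq, hC⟩ := x
  dsimp only at hq hC hp ⊢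
  subst hC
  exact h.new_of_mem hq hp

lemma next_ne (x : (L.next G).P) {q r : L.P} (hq : q ∈ x.1.2) (hr : r = q ∨ L.adj q r) :
    L.f r ≠ x.1.1 := by
  have := h.new_of_mem_next x hq
  rcases hr with rfl | hr
  · exact this.1.ne
  · exact fun h1 => this.2.2 ⟨r, hr, h1⟩

include hG

lemma cl_clique_aux {p q r : L.P} {w a : V} (hw : L.New G p w) (hq : L.adj p q)
    (hqw : G.Adj (L.f q) w) (hr : L.adj p r) (hrw : G.Adj (L.f r) w) (ha : a ∈ L.pred p)
    (haq : a ∈ L.pred q) (har : a ∈ L.pred r) : G.Near (L.f q) (L.f r) := by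
  rcases hG.four (L.f p) a (L.f q) w (L.f r) (h.pred_adj p a ha) (h.map_adj _ _ hq) hw.1
    (h.map_adj _ _ hr) (h.pred_adj q a haq).symm hqw hrw.symm (h.pred_adj r a har) with h1 | h1
  · exact absurd h1 (h.new_not_adj hw ha)
  · exact h1

lemma cl_clique {p q r : L.P} {w : V} (hw : L.New G p w) (hq : q ∈ L.cl G p w)
    (hr : r ∈ L.cl G p w) : r = q ∨ L.adj q r := by
  obtain ⟨rfl | hpq, hqw⟩ := hq
  · exact hr.1
  obtain ⟨rfl | hpr, hrw⟩ := hr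
  · exact Or.inr (h.symm _ _ hpq)
  suffices G.Near (L.f q) (L.f r) by
    rcases this with h1 | h1
    · exact Or.inl (h.sib_unique p r q hpr hpq h1.symm)
    · exact Or.inr (h.sib_adj p q r hpq hpr h1)
  obtain ⟨a, hap, haq⟩ := h.common_pred p q hpq
  obtain ⟨b, hbp, hbr⟩ := h.common_pred p r hpr
  rcases h.pred_near p a b hap hbp with rfl | hab
  · exact h.cl_clique_aux hG hw hpq hqw hpr hrw hap haq hbr
  rcases hG.five (L.f p) a (L.f q) w (L.f r) b (h.pred_adj p a hap) (h.map_adj _ _ hpq) hw.1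
    (h.map_adj _ _ hpr) (h.pred_adj p b hbp) (h.pred_adj q a haq).symm hqw hrw.symm
    (h.pred_adj r b hbr) hab.symm with h1 | h1 | h1 | h1 | h1
  · exact absurd h1 (h.new_not_adj hw hap)
  · rcases h1 with h1 | h1
    · exact absurd h1 (h.pred_ne p r a hap hpr)
    · exact h.cl_clique_aux hG hw hpq hqw hpr hrw hap haq (h.pred_of_adj p r a hap hpr h1)
  · exact h1
  · rcases h1 with h1 | h1
    · exact absurd h1.symm (h.pred_ne p q b hbp hpq)
    · exact h.cl_clique_aux hG hw hpq hqw hpr hrw hbp (h.pred_of_adj p q b hbp hpq h1.symm) hbr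
  · exact absurd (h1.imp Eq.symm Adj.symm) (h.new_not_adj hw hbp)

lemma cl_subset {p q : L.P} {w : V} (hw : L.New G p w) (hq : q ∈ L.cl G p w) :
    L.cl G p w ⊆ L.cl G q w := fun _ hr => ⟨h.cl_clique hG hw hq hr, hr.2⟩

lemma cl_eq {p q : L.P} {w : V} (hw : L.New G p w) (hq : q ∈ L.cl G p w) :
    L.cl G p w = L.cl G q w := by
  have h1 := h.cl_subset hG hw hq
  exact h1.antisymm (h.cl_subset hG (h.new_of_mem hw hq) (h1 (hw.mem_cl)))

lemma eq_cl_of_mem_next (x : (L.next G).P) {p : L.P} (hp : p ∈ x.1.2) :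
    x.1.2 = L.cl G p x.1.1 := by
  obtain ⟨⟨w, C⟩, q, hq, hC⟩ := x
  dsimp only at hq hC hp ⊢
  subst hC
  exact h.cl_eq hG hq hp

lemma next_clique (x : (L.next G).P) {q r : L.P} (hq : q ∈ x.1.2) (hr : r ∈ x.1.2) :
    r = q ∨ L.adj q r := by
  rw [h.eq_cl_of_mem_next hG x hq] at hr
  exact hr.1

lemma mem_next_of_adj (x y : (L.next G).P) {q : L.P} (hxy : (L.next G).adj x y) (hq : q ∈ x.1.2)
    (h1 : G.Adj (L.f q) y.1.1) : q ∈ y.1.2 := by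
  obtain ⟨-, c, hcx, hcy⟩ := hxy
  rw [h.eq_cl_of_mem_next hG y hcy]
  exact ⟨h.next_clique hG x hcx hq, h1⟩

lemma next_ext (x y : (L.next G).P) (hxy : x.1.1 = y.1.1) {p : L.P} (hx : p ∈ x.1.2)
    (hy : p ∈ y.1.2) : x = y := by
  apply Subtype.ext
  apply Prod.ext hxy
  rw [h.eq_cl_of_mem_next hG x hx, h.eq_cl_of_mem_next hG y hy, hxy]

lemma next_sib (x y z : (L.next G).P) (hxy : (L.next G).adj x y) (hxz : (L.next G).adj x z)
    (hyz : G.Near y.1.1 z.1.1) : (y.1.2 ∩ z.1.2).Nonempty := by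
  obtain ⟨axy, c, hcx, hcy⟩ := hxy
  obtain ⟨axz, d, hdx, hdz⟩ := hxz
  have cz := (h.new_of_mem_next x hcx).1
  have dz := (h.new_of_mem_next x hdx).1
  have cy := (h.new_of_mem_next y hcy).1
  have dz' := (h.new_of_mem_next z hdz).1
  rcases h.next_clique hG x hcx hdx with rfl | hcd
  · exact ⟨d, hcy, hdz⟩
  rcases hyz with hyz | hyz
  · refine ⟨d, ?_, hdz⟩
    rw [h.eq_cl_of_mem_next hG y hcy, hyz]
    exact ⟨Or.inr hcd, dz'⟩
  rcases hG.four x.1.1 (L.f c) (L.f d) z.1.1 y.1.1 cz.symm dz.symm axz axy (h.map_adj _ _ hcd)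
    dz' hyz.symm cy.symm with (h1 | h1) | (h1 | h1)
  · exact absurd h1 (h.next_ne z hdz (Or.inr (h.symm _ _ hcd)))
  · refine ⟨c, hcy, ?_⟩
    rw [h.eq_cl_of_mem_next hG z hdz]
    exact ⟨Or.inr (h.symm _ _ hcd), h1⟩
  · exact absurd h1 (h.next_ne y hcy (Or.inr hcd))
  · refine ⟨d, ?_, hdz⟩
    rw [h.eq_cl_of_mem_next hG y hcy]
    exact ⟨Or.inr hcd, h1⟩

lemma next : (L.next G).Good G where
  symm x y hxy := ⟨hxy.1.symm, by rw [Set.inter_comm]; exact hxy.2⟩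
  map_adj x y hxy := hxy.1
  pred_adj x := by
    rintro _ ⟨q, hq, rfl⟩
    exact (h.new_of_mem_next x hq).1.symm
  sib_unique x y z hxy hxz e := by
    obtain ⟨c, hy, hz⟩ := h.next_sib hG x y z hxy hxz (Or.inl e)
    exact h.next_ext hG y z e hy hz
  sib_adj x y z hxy hxz e := ⟨e, h.next_sib hG x y z hxy hxz (Or.inr e)⟩
  pred_ne := by
    rintro x y _ ⟨q, hq, rfl⟩ ⟨-, c, hcx, hcy⟩
    exact h.next_ne y hcy (h.next_clique hG x hcx hq)
  pred_near := by
    rintro x _ _ ⟨q, hq, rfl⟩ ⟨r, hr, rfl⟩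
    rcases h.next_clique hG x hq hr with rfl | h1
    · exact Or.inl rfl
    · exact Or.inr (h.map_adj _ _ h1)
  pred_of_adj := by
    rintro x y _ ⟨q, hq, rfl⟩ hxy h1
    exact ⟨q, h.mem_next_of_adj hG x y hxy hq h1, rfl⟩
  common_pred := by
    rintro x y ⟨-, c, hcx, hcy⟩
    exact ⟨_, ⟨c, hcx, rfl⟩, ⟨c, hcy, rfl⟩⟩
  not_new := by
    rintro x _ w ⟨q, hq, rfl⟩ hwq hwx
    have hn := h.new_of_mem_next x hq
    by_cases h1 : w ∈ L.pred q
    · exact absurd (Or.inr hwx) (h.new_not_adj hn h1)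
    by_cases h2 : ∃ r, L.adj q r ∧ L.f r = w
    · obtain ⟨r, hr, rfl⟩ := h2
      refine Or.inl ⟨r, ?_, rfl⟩
      rw [h.eq_cl_of_mem_next hG x hq]
      exact ⟨Or.inr hr, hwx⟩
    · have hw : L.New G q w := ⟨hwq.symm, h1, h2⟩
      exact Or.inr ⟨⟨(w, L.cl G q w), q, hw, rfl⟩, ⟨hwx.symm, q, hq, hw.mem_cl⟩, rfl⟩

end Good

end Layer

variable (G : SimpleGraph V) (u : V)

/-- The spheres around `u`. -/
def layer : ℕ → Layer V
  | 0 => ⟨PUnit, fun _ => u, fun _ _ => False, fun _ => ∅⟩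
  | n + 1 => (layer n).next G

variable {G u}

lemma LocallyLarge.good (hG : G.LocallyLarge) (n : ℕ) : (G.layer u n).Good G := by
  induction n with
  | zero => constructor <;> simp [layer]
  | succ n ih => exact ih.next hG

variable (G u)

/-- Adjacency in the space of combinatorial geodesics. -/
inductive TotalAdj : (Σ n, (G.layer u n).P) → (Σ n, (G.layer u n).P) → Prop
  | same (n : ℕ) (p q : (G.layer u n).P) : (G.layer u n).adj p q → TotalAdj ⟨n, p⟩ ⟨n, q⟩
  | up (n : ℕ) (p : (G.layer u n).P) (x : ((G.layer u n).next G).P) : p ∈ x.1.2 →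
      TotalAdj ⟨n, p⟩ ⟨n + 1, x⟩
  | down (n : ℕ) (p : (G.layer u n).P) (x : ((G.layer u n).next G).P) : p ∈ x.1.2 →
      TotalAdj ⟨n + 1, x⟩ ⟨n, p⟩

variable {G u}

lemma LocallyLarge.totalAdj_symm (hG : G.LocallyLarge) {p q : Σ n, (G.layer u n).P}
    (h : TotalAdj G u p q) : TotalAdj G u q p := by
  obtain ⟨n, p, q, h⟩ | ⟨n, p, q, h⟩ | ⟨n, p, q, h⟩ := h
  · exact .same _ _ _ ((hG.good n).symm _ _ h)
  · exact .down _ _ _ h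
  · exact .up _ _ _ h

lemma LocallyLarge.totalAdj_map (hG : G.LocallyLarge) {p q : Σ n, (G.layer u n).P}
    (h : TotalAdj G u p q) : G.Adj ((G.layer u p.1).f p.2) ((G.layer u q.1).f q.2) := by
  obtain ⟨n, p, q, h⟩ | ⟨n, p, q, h⟩ | ⟨n, p, q, h⟩ := h
  · exact (hG.good n).map_adj _ _ h
  · exact ((hG.good n).new_of_mem_next _ h).1
  · exact ((hG.good n).new_of_mem_next _ h).1.symm

lemma LocallyLarge.near_same_up (hG : G.LocallyLarge) {n : ℕ} {p q : (G.layer u n).P}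
    {x : ((G.layer u n).next G).P} (h : (G.layer u n).adj p q) (h' : p ∈ x.1.2)
    (e : G.Near ((G.layer u n).f q) x.1.1) : q ∈ x.1.2 := by
  have gn := hG.good (u := u) n
  rcases e with e | e
  · exact absurd ⟨q, h, e⟩ (gn.new_of_mem_next x h').2.2
  · rw [gn.eq_cl_of_mem_next hG x h']
    exact ⟨Or.inr h, e⟩

lemma LocallyLarge.near_same_down (hG : G.LocallyLarge) {n : ℕ} {q : (G.layer u n).P}
    {x y : ((G.layer u n).next G).P} (h : ((G.layer u n).next G).adj x y) (h' : q ∈ x.1.2)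
    (e : G.Near y.1.1 ((G.layer u n).f q)) : q ∈ y.1.2 := by
  have gn := hG.good (u := u) n
  rcases e with e | e
  · exact absurd e.symm ((gn.next hG).pred_ne x y _ ⟨q, h', rfl⟩ h)
  · exact gn.mem_next_of_adj hG x y h h' e.symm

lemma LocallyLarge.near_up_down (hG : G.LocallyLarge) {n : ℕ} {q : (G.layer u n).P}
    {p : (G.layer u (n + 1)).P} {x : ((G.layer u (n + 1)).next G).P} (h : p ∈ x.1.2)
    (h' : q ∈ p.1.2) : ¬ G.Near x.1.1 ((G.layer u n).f q) := fun e =>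
  (hG.good (n + 1)).new_not_adj ((hG.good (n + 1)).new_of_mem_next x h) ⟨q, h', rfl⟩
    (e.imp Eq.symm Adj.symm)

lemma LocallyLarge.totalAdj_near (hG : G.LocallyLarge) {p q q' : Σ n, (G.layer u n).P}
    (h : TotalAdj G u p q) (h' : TotalAdj G u p q')
    (e : G.Near ((G.layer u q.1).f q.2) ((G.layer u q'.1).f q'.2)) :
    q = q' ∨ TotalAdj G u q q' := by
  obtain ⟨n, p, q, h⟩ | ⟨n, p, x, h⟩ | ⟨n, q, x, h⟩ := h
  · have gn := hG.good (u := u) n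
    cases h' with
    | same _ _ q' h' =>
      rcases e with e | e
      · exact Or.inl (by rw [gn.sib_unique p q q' h h' e])
      · exact Or.inr (.same _ _ _ (gn.sib_adj p q q' h h' e))
    | up _ _ x' h' => exact Or.inr (.up _ _ _ (hG.near_same_up h h' e))
    | down m q' x h' => exact Or.inr (.down _ _ _ (hG.near_same_down h h' e))
  · have gn := hG.good (u := u) n
    cases h' with
    | same _ _ q' h' =>
      exact Or.inr (.down _ _ _ (hG.near_same_up h' h (e.imp Eq.symm Adj.symm)))
    | up _ _ x' h' =>
      rcases e with e | e
      · exact Or.inl (by rw [gn.next_ext hG x x' e h h'])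
      · exact Or.inr (.same (n + 1) _ _ ⟨e, p, h, h'⟩)
    | down m q' x' h' => exact absurd e (hG.near_up_down h h')
  · have gn := hG.good (u := u) n
    cases h' with
    | same _ _ q' h' =>
      exact Or.inr (.up _ _ _ (hG.near_same_down h' h (e.imp Eq.symm Adj.symm)))
    | up _ _ x' h' => exact absurd (e.imp Eq.symm Adj.symm) (hG.near_up_down h' h)
    | down m q' x' h' =>
      rcases gn.next_clique hG x h h' with rfl | h1
      · exact Or.inl rfl
      · exact Or.inr (.same _ _ _ h1)

/-- The space of combinatorial geodesics covers the graph. -/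
def LocallyLarge.totalCovering (hG : G.LocallyLarge) (u : V) :
    FlagCovering G (Σ n, (G.layer u n).P) where
  f p := (G.layer u p.1).f p.2
  adj := TotalAdj G u
  symm _ _ h := hG.totalAdj_symm h
  map_adj _ _ h := hG.totalAdj_map h
  lift := by
    rintro ⟨n, p⟩ w hw
    by_cases h1 : w ∈ (G.layer u n).pred p
    · cases n with
      | zero => exact h1.elim
      | succ n =>
        obtain ⟨q, hq, rfl⟩ := h1
        exact ⟨⟨n, q⟩, .down _ _ _ hq, rfl⟩
    by_cases h2 : ∃ r, (G.layer u n).adj p r ∧ (G.layer u n).f r = w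
    · obtain ⟨r, hr, rfl⟩ := h2
      exact ⟨⟨n, r⟩, .same _ _ _ hr, rfl⟩
    · have hn : (G.layer u n).New G p w := ⟨hw, h1, h2⟩
      exact ⟨⟨n + 1, ⟨(w, (G.layer u n).cl G p w), p, hn, rfl⟩⟩,
        .up _ _ _ (hn.mem_cl), rfl⟩
  lift_unique p q q' h h' e := by
    rcases hG.totalAdj_near h h' (Or.inl e) with h1 | h1
    · exact h1
    · exact absurd e (hG.totalAdj_map h1).ne
  lift_adj p q q' h h' e := by
    rcases hG.totalAdj_near h h' (Or.inr e) with h1 | h1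
    · exact absurd (congrArg (fun p => (G.layer u p.1).f p.2) h1) e.ne
    · exact h1

/-- A distance function from a vertex with convex balls. -/
structure IsRadial (G : SimpleGraph V) (u : V) (l : V → ℕ) : Prop where
  eq_zero_iff : ∀ x, l x = 0 ↔ x = u
  le_succ : ∀ x y, G.Adj x y → l y ≤ l x + 1
  exists_pred : ∀ x n, l x = n + 1 → ∃ y, G.Adj y x ∧ l y = n
  pred_near : ∀ x y z n, l x = n + 1 → l y = n → l z = n → G.Adj y x → G.Adj z x → G.Near y z
  common_pred : ∀ x y n, l x = n + 1 → l y = n + 1 → G.Adj x y →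
    ∃ z, l z = n ∧ G.Adj z x ∧ G.Adj z y

lemma LocallyLarge.exists_radial (hG : G.LocallyLarge) (hs : G.FlagSimplyConnected) (u : V) :
    ∃ l, G.IsRadial u l := by
  obtain ⟨σ, h0, hσ, hadj⟩ := hs _ (hG.totalCovering u) ⟨0, PUnit.unit⟩
  change σ u = _ at h0
  have hf : ∀ n (p : (G.layer u n).P), σ ((G.layer u n).f p) = ⟨n, p⟩ := by
    intro n
    induction n with
    | zero => exact fun p => h0
    | succ n ih =>
      intro x
      obtain ⟨c, hc⟩ := Layer.next_nonempty x
      have h1 := ((hG.good n).new_of_mem_next x hc).1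
      have h2 := hadj _ _ h1
      rw [ih] at h2
      exact (hG.totalCovering u).lift_unique _ _ _ h2 (.up n c x hc) (hσ _)
  have key : ∀ (T : Σ n, (G.layer u n).P), σ ((G.layer u T.1).f T.2) = T := fun T => hf _ _
  have hsurj : ∀ x, ∃ n, ∃ p : (G.layer u n).P, (G.layer u n).f p = x :=
    fun x => ⟨_, _, hσ x⟩
  refine ⟨fun x => (σ x).1, ?_, ?_, ?_, ?_, ?_⟩
  · intro x
    obtain ⟨n, p, rfl⟩ := hsurj x
    rw [hf]
    constructor
    · rintro rfl
      rfl
    · intro h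
      rw [← hf, h, h0]
  · intro x y h
    generalize hx : σ x = X
    generalize hy : σ y = Y
    have := hadj x y h
    rw [hx, hy] at this
    change TotalAdj G u _ _ at this
    cases this <;> dsimp only <;> omega
  · intro x n h
    obtain ⟨m, p, rfl⟩ := hsurj x
    rw [hf] at h
    dsimp only at h
    subst h
    obtain ⟨c, hc⟩ := Layer.next_nonempty p
    refine ⟨_, ((hG.good n).new_of_mem_next p hc).1, by rw [hf]⟩
  · intro x y z n hx hy hz hyx hzx
    obtain ⟨m, x, rfl⟩ := hsurj x
    obtain ⟨_, y, rfl⟩ := hsurj y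
    obtain ⟨_, z, rfl⟩ := hsurj z
    rw [hf] at hx hy hz
    dsimp only at hx hy hz
    subst hx hy hz
    replace hyx := hadj _ _ hyx
    replace hzx := hadj _ _ hzx
    rw [hf, hf] at hyx hzx
    change TotalAdj G u _ _ at hyx hzx
    cases hyx with
    | up _ _ _ hy =>
      cases hzx with
      | up _ _ _ hz =>
        rcases (hG.good _).next_clique hG x hy hz with rfl | h1
        · exact Or.inl rfl
        · exact Or.inr ((hG.good _).map_adj _ _ h1)
  · intro x y n hx hy h
    obtain ⟨m, x, rfl⟩ := hsurj x
    obtain ⟨m', y, rfl⟩ := hsurj y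
    rw [hf] at hx hy
    dsimp only at hx hy
    subst hx hy
    replace h := hadj _ _ h
    rw [hf, hf] at h
    change TotalAdj G u _ _ at h
    cases h with
    | same _ _ _ h =>
      obtain ⟨-, c, hcx, hcy⟩ := h
      exact ⟨_, by rw [hf], ((hG.good _).new_of_mem_next x hcx).1,
        ((hG.good _).new_of_mem_next y hcy).1⟩

lemma IsRadial.adj_of_eq_one {l : V → ℕ} (h : G.IsRadial u l) {x : V} (hx : l x = 1) :
    G.Adj u x := by
  obtain ⟨y, hy, hy0⟩ := h.exists_pred x 0 hx
  rwa [(h.eq_zero_iff y).1 hy0] at hy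

lemma IsRadial.eq_one {l : V → ℕ} (h : G.IsRadial u l) {x : V} (hx : G.Adj u x) : l x = 1 := by
  have h1 := h.le_succ _ _ hx
  have h2 := (h.eq_zero_iff u).2 rfl
  have h3 : l x ≠ 0 := fun h0 => hx.ne ((h.eq_zero_iff x).1 h0).symm
  omega

lemma IsRadial.near_or_eq_two {l : V → ℕ} (h : G.IsRadial u l) {x y : V} (hx : G.Adj u x)
    (hy : G.Adj x y) : G.Near u y ∨ l y = 2 := by
  have h1 := h.le_succ _ _ hy
  have h2 := h.eq_one hx
  obtain h3 | h3 | h3 : l y = 0 ∨ l y = 1 ∨ l y = 2 := by omega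
  · exact Or.inl (Or.inl ((h.eq_zero_iff y).1 h3).symm)
  · exact Or.inl (Or.inr (h.adj_of_eq_one h3))
  · exact Or.inr h3

theorem LocallyLarge.fiveLarge (hG : G.LocallyLarge) (hs : G.FlagSimplyConnected) :
    G.FiveLarge where
  four a b c d hab hbc hcd hda := by
    obtain ⟨l, hl⟩ := hG.exists_radial hs a
    rcases hl.near_or_eq_two hab hbc with h | h
    · exact Or.inl h
    · exact Or.inr (hl.pred_near c b d 1 h (hl.eq_one hab) (hl.eq_one hda.symm) hbc hcd.symm)
  five a b c d e hab hbc hcd hde hea := by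
    obtain ⟨l, hl⟩ := hG.exists_radial hs a
    rcases hl.near_or_eq_two hab hbc with hc | hc
    · exact Or.inl hc
    rcases hl.near_or_eq_two hea.symm hde.symm with hd | hd
    · exact Or.inr (Or.inl hd)
    obtain ⟨p, hp, hpc, hpd⟩ := hl.common_pred c d 1 hc hd hcd
    rcases hl.pred_near c p b 1 hc hp (hl.eq_one hab) hpc hbc with rfl | hpb
    · exact Or.inr (Or.inr (Or.inl (Or.inr hpd)))
    rcases hl.pred_near d p e 1 hd hp (hl.eq_one hea.symm) hpd hde.symm with rfl | hpe
    · exact Or.inr (Or.inr (Or.inr (Or.inr (Or.inr hpc.symm))))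
    exact hG.five p a b c d e (hl.adj_of_eq_one hp).symm hpb hpc hpd hpe hab hbc hcd hde hea

end SimpleGraph

/-! ### The Artin complex -/

namespace ArtinGroup

variable {S : Type u} {M : S → S → ℕ∞}

/-- Vertices of the Artin complex. -/
abbrev Vert (M : S → S → ℕ∞) : Type u := Σ s : S, ArtinGroup M ⧸ par M {s}ᶜ

/-- The vertex of type `s` of a chamber. -/
def vtx (g : ArtinGroup M) (s : S) : Vert M := ⟨s, QuotientGroup.mk g⟩

lemma exists_vtx (x : Vert M) : ∃ g, vtx g x.1 = x := by
  obtain ⟨s, C⟩ := x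
  obtain ⟨g, rfl⟩ := QuotientGroup.mk_surjective C
  exact ⟨g, rfl⟩

lemma vtx_eq_iff {g h : ArtinGroup M} {s : S} : vtx g s = vtx h s ↔ g⁻¹ * h ∈ par M {s}ᶜ := by
  rw [← QuotientGroup.eq]
  constructor
  · intro e
    exact eq_of_heq (Sigma.mk.inj e).2
  · intro e
    rw [vtx, vtx, e]

lemma vtx_mul {g a : ArtinGroup M} {s : S} (h : a ∈ par M {s}ᶜ) : vtx (g * a) s = vtx g s := by
  rw [eq_comm, vtx_eq_iff, inv_mul_cancel_left]
  exact h

/-- The one-skeleton of the Artin complex. -/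
def complex (M : S → S → ℕ∞) : SimpleGraph (Vert M) where
  Adj x y := x.1 ≠ y.1 ∧ ∃ g, vtx g x.1 = x ∧ vtx g y.1 = y
  symm := ⟨fun _ _ ⟨h, g, hx, hy⟩ => ⟨h.symm, g, hy, hx⟩⟩
  loopless := ⟨fun _ h => h.1 rfl⟩

lemma complex_adj_vtx (g : ArtinGroup M) {s t : S} (h : s ≠ t) :
    (complex M).Adj (vtx g s) (vtx g t) := ⟨h, g, rfl, rfl⟩

lemma exists_eq_vtx {x y : Vert M} (h : (complex M).Adj x y) :
    ∃ g s t, s ≠ t ∧ x = vtx g s ∧ y = vtx g t := by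
  obtain ⟨h, g, hx, hy⟩ := h
  exact ⟨g, _, _, h, hx.symm, hy.symm⟩

/-- The action on the vertices. -/
def move (a : ArtinGroup M) (x : Vert M) : Vert M := ⟨x.1, a • x.2⟩

lemma move_vtx (a g : ArtinGroup M) (s : S) : move a (vtx g s) = vtx (a * g) s := rfl

lemma move_inv (a : ArtinGroup M) (x : Vert M) : move a⁻¹ (move a x) = x := by
  obtain ⟨g, hg⟩ := exists_vtx x
  rw [← hg, move_vtx, move_vtx, inv_mul_cancel_left]

lemma move_adj (a : ArtinGroup M) {x y : Vert M} (h : (complex M).Adj x y) :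
    (complex M).Adj (move a x) (move a y) := by
  obtain ⟨g, s, t, hst, rfl, rfl⟩ := exists_eq_vtx h
  exact complex_adj_vtx _ hst

section Covering

variable {T : Type u} (c : (complex M).FlagCovering T)

/-- Lifts of chambers to a covering. -/
@[ext]
structure Chamber where
  g : ArtinGroup M
  φ : S → T
  map_φ : ∀ s, c.f (φ s) = vtx g s
  adj : ∀ s t, s ≠ t → c.adj (φ s) (φ t)

variable {c}

lemma Chamber.eq_of_eq {e e' : Chamber c} {r : S} (h : e.g = e'.g) (hr : e.φ r = e'.φ r) :
    e = e' := by
  ext s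
  · exact h
  · by_cases hs : s = r
    · rw [hs, hr]
    · refine c.lift_unique (e.φ r) _ _ (e.adj _ _ (Ne.symm hs)) ?_ ?_
      · rw [hr]; exact e'.adj _ _ (Ne.symm hs)
      · rw [e.map_φ, e'.map_φ, h]

lemma exists_chamber (g : ArtinGroup M) (r : S) (p : T) (h : c.f p = vtx g r) :
    ∃ e : Chamber c, e.g = g ∧ e.φ r = p := by
  classical
  have h1 : ∀ s, s ≠ r → ∃ q, c.adj p q ∧ c.f q = vtx g s := by
    intro s hs
    apply c.lift
    rw [h]
    exact complex_adj_vtx _ hs.symm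
  have : Nonempty T := ⟨p⟩
  choose! φ hφ hφ' using h1
  refine ⟨⟨g, fun s => if s = r then p else φ s, ?_, ?_⟩, rfl, if_pos rfl⟩
  · intro s
    split_ifs with hs
    · rw [h, hs]
    · exact hφ' s hs
  · intro s t hst
    split_ifs with hs ht ht
    · exact absurd (hs.trans ht.symm) hst
    · exact hφ _ ht
    · exact c.symm _ _ (hφ _ hs)
    · apply c.lift_adj p _ _ (hφ _ hs) (hφ _ ht)
      rw [hφ' _ hs, hφ' _ ht]
      exact complex_adj_vtx _ hst

lemma Chamber.exists_move (e : Chamber c) {s : S} (hs : ∃ r, r ≠ s) {a : ArtinGroup M}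
    (ha : a ∈ par M {s}) : ∃ e' : Chamber c, e'.g = e.g * a ∧ ∀ r ≠ s, e'.φ r = e.φ r := by
  obtain ⟨r, hr⟩ := hs
  have ha' : ∀ r, r ≠ s → a ∈ par M {r}ᶜ := fun r hr => par_mono (by simpa using hr) ha
  obtain ⟨e', h1, h2⟩ := exists_chamber (c := c) (e.g * a) r (e.φ r)
    (by rw [e.map_φ, vtx_mul (ha' r hr)])
  refine ⟨e', h1, fun r' hr' => ?_⟩
  by_cases h : r' = r
  · rw [h, h2]
  · refine c.lift_unique (e.φ r) _ _ ?_ (e.adj _ _ (Ne.symm h)) ?_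
    · rw [← h2]; exact e'.adj _ _ (Ne.symm h)
    · rw [e.map_φ, e'.map_φ, h1, vtx_mul (ha' r' hr')]

/-- The chamber system has no rank one or spherical rank two component. -/
structure Wide (M : S → S → ℕ∞) : Prop where
  one : ∀ s : S, ∃ r, r ≠ s
  two : ∀ s t : S, s ≠ t → M s t ≠ ⊤ → ∃ r, r ≠ s ∧ r ≠ t

variable (hM : Wide M)

/-- The chamber obtained by crossing a panel with the inverse of a generator. -/
noncomputable def chamberDown (s : S) (e : Chamber c) : Chamber c :=
  (e.exists_move (hM.one s) (inv_mem (gen_mem_par (Set.mem_singleton s)))).choose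

lemma chamberDown_spec (s : S) (e : Chamber c) : (chamberDown hM s e).g = e.g * (gen M s)⁻¹ ∧
    ∀ r ≠ s, (chamberDown hM s e).φ r = e.φ r :=
  (e.exists_move (hM.one s) (inv_mem (gen_mem_par (Set.mem_singleton s)))).choose_spec

/-- The chamber obtained by crossing a panel with a generator. -/
noncomputable def chamberUp (s : S) (e : Chamber c) : Chamber c :=
  (e.exists_move (hM.one s) (gen_mem_par (Set.mem_singleton s))).choose

lemma chamberUp_spec (s : S) (e : Chamber c) : (chamberUp hM s e).g = e.g * gen M s ∧
    ∀ r ≠ s, (chamberUp hM s e).φ r = e.φ r :=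
  (e.exists_move (hM.one s) (gen_mem_par (Set.mem_singleton s))).choose_spec

/-- The permutation of lifted chambers given by a generator. -/
noncomputable def chamberPerm (s : S) : Equiv.Perm (Chamber c) where
  toFun := chamberDown hM s
  invFun := chamberUp hM s
  left_inv e := by
    obtain ⟨r, hr⟩ := hM.one s
    apply Chamber.eq_of_eq (r := r)
    · rw [(chamberUp_spec hM s _).1, (chamberDown_spec hM s _).1, inv_mul_cancel_right]
    · rw [(chamberUp_spec hM s _).2 r hr, (chamberDown_spec hM s _).2 r hr]
  right_inv e := by
    obtain ⟨r, hr⟩ := hM.one s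
    apply Chamber.eq_of_eq (r := r)
    · rw [(chamberDown_spec hM s _).1, (chamberUp_spec hM s _).1, mul_inv_cancel_right]
    · rw [(chamberDown_spec hM s _).2 r hr, (chamberUp_spec hM s _).2 r hr]

lemma chamberPerm_spec (s : S) (e : Chamber c) : (chamberPerm hM s e).g = e.g * (gen M s)⁻¹ ∧
    ∀ r ≠ s, (chamberPerm hM s e).φ r = e.φ r :=
  chamberDown_spec hM s e

lemma chamberPerm_inv_spec (s : S) (e : Chamber c) : ((chamberPerm hM s)⁻¹ e).g = e.g * gen M s ∧
    ∀ r ≠ s, ((chamberPerm hM s)⁻¹ e).φ r = e.φ r :=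
  chamberUp_spec hM s e

lemma revProd_chamberPerm (x : ℕ → S) (k : ℕ) (e : Chamber c) :
    (revProd (fun i => chamberPerm hM (x i)) k e).g =
      e.g * (revProd (fun i => gen M (x i)) k)⁻¹ ∧
    ∀ r, (∀ i, r ≠ x i) → (revProd (fun i => chamberPerm hM (x i)) k e).φ r = e.φ r := by
  induction k with
  | zero => simp [revProd]
  | succ k ih =>
    have := chamberPerm_spec hM (x k) (revProd (fun i => chamberPerm hM (x i)) k e)
    rw [revProd, Equiv.Perm.mul_apply, this.1, ih.1, revProd, mul_inv_rev, mul_assoc]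
    exact ⟨rfl, fun r hr => by rw [this.2 r (hr k), ih.2 r hr]⟩

lemma altProd_chamberPerm (s t r : S) (hs : r ≠ s) (ht : r ≠ t) (k : ℕ) (e : Chamber c) :
    (altProd k (chamberPerm hM s) (chamberPerm hM t) e).g =
      e.g * (altProd k (gen M s) (gen M t))⁻¹ ∧
    (altProd k (chamberPerm hM s) (chamberPerm hM t) e).φ r = e.φ r := by
  have := revProd_chamberPerm hM (fun i => if i % 2 = 0 then s else t) k e
  have e1 : altProd k (chamberPerm (c := c) hM s) (chamberPerm hM t) =
      revProd (fun i => chamberPerm hM (if i % 2 = 0 then s else t)) k := by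
    apply revProd_congr; intro i _; split_ifs <;> rfl
  have e2 : altProd k (gen M s) (gen M t) =
      revProd (fun i => gen M (if i % 2 = 0 then s else t)) k := by
    apply revProd_congr; intro i _; split_ifs <;> rfl
  rw [e1, e2]
  exact ⟨this.1, this.2 r fun i => by split_ifs <;> assumption⟩

/-- The action on the lifted chambers. -/
noncomputable def chamberAct : ArtinGroup M →* Equiv.Perm (Chamber c) :=
  lift (chamberPerm hM) fun s t hst m hm => by
    obtain ⟨r, hs, ht⟩ := hM.two s t hst (by rw [hm]; exact ENat.natCast_ne_top m)
    ext1 e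
    have h1 := altProd_chamberPerm hM s t r hs ht m e
    have h2 := altProd_chamberPerm hM t s r ht hs m e
    apply Chamber.eq_of_eq (r := r)
    · rw [h1.1, h2.1, altProd_gen hst hm]
    · rw [h1.2, h2.2]

lemma chamberAct_g (a : ArtinGroup M) (e : Chamber c) : (chamberAct hM a e).g = e.g * a⁻¹ := by
  induction a using CoxeterModel.artin_induction with
  | h1 => simp
  | hg s a ih =>
    rw [map_mul, Equiv.Perm.mul_apply, chamberAct, lift_gen, (chamberPerm_spec hM s _).1,
      ← chamberAct, ih, mul_inv_rev, mul_assoc]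
  | hi s a ih =>
    rw [map_mul, map_inv, Equiv.Perm.mul_apply, chamberAct, lift_gen,
      (chamberPerm_inv_spec hM s _).1, ← chamberAct, ih, mul_inv_rev, mul_assoc, inv_inv]

lemma chamberAct_φ (s : S) {a : ArtinGroup M} (ha : a ∈ par M {s}ᶜ) (e : Chamber c) :
    (chamberAct hM a e).φ s = e.φ s := by
  refine CoxeterModel.par_induction (p := fun a => (chamberAct hM a e).φ s = e.φ s)
    (by simp) ?_ ?_ ha
  · intro t ht a ih
    rw [map_mul, Equiv.Perm.mul_apply, chamberAct, lift_gen,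
      (chamberPerm_spec hM t _).2 s (Ne.symm ht), ← chamberAct, ih]
  · intro t ht a ih
    rw [map_mul, map_inv, Equiv.Perm.mul_apply, chamberAct, lift_gen,
      (chamberPerm_inv_spec hM t _).2 s (Ne.symm ht), ← chamberAct, ih]

end Covering

lemma complex_flagSimplyConnected (hM : Wide M) : (complex M).FlagSimplyConnected := by
  intro T c t
  obtain ⟨g₀, hg₀⟩ := exists_vtx (c.f t)
  obtain ⟨e, he, het⟩ := exists_chamber (c := c) g₀ (c.f t).1 t hg₀.symm
  let σ : Vert M → T := fun x => (chamberAct hM ((exists_vtx x).choose⁻¹ * g₀) e).φ x.1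
  have hσ : ∀ g s, σ (vtx g s) = (chamberAct hM (g⁻¹ * g₀) e).φ s := by
    intro g s
    have h1 := (exists_vtx (vtx g s)).choose_spec
    change vtx _ s = _ at h1
    change (chamberAct hM ((exists_vtx (vtx g s)).choose⁻¹ * g₀) e).φ s = _
    generalize (exists_vtx (vtx g s)).choose = h at h1
    have h2 : h⁻¹ * g₀ = (h⁻¹ * g) * (g⁻¹ * g₀) := by group
    rw [h2, map_mul, Equiv.Perm.mul_apply, chamberAct_φ hM s (vtx_eq_iff.1 h1)]
  refine ⟨σ, ?_, ?_, ?_⟩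
  · rw [← hg₀, hσ, inv_mul_cancel, map_one, Equiv.Perm.one_apply, het]
  · intro x
    obtain ⟨g, hg⟩ := exists_vtx x
    rw [← hg, hσ, Chamber.map_φ, chamberAct_g, he]
    congr 1
    group
  · intro x y h
    obtain ⟨g, s, t, hst, rfl, rfl⟩ := exists_eq_vtx h
    rw [hσ, hσ]
    exact Chamber.adj _ _ _ hst

end ArtinGroup

namespace ArtinGroup

variable {S : Type u} {W : Type*} [Group W] {M : S → S → ℕ∞}

lemma incl_mem_par_compl_singleton {Y : Set S} {t : Y} {q : ArtinGroup fun a b : Y => M a b}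
    (h : q ∈ par (fun a b : Y => M a b) {t}ᶜ) : incl M Y q ∈ par M {t.1}ᶜ := by
  have h1 := Subgroup.mem_map_of_mem (incl M Y) h
  rw [map_incl_par] at h1
  refine par_mono ?_ h1
  rintro _ ⟨r, hr, rfl⟩ e
  exact hr (Subtype.ext e)

lemma exists_incl_of_mem_par_inter {Y : Set S} {t : Y} {x : ArtinGroup M}
    (h : x ∈ par M ({t.1}ᶜ ∩ Y)) :
    ∃ q ∈ par (fun a b : Y => M a b) {t}ᶜ, incl M Y q = x := by
  have h1 : ({t.1}ᶜ ∩ Y : Set S) = Subtype.val '' ({t}ᶜ : Set Y) := by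
    ext r
    simp only [Set.mem_inter_iff, Set.mem_compl_iff, Set.mem_singleton_iff, Set.mem_image,
      Subtype.exists, Subtype.ext_iff]
    grind
  rw [h1, ← map_incl_par] at h
  obtain ⟨q, hq, e⟩ := h
  exact ⟨q, hq, e⟩

lemma incl_mem_par {Y : Set S} (q : ArtinGroup fun a b : Y => M a b) : incl M Y q ∈ par M Y := by
  rw [← range_incl]
  exact ⟨q, rfl⟩

lemma vtx_of_adj {g : ArtinGroup M} {s : S} {y : Vert M} (h : (complex M).Adj (vtx g s) y) :
    ∃ p ∈ par M {s}ᶜ, ∃ t, t ≠ s ∧ y = vtx (g * p) t := by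
  obtain ⟨hne, k, h1, h2⟩ := h
  refine ⟨g⁻¹ * k, vtx_eq_iff.1 h1.symm, y.1, hne.symm, ?_⟩
  rw [mul_inv_cancel_left, h2]

/-- The link of a vertex is the Artin complex of a standard parabolic subgroup. -/
lemma exists_link (K : CoxeterModel M W) (x : Vert M) :
    ∃ f : Vert (fun a b : ({x.1}ᶜ : Set S) => M a b) → Vert M,
      (∀ y, (complex M).Adj x y → ∃ z, f z = y) ∧
      (∀ z z', (complex M).Adj (f z) (f z') → (complex _).Adj z z') ∧
      ∀ z z', (complex _).Near z z' → (complex M).Near (f z) (f z') := by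
  obtain ⟨g, hg⟩ := exists_vtx x
  generalize x.1 = s at hg
  subst hg
  let f : Vert (fun a b : ({s}ᶜ : Set S) => M a b) → Vert M :=
    fun z => vtx (g * incl M {s}ᶜ (exists_vtx z).choose) z.1.1
  have hf : ∀ q t, f (vtx q t) = vtx (g * incl M {s}ᶜ q) t := by
    intro q t
    have h1 := (exists_vtx (vtx q t)).choose_spec
    change vtx _ t = _ at h1
    rw [vtx_eq_iff] at h1
    change vtx _ t.1 = vtx _ t.1
    rw [vtx_eq_iff]
    have h2 := incl_mem_par_compl_singleton h1
    rw [map_mul, map_inv] at h2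
    rwa [mul_inv_rev, mul_assoc, inv_mul_cancel_left]
  refine ⟨f, ?_, ?_, ?_⟩
  · intro y hy
    obtain ⟨p, hp, t, ht, rfl⟩ := vtx_of_adj hy
    obtain ⟨b, rfl⟩ := CoxeterModel.exists_incl hp
    exact ⟨vtx b ⟨t, ht⟩, hf _ _⟩
  · intro z z' h
    obtain ⟨q, hq⟩ := exists_vtx z
    obtain ⟨q', hq'⟩ := exists_vtx z'
    generalize z.1 = t at hq
    generalize z'.1 = t' at hq'
    subst hq hq'
    rw [hf, hf] at h
    obtain ⟨hne, k, h1, h2⟩ := h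
    change vtx _ t.1 = _ at h1
    change vtx _ t'.1 = _ at h2
    have h3 := vtx_eq_iff.1 h1.symm
    have h4 := vtx_eq_iff.1 h2
    have h5 := incl_mem_par (M := M) (q⁻¹ * q')
    have h6 : ((g * incl M {s}ᶜ q)⁻¹ * k) * (k⁻¹ * (g * incl M {s}ᶜ q')) =
        incl M {s}ᶜ (q⁻¹ * q') := by
      rw [map_mul, map_inv]; group
    rw [← h6] at h5
    obtain ⟨a, ha, b, hb, e⟩ := K.exists_mul_of_mem_par h3 h4 h5
    obtain ⟨a, ha₀, rfl⟩ := exists_incl_of_mem_par_inter ha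
    obtain ⟨b, hb₀, rfl⟩ := exists_incl_of_mem_par_inter hb
    rw [h6, ← map_mul] at e
    have e1 := K.incl_injective _ e
    refine ⟨fun h => hne (congrArg Subtype.val h), q * a, vtx_mul ha₀, ?_⟩
    change vtx _ t' = vtx _ t'
    rw [vtx_eq_iff]
    convert hb₀ using 1
    rw [mul_inv_rev, mul_assoc, e1, inv_mul_cancel_left]
  · rintro z z' (rfl | h)
    · exact Or.inl rfl
    · right
      obtain ⟨k, t, t', hne, rfl, rfl⟩ := exists_eq_vtx h
      rw [hf, hf]
      exact complex_adj_vtx _ (Subtype.coe_injective.ne hne)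

lemma locallyLarge_of_links (K : CoxeterModel M W)
    (h : ∀ s : S, (complex fun a b : ({s}ᶜ : Set S) => M a b).FiveLarge) :
    (complex M).LocallyLarge where
  four x a b c d ha hb hc hd hab hbc hcd hda := by
    obtain ⟨f, h1, h2, h3⟩ := exists_link K x
    obtain ⟨a, rfl⟩ := h1 a ha
    obtain ⟨b, rfl⟩ := h1 b hb
    obtain ⟨c, rfl⟩ := h1 c hc
    obtain ⟨d, rfl⟩ := h1 d hd
    exact ((h _).four a b c d (h2 _ _ hab) (h2 _ _ hbc) (h2 _ _ hcd) (h2 _ _ hda)).imp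
      (h3 _ _) (h3 _ _)
  five x a b c d e ha hb hc hd he hab hbc hcd hde hea := by
    obtain ⟨f, h1, h2, h3⟩ := exists_link K x
    obtain ⟨a, rfl⟩ := h1 a ha
    obtain ⟨b, rfl⟩ := h1 b hb
    obtain ⟨c, rfl⟩ := h1 c hc
    obtain ⟨d, rfl⟩ := h1 d hd
    obtain ⟨e, rfl⟩ := h1 e he
    exact ((h _).five a b c d e (h2 _ _ hab) (h2 _ _ hbc) (h2 _ _ hcd) (h2 _ _ hde)
      (h2 _ _ hea)).imp (h3 _ _) (Or.imp (h3 _ _) (Or.imp (h3 _ _) (Or.imp (h3 _ _) (h3 _ _))))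

end ArtinGroup

/-! ### Normal forms in dihedral Artin groups -/

namespace Dihedral

/-- The `k`-th letter, read from right to left, of an alternating word ending in `z`. -/
def fl (k : ℕ) (z : Bool) : Bool := if k % 2 = 0 then z else !z

lemma fl_zero (z : Bool) : fl 0 z = z := rfl

lemma fl_succ (k : ℕ) (z : Bool) : fl (k + 1) z = !fl k z := by
  rcases Nat.mod_two_eq_zero_or_one k with h | h <;> simp [fl, h, Nat.add_mod]

lemma fl_fl (k l : ℕ) (z : Bool) : fl k (fl l z) = fl (l + k) z := by
  induction k with
  | zero => rfl
  | succ k ih => rw [fl_succ, ih, ← add_assoc, fl_succ]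

lemma fl_self (k : ℕ) (z : Bool) : fl k (fl k z) = z := by
  rw [fl_fl, fl, if_pos (by omega)]

lemma fl_not (k : ℕ) (z : Bool) : fl k (!z) = !fl k z := by
  unfold fl; split_ifs <;> rfl

/-- The alternating word of length `k` ending in `z`. -/
def alt : ℕ → Bool → List Bool
  | 0, _ => []
  | k + 1, z => fl k z :: alt k z

lemma length_alt (k : ℕ) (z : Bool) : (alt k z).length = k := by
  induction k with
  | zero => rfl
  | succ k ih => rw [alt, List.length_cons, ih]

lemma map_alt (m k : ℕ) (z : Bool) : (alt k z).map (fl m) = alt k (fl m z) := by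
  induction k with
  | zero => rfl
  | succ k ih => rw [alt, alt, List.map_cons, ih, fl_fl, fl_fl, add_comm]

lemma map_fl_map_fl (m : ℕ) (w : List Bool) : (w.map (fl m)).map (fl m) = w := by
  rw [List.map_map]
  convert List.map_id w
  ext z
  simp [fl_self]

/-- The alternating initial segment of a word cannot be prolonged beyond a letter `z`. -/
def Stop (z : Bool) (w : List Bool) : Prop := ∀ v, w ≠ (!z) :: v

lemma Stop.map {z : Bool} {w : List Bool} (h : Stop z w) (m : ℕ) :
    Stop (fl m z) (w.map (fl m)) := by
  intro v e
  apply h (v.map (fl m))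
  rw [← map_fl_map_fl m w, e, List.map_cons, fl_not, fl_self]

/-- The length of the longest alternating initial segment. -/
def lead : List Bool → ℕ
  | [] => 0
  | x :: w => if w.head? = some (!x) then lead w + 1 else 1

lemma lead_alt_append {z : Bool} {w : List Bool} (h : Stop z w) (k : ℕ) :
    lead (alt (k + 1) z ++ w) = k + 1 := by
  induction k with
  | zero =>
    rw [alt, alt, List.singleton_append, lead, if_neg]
    intro e
    obtain ⟨v, rfl⟩ := List.head?_eq_some_iff.1 e
    exact h v rfl
  | succ k ih =>
    rw [alt, List.cons_append, lead, if_pos, ih]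
    rw [alt, List.cons_append, List.head?_cons, fl_succ, Bool.not_not]

lemma exists_eq_alt_append (x : Bool) (w : List Bool) :
    ∃ k z v, x :: w = alt (k + 1) z ++ v ∧ Stop z v := by
  induction w generalizing x with
  | nil => exact ⟨0, x, [], rfl, fun v => by simp⟩
  | cons y w ih =>
    by_cases h : y = !x
    · obtain ⟨k, z, v, e, hv⟩ := ih y
      refine ⟨k + 1, z, v, ?_, hv⟩
      rw [alt, List.cons_append, ← e, fl_succ]
      rw [alt, List.cons_append] at e
      rw [← (List.cons.inj e).1, h, Bool.not_not]
    · refine ⟨0, x, y :: w, rfl, fun v e => h (List.cons.inj e).1⟩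

/-- Words without an alternating subword of length `m`. -/
def Free (m : ℕ) : List Bool → Prop
  | [] => True
  | x :: w => lead (x :: w) < m ∧ Free m w

lemma lead_map (m : ℕ) (w : List Bool) : lead (w.map (fl m)) = lead w := by
  induction w with
  | nil => rfl
  | cons x w ih =>
    rw [List.map_cons, lead, lead, ih, List.head?_map]
    congr 1
    rw [← fl_not, Option.map_eq_some_iff, eq_iff_iff]
    constructor
    · rintro ⟨a, h1, h2⟩
      rw [h1, ← fl_self m a, h2, fl_self]
    · intro h
      exact ⟨_, h, rfl⟩

lemma Free.map {m : ℕ} {w : List Bool} (h : Free m w) (l : ℕ) : Free m (w.map (fl l)) := by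
  induction w with
  | nil => trivial
  | cons x w ih => exact ⟨by rw [← List.map_cons, lead_map]; exact h.1, ih h.2⟩

lemma Free.alt_append {m k : ℕ} (hk : k < m) {z : Bool} {w : List Bool} (h : Free m w)
    (hz : Stop z w) : Free m (alt k z ++ w) := by
  induction k with
  | zero => exact h
  | succ k ih =>
    refine ⟨?_, ih (by omega)⟩
    have := lead_alt_append hz k
    rw [alt, List.cons_append] at this
    change lead (fl k z :: (alt k z ++ w)) < m
    omega

lemma Free.of_append {m : ℕ} {v w : List Bool} (h : Free m (v ++ w)) : Free m w := by
  induction v with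
  | nil => exact h
  | cons x v ih => exact ih h.2

lemma lead_le_of_free {m : ℕ} (hm : 2 ≤ m) {x : Bool} {w : List Bool} (h : Free m w) :
    lead (x :: w) ≤ m := by
  rw [lead]
  split_ifs
  · cases w with
    | nil => simp [lead]; omega
    | cons y w => exact h.1
  · omega

/-- Normal forms of elements. -/
def NF (m : ℕ) : Type := {z : ℤ × List Bool // Free m z.2}

variable {m : ℕ}

/-- The normal form with a given exponent and a given word. -/
def mk (n : ℤ) (w : List Bool) (h : Free m w) : NF m := ⟨(n, w), h⟩

lemma mk_congr {n n' : ℤ} {w w' : List Bool} {h : Free m w} {h' : Free m w'} (hn : n = n')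
    (hw : w = w') : mk n w h = mk n' w' h' := by
  subst hn hw; rfl

lemma Free.drop {w : List Bool} (h : Free m w) (k : ℕ) : Free m (w.drop k) :=
  Free.of_append (v := w.take k) (by rwa [List.take_append_drop])

/-- Left multiplication by a letter. -/
def up (x : Bool) (z : NF m) : NF m :=
  if h : lead (x :: z.1.2) < m then mk z.1.1 (x :: z.1.2) ⟨h, z.2⟩
  else mk (z.1.1 + 1) ((z.1.2.drop (m - 1)).map (fl m)) ((z.2.drop _).map _)

lemma up_mk_of_lt {x : Bool} {n : ℤ} {w : List Bool} {hw : Free m w} (h : lead (x :: w) < m) :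
    up x (mk n w hw) = mk n (x :: w) ⟨h, hw⟩ := dif_pos h

lemma up_mk_of_eq {x z : Bool} {n : ℤ} {w v : List Bool} {hw : Free m w}
    (h : x :: w = alt m z ++ v) (hz : Stop z v) (hv : Free m v) :
    up x (mk n w hw) = mk (n + 1) (v.map (fl m)) (hv.map _) := by
  cases m with
  | zero =>
    cases w with
    | nil =>
      cases v with
      | nil => simp [alt] at h
      | cons y v => exact absurd hv.1 (by omega)
    | cons y w => exact absurd hw.1 (by omega)
  | succ k =>
    have h1 := lead_alt_append hz k
    rw [← h] at h1
    refine (dif_neg ?_).trans (mk_congr rfl ?_)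
    · change ¬ lead (x :: w) < k + 1
      omega
    · rw [alt, List.cons_append] at h
      change List.map _ (List.drop k w) = _
      rw [(List.cons.inj h).2, List.drop_left' (length_alt _ _)]

/-- Left multiplication by the inverse of a letter. -/
def down (hm : 2 ≤ m) (x : Bool) (z : NF m) : NF m :=
  if h : z.1.2.head? = some x then mk z.1.1 z.1.2.tail (by
    have := z.2.drop 1
    rwa [List.drop_one] at this)
  else mk (z.1.1 - 1) (alt (m - 1) (fl (m - 1) x) ++ z.1.2.map (fl m))
    ((z.2.map m).alt_append (by omega) (by
      obtain ⟨k, rfl⟩ := Nat.exists_eq_add_of_le' (show 1 ≤ m by omega)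
      intro v e
      apply h
      rw [Nat.add_sub_cancel, ← fl_succ] at e
      rw [← map_fl_map_fl (k + 1) z.1.2, e, List.map_cons, fl_self, List.head?_cons]))

lemma down_mk_cons (hm : 2 ≤ m) {x : Bool} {n : ℤ} {w : List Bool} {hw : Free m (x :: w)} :
    down hm x (mk n (x :: w) hw) = mk n w hw.2 := dif_pos rfl

lemma down_mk_of_ne (hm : 2 ≤ m) {x : Bool} {n : ℤ} {w : List Bool} {hw : Free m w}
    (h : w.head? ≠ some x)
    (hf : Free m (alt (m - 1) (fl (m - 1) x) ++ w.map (fl m))) :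
    down hm x (mk n w hw) = mk (n - 1) (alt (m - 1) (fl (m - 1) x) ++ w.map (fl m)) hf := dif_neg h

lemma exists_mk (z : NF m) : ∃ n w h, z = mk n w h := ⟨z.1.1, z.1.2, z.2, rfl⟩

lemma stop_of_head_ne {x : Bool} {k : ℕ} {w : List Bool} (h : w.head? ≠ some x) :
    Stop (fl k x) (w.map (fl (k + 1))) := by
  intro v e
  apply h
  rw [← fl_succ] at e
  rw [← map_fl_map_fl (k + 1) w, e, List.map_cons, fl_self, List.head?_cons]

lemma up_down (hm : 2 ≤ m) (x : Bool) (z : NF m) : up x (down hm x z) = z := by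
  obtain ⟨n, w, hw, rfl⟩ := exists_mk z
  by_cases h : w.head? = some x
  · obtain ⟨v, rfl⟩ := List.head?_eq_some_iff.1 h
    rw [down_mk_cons, up_mk_of_lt]
    exact hw.1
  · obtain ⟨k, rfl⟩ := Nat.exists_eq_add_of_le' (show 1 ≤ m by omega)
    have hs := stop_of_head_ne (k := k) h
    rw [down_mk_of_ne hm h ((hw.map _).alt_append (by omega) hs),
      up_mk_of_eq (z := fl k x) (v := w.map (fl (k + 1))) ?_ hs (hw.map _)]
    · exact mk_congr (by ring) (map_fl_map_fl _ _)
    · rw [alt, fl_self]; rfl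

lemma down_up (hm : 2 ≤ m) (x : Bool) (z : NF m) : down hm x (up x z) = z := by
  obtain ⟨n, w, hw, rfl⟩ := exists_mk z
  by_cases h : lead (x :: w) < m
  · rw [up_mk_of_lt h]
    exact down_mk_cons hm
  · obtain ⟨k, z, v, e, hz⟩ := exists_eq_alt_append x w
    have h1 := lead_alt_append hz k
    rw [← e] at h1
    have h2 := lead_le_of_free hm (x := x) hw
    obtain rfl : m = k + 1 := by omega
    have e' := e
    rw [alt, List.cons_append] at e'
    obtain ⟨rfl, rfl⟩ := List.cons.inj e'
    have hv : Free (k + 1) v := hw.of_append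
    rw [up_mk_of_eq e hz hv, down_mk_of_ne hm]
    · exact mk_congr (by ring) (by rw [map_fl_map_fl, Nat.add_sub_cancel, fl_self])
    · intro h
      obtain ⟨u, hu⟩ := List.head?_eq_some_iff.1 h
      apply hz (u.map (fl (k + 1)))
      rw [← map_fl_map_fl (k + 1) v, hu, List.map_cons, fl_succ, fl_self]
    · rw [map_fl_map_fl, Nat.add_sub_cancel, fl_self]
      exact hw

/-- Left multiplication by a letter, as a permutation. -/
def perm (hm : 2 ≤ m) (x : Bool) : Equiv.Perm (NF m) where
  toFun := up x
  invFun := down hm x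
  left_inv := down_up hm x
  right_inv := up_down hm x

lemma perm_apply (hm : 2 ≤ m) (x : Bool) (z : NF m) : perm hm x z = up x z := rfl

/-- Alternating products of a family indexed by letters. -/
def altp {G : Type*} [Monoid G] (k : ℕ) (f : Bool → G) (z : Bool) : G := altProd k (f z) (f !z)

lemma altp_succ {G : Type*} [Monoid G] (k : ℕ) (f : Bool → G) (z : Bool) :
    altp (k + 1) f z = f (fl k z) * altp k f z := by
  rw [altp, altProd_succ, ← altp, fl]
  split_ifs <;> rfl

lemma altp_add {G : Type*} [Monoid G] (k l : ℕ) (f : Bool → G) (z : Bool) :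
    altp (k + l) f z = altp l f (fl k z) * altp k f z := by
  rw [altp, altProd_add, fl]
  split_ifs
  · rfl
  · rw [altp, altp, Bool.not_not]

lemma altp_perm_of_lt (hm : 2 ≤ m) {k : ℕ} (hk : k < m) {z : Bool} {n : ℤ} {w : List Bool}
    {hw : Free m w} (hz : Stop z w) :
    altp k (perm hm) z (mk n w hw) = mk n (alt k z ++ w) (hw.alt_append hk hz) := by
  induction k with
  | zero => rfl
  | succ k ih =>
    rw [altp_succ, Equiv.Perm.mul_apply, ih (by omega), perm_apply, up_mk_of_lt]
    · rfl
    · have := lead_alt_append hz k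
      rw [alt, List.cons_append] at this
      omega

lemma altp_perm_of_stop (hm : 2 ≤ m) {z : Bool} {n : ℤ} {w : List Bool}
    {hw : Free m w} (hz : Stop z w) :
    altp m (perm hm) z (mk n w hw) = mk (n + 1) (w.map (fl m)) (hw.map m) := by
  obtain ⟨k, rfl⟩ := Nat.exists_eq_add_of_le' (show 1 ≤ m by omega)
  rw [altp_succ, Equiv.Perm.mul_apply, altp_perm_of_lt hm (by omega) hz, perm_apply]
  exact up_mk_of_eq (v := w) rfl hz hw

lemma altp_perm (hm : 2 ≤ m) {z : Bool} {n : ℤ} {w : List Bool}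
    {hw : Free m w} :
    altp m (perm hm) z (mk n w hw) = mk (n + 1) (w.map (fl m)) (hw.map m) := by
  by_cases hz : Stop z w
  · exact altp_perm_of_stop hm hz
  · obtain ⟨v, hv⟩ : ∃ v, w = (!z) :: v := by simpa [Stop] using hz
    obtain ⟨k, y, v', e, hy⟩ := exists_eq_alt_append (!z) v
    rw [← hv] at e
    subst e
    have hv' : Free m v' := hw.of_append
    have hk : k + 1 < m := by
      have h1 := lead_alt_append hy k
      rw [hv] at hw h1
      have := hw.1
      omega
    have hz' : fl (k + 1) y = z := by
      rw [alt, List.cons_append] at hv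
      rw [fl_succ, (List.cons.inj hv).1, Bool.not_not]
    rw [← altp_perm_of_lt hm (hw := hv') hk hy, ← Equiv.Perm.mul_apply, ← hz', ← altp_add, add_comm,
      altp_add, Equiv.Perm.mul_apply, altp_perm_of_stop hm hy, altp_perm_of_lt hm hk (hy.map m)]
    exact mk_congr rfl (by rw [List.map_append, map_alt])

lemma perm_braid (hm : 2 ≤ m) (z : Bool) :
    altProd m (perm hm z) (perm hm !z) = altProd m (perm hm !z) (perm hm z) := by
  ext1 x
  obtain ⟨n, w, hw, rfl⟩ := exists_mk x
  have h1 := altp_perm hm (z := z) (n := n) (hw := hw)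
  have h2 := altp_perm hm (z := !z) (n := n) (hw := hw)
  rw [altp] at h1 h2
  rw [Bool.not_not] at h2
  rw [h1, h2]

section Root

variable {G : Type*} [Group G] (g : Bool → G)

/-- The value of a word. -/
def pr (w : List Bool) : G := (w.map g).prod

lemma pr_nil : pr g [] = 1 := rfl

lemma pr_cons (x : Bool) (w : List Bool) : pr g (x :: w) = g x * pr g w := by simp [pr]

lemma pr_append (v w : List Bool) : pr g (v ++ w) = pr g v * pr g w := by simp [pr]

lemma pr_replicate (k : ℕ) (x : Bool) : pr g (List.replicate k x) = g x ^ k := by simp [pr]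

lemma pr_alt (k : ℕ) (z : Bool) : pr g (alt k z) = altp k g z := by
  induction k with
  | zero => rfl
  | succ k ih => rw [alt, pr_cons, ih, altp_succ]

variable {g} (hg : altProd m (g true) (g false) = altProd m (g false) (g true))

include hg

lemma altp_eq (z : Bool) : altp m g z = altp m g true := by
  cases z
  · exact hg.symm
  · rfl

lemma altp_mul_gen (z : Bool) : altp m g true * g z = g (fl m z) * altp m g true := by
  have h := altp_succ m g z
  rw [add_comm, altp_add, altp_eq hg, altp_eq hg z, altp_succ] at h
  simpa [altp, altProd, revProd, fl_zero] using h

lemma altp_mul_pr (w : List Bool) :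
    altp m g true * pr g w = pr g (w.map (fl m)) * altp m g true := by
  induction w with
  | nil => simp [pr]
  | cons x w ih => rw [List.map_cons, pr_cons, pr_cons, ← mul_assoc, altp_mul_gen hg, mul_assoc, ih,
      mul_assoc]

omit hg in
variable (g) in
/-- The value of a normal form. -/
def eval (z : NF m) : G := pr g z.1.2 * altp m g true ^ z.1.1

lemma eval_up (hm : 2 ≤ m) (x : Bool) (z : NF m) : eval g (up x z) = g x * eval g z := by
  obtain ⟨n, w, hw, rfl⟩ := exists_mk z
  by_cases h : lead (x :: w) < m
  · rw [up_mk_of_lt h]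
    change pr g (x :: w) * _ = _
    rw [pr_cons, mul_assoc]
    rfl
  · obtain ⟨k, z, v, e, hz⟩ := exists_eq_alt_append x w
    have h1 := lead_alt_append hz k
    rw [← e] at h1
    have h2 := lead_le_of_free hm (x := x) hw
    obtain rfl : m = k + 1 := by omega
    have hv : Free (k + 1) v := by
      have e' := e
      rw [alt, List.cons_append] at e'
      rw [(List.cons.inj e').2] at hw
      exact hw.of_append
    rw [up_mk_of_eq e hz hv]
    change pr g (v.map _) * altp _ g true ^ (n + 1) = g x * (pr g w * altp _ g true ^ n)
    rw [← mul_assoc, ← pr_cons, e, pr_append, pr_alt, altp_eq hg z, altp_mul_pr hg, add_comm n,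
      zpow_one_add, mul_assoc]

variable (hm : 2 ≤ m) (φ : G →* Equiv.Perm (NF m)) (hφ : ∀ x, φ (g x) = perm hm x)

include hφ

lemma eval_act (hgen : Subgroup.closure (Set.range g) = ⊤) (c : G) (z : NF m) :
    eval g (φ c z) = c * eval g z := by
  have hc : c ∈ Subgroup.closure (Set.range g) := by rw [hgen]; trivial
  induction hc using Subgroup.closure_induction generalizing z with
  | mem x hx =>
    obtain ⟨b, rfl⟩ := hx
    rw [hφ, perm_apply, eval_up hg hm]
  | one => simp
  | mul a b _ _ ha hb => rw [map_mul, Equiv.Perm.mul_apply, ha, hb, mul_assoc]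
  | inv a _ ha =>
    rw [eq_inv_mul_iff_mul_eq, ← ha, ← Equiv.Perm.mul_apply, ← map_mul, mul_inv_cancel, map_one,
      Equiv.Perm.one_apply]

lemma exists_eq_pr_mul (hgen : Subgroup.closure (Set.range g) = ⊤) (c : G) :
    ∃ w, Free m w ∧ ∃ n : ℤ, c = pr g w * altp m g true ^ n := by
  have h := eval_act hg hm φ hφ hgen c (mk 0 [] trivial)
  obtain ⟨n, w, hw, e⟩ := exists_mk (φ c (mk 0 [] trivial))
  rw [e] at h
  refine ⟨w, hw, n, ?_⟩
  change pr g w * altp m g true ^ n = c * (1 * altp m g true ^ (0 : ℤ)) at h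
  rw [h, zpow_zero, mul_one, mul_one]

omit hg

lemma act_pr_of_free {v w : List Bool} {n : ℤ} {hw : Free m w} (h : Free m (v ++ w)) :
    φ (pr g v) (mk n w hw) = mk n (v ++ w) h := by
  induction v with
  | nil => rw [pr_nil, map_one]; rfl
  | cons x v ih =>
    rw [pr_cons, map_mul, Equiv.Perm.mul_apply, ih h.2, hφ, perm_apply]
    exact up_mk_of_lt h.1

omit hφ in
lemma lt_up_of_not_lt {x : Bool} {n : ℤ} {w : List Bool} {hw : Free m w}
    (h : ¬ lead (x :: w) < m) : n < (up x (mk n w hw)).1.1 := by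
  have : up x (mk n w hw) = mk (n + 1) ((w.drop (m - 1)).map (fl m)) ((hw.drop _).map _) :=
    dif_neg h
  rw [this]
  exact lt_add_one n

omit hφ in
lemma le_up (x : Bool) (z : NF m) : z.1.1 ≤ (up x z).1.1 := by
  obtain ⟨n, w, hw, rfl⟩ := exists_mk z
  by_cases h : lead (x :: w) < m
  · rw [up_mk_of_lt h]
    exact le_refl n
  · exact (lt_up_of_not_lt h).le

lemma act_pr (v w : List Bool) (n : ℤ) (hw : Free m w) :
    (∃ h, φ (pr g v) (mk n w hw) = mk n (v ++ w) h) ∨ n < (φ (pr g v) (mk n w hw)).1.1 := by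
  induction v with
  | nil => left; exact ⟨hw, by rw [pr_nil, map_one]; rfl⟩
  | cons x v ih =>
    rw [pr_cons, map_mul, Equiv.Perm.mul_apply, hφ, perm_apply]
    rcases ih with ⟨h, e⟩ | ih
    · rw [e]
      by_cases h' : lead (x :: (v ++ w)) < m
      · left
        exact ⟨⟨h', h⟩, up_mk_of_lt h'⟩
      · right
        exact lt_up_of_not_lt h'
    · right
      exact ih.trans_le (le_up _ _)

lemma pr_inj {v w : List Bool} (hv : Free m v) (h : pr g v = pr g w) : v = w := by
  have h1 := act_pr_of_free hm φ hφ (v := v) (w := []) (n := 0) (hw := trivial) (by simpa using hv)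
  rcases act_pr hm φ hφ w [] 0 trivial with ⟨h2, e⟩ | e
  · rw [h] at h1
    have h3 : v ++ [] = w ++ [] := congrArg (fun z : NF m => z.1.2) (h1.symm.trans e)
    rwa [List.append_nil, List.append_nil] at h3
  · rw [← h, h1] at e
    exact absurd e (lt_irrefl _)

omit hφ in
lemma free_replicate_append (hm : 2 ≤ m) {x : Bool} {w : List Bool} (hx : lead (x :: w) < m) (hw : Free m w)
    (k : ℕ) : Free m (List.replicate k x ++ w) := by
  induction k with
  | zero => exact hw
  | succ k ih =>
    rw [List.replicate_succ, List.cons_append]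
    refine ⟨?_, ih⟩
    cases k with
    | zero => exact hx
    | succ k =>
      rw [List.replicate_succ, List.cons_append, lead, if_neg]
      · omega
      · simp

include hg

lemma root_pr {w : List Bool} (hw : Free m w) (k : ℕ) {x y : Bool}
    (h : g x ^ (k + 1) * pr g w = pr g w * g y ^ (k + 1)) : g x * pr g w = pr g w * g y := by
  obtain ⟨l, hl⟩ : ∃ l, w.length = l := ⟨_, rfl⟩
  induction l using Nat.strong_induction_on generalizing w x with
  | _ l ih =>
    by_cases hx : lead (x :: w) < m
    · rw [← pr_replicate, ← pr_replicate, ← pr_append, ← pr_append] at h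
      have h1 := pr_inj hm φ hφ (free_replicate_append hm hx hw (k + 1)) h
      cases w with
      | nil =>
        rw [List.append_nil, List.nil_append, List.replicate_succ, List.replicate_succ] at h1
        rw [(List.cons.inj h1).1, pr_nil, mul_one, one_mul]
      | cons z v =>
        rw [List.replicate_succ, List.cons_append, List.cons_append] at h1
        obtain rfl := (List.cons.inj h1).1
        rw [pr_append, pr_append, pr_replicate,
          pr_replicate, pr_cons, ← mul_assoc, (Commute.pow_self (g x) (k + 1)).eq, mul_assoc,
          mul_assoc, mul_left_cancel_iff] at h
        rw [pr_cons, mul_assoc, ih v.length (by simp at hl; omega) hw.2 h rfl]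
    · obtain ⟨j, z, v, e, hz⟩ := exists_eq_alt_append x w
      have h1 := lead_alt_append hz j
      rw [← e] at h1
      have h2 := lead_le_of_free hm (x := x) hw
      obtain rfl : m = j + 1 := by omega
      rw [alt, List.cons_append] at e
      obtain ⟨rfl, rfl⟩ := List.cons.inj e
      have hv : Free (j + 1) v := hw.of_append
      have h3 : g (fl j z) * pr g (alt j z) = pr g (alt j z) * g (fl (j + 1) (fl j z)) := by
        apply mul_left_cancel (a := g (fl j z))
        rw [pr_alt, ← mul_assoc (g (fl j z)) (altp j g z) (g _), ← altp_succ, altp_eq hg,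
          altp_mul_gen hg, fl_self]
      have h4 := SemiconjBy.pow_right (a := pr g (alt j z)) (h3.symm) (k + 1)
      rw [pr_append, ← mul_assoc, ← h4.eq, mul_assoc, mul_assoc, mul_left_cancel_iff] at h
      rw [pr_append, ← mul_assoc, h3, mul_assoc, mul_assoc,
        ih v.length (by simp [length_alt] at hl; omega) hv h rfl]

omit hφ hg in
lemma exists_semiconjBy_zpow (hg : altProd m (g true) (g false) = altProd m (g false) (g true))
    (n : ℤ) (y : Bool) : ∃ y', SemiconjBy (altp m g true ^ n) (g y) (g y') := by
  have h1 : ∀ y, SemiconjBy (altp m g true) (g y) (g (fl m y)) := altp_mul_gen hg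
  have h2 : ∀ y, SemiconjBy (altp m g true)⁻¹ (g y) (g (fl m y)) := fun y => by
    have := (h1 (fl m y)).inv_symm_left
    rwa [fl_self] at this
  induction n generalizing y with
  | zero => exact ⟨y, by simp⟩
  | succ n ih =>
    obtain ⟨y', h⟩ := ih (fl m y)
    exact ⟨y', by rw [zpow_add_one]; exact h.mul_left (h1 y)⟩
  | pred n ih =>
    obtain ⟨y', h⟩ := ih (fl m y)
    exact ⟨y', by rw [zpow_sub_one]; exact h.mul_left (h2 y)⟩

/-- An element conjugating a power of a generator to a power of a generator conjugates the
generators. -/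
lemma root_pow (hgen : Subgroup.closure (Set.range g) = ⊤) {c : G} (k : ℕ) {x y : Bool}
    (h : g x ^ (k + 1) * c = c * g y ^ (k + 1)) : g x * c = c * g y := by
  obtain ⟨w, hw, n, rfl⟩ := exists_eq_pr_mul hg hm φ hφ hgen c
  obtain ⟨y', hy⟩ := exists_semiconjBy_zpow hg n y
  rw [mul_assoc, (hy.pow_right (k + 1)).eq, ← mul_assoc, ← mul_assoc, mul_right_cancel_iff] at h
  rw [mul_assoc, hy.eq, ← mul_assoc, ← mul_assoc, root_pr hg hm φ hφ hw k h]

lemma root_zpow (hgen : Subgroup.closure (Set.range g) = ⊤) {c : G} {k : ℤ} (hk : k ≠ 0)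
    {x y : Bool} (h : g x ^ k * c = c * g y ^ k) : g x * c = c * g y := by
  have h1 : SemiconjBy c (g y ^ k.natAbs) (g x ^ k.natAbs) := by
    have h2 : SemiconjBy c (g y ^ k) (g x ^ k) := h.symm
    rcases Int.natAbs_eq k with e | e
    · rwa [e, zpow_natCast, zpow_natCast] at h2
    · rwa [e, zpow_neg, zpow_neg, zpow_natCast, zpow_natCast, SemiconjBy.inv_right_iff] at h2
  obtain ⟨j, hj⟩ := Nat.exists_eq_add_one_of_ne_zero (Int.natAbs_ne_zero.2 hk)
  rw [hj] at h1
  exact root_pow hg hm φ hφ hgen j h1.eq.symm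

end Root

end Dihedral

/-! ### Conjugates of subgroups -/

section Conj

variable {G : Type*} [Group G]

lemma mem_conjSubgroup {g z : G} {H : Subgroup G} : z ∈ conjSubgroup g H ↔ g⁻¹ * z * g ∈ H := by
  rw [conjSubgroup, Subgroup.mem_map]
  constructor
  · rintro ⟨x, hx, rfl⟩
    convert hx using 1
    simp [mul_assoc]
  · intro h
    exact ⟨_, h, by simp [mul_assoc]⟩

lemma conjSubgroup_mul (g h : G) (H : Subgroup G) :
    conjSubgroup (g * h) H = conjSubgroup g (conjSubgroup h H) := by
  ext z
  simp only [mem_conjSubgroup, mul_inv_rev, mul_assoc]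

lemma conjSubgroup_one (H : Subgroup G) : conjSubgroup 1 H = H := by
  ext z
  simp [mem_conjSubgroup]

lemma conjSubgroup_inv (g : G) (H : Subgroup G) : conjSubgroup g⁻¹ (conjSubgroup g H) = H := by
  rw [← conjSubgroup_mul, inv_mul_cancel, conjSubgroup_one]

lemma conjSubgroup_conjSubgroup_inv (g : G) (H : Subgroup G) :
    conjSubgroup g (conjSubgroup g⁻¹ H) = H := by
  rw [← conjSubgroup_mul, mul_inv_cancel, conjSubgroup_one]

lemma conjSubgroup_inf (g : G) (H K : Subgroup G) :
    conjSubgroup g (H ⊓ K) = conjSubgroup g H ⊓ conjSubgroup g K := by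
  ext z
  simp [mem_conjSubgroup]

lemma conjSubgroup_mono (g : G) {H K : Subgroup G} (h : H ≤ K) :
    conjSubgroup g H ≤ conjSubgroup g K := Subgroup.map_mono h

lemma conjSubgroup_le_iff {g : G} {H K : Subgroup G} :
    conjSubgroup g H ≤ K ↔ H ≤ conjSubgroup g⁻¹ K := by
  constructor
  · intro h
    rw [← conjSubgroup_inv g H]
    exact conjSubgroup_mono _ h
  · intro h
    rw [← conjSubgroup_conjSubgroup_inv g K]
    exact conjSubgroup_mono _ h

lemma conjSubgroup_of_mem {g : G} {H : Subgroup G} (h : g ∈ H) : conjSubgroup g H = H := by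
  ext z
  rw [mem_conjSubgroup, Subgroup.mul_mem_cancel_right _ h, Subgroup.mul_mem_cancel_left _
    (inv_mem h)]

lemma conjSubgroup_bot (g : G) : conjSubgroup g (⊥ : Subgroup G) = ⊥ := Subgroup.map_bot _

lemma conjSubgroup_top (g : G) : conjSubgroup g (⊤ : Subgroup G) = ⊤ :=
  conjSubgroup_of_mem (Subgroup.mem_top g)

lemma map_conjSubgroup {H : Type*} [Group H] (f : G →* H) (g : G) (K : Subgroup G) :
    (conjSubgroup g K).map f = conjSubgroup (f g) (K.map f) := by
  rw [conjSubgroup, conjSubgroup, Subgroup.map_map, Subgroup.map_map]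
  congr 1
  ext z
  simp

end Conj

/-! ### Dihedral Artin groups -/

namespace ArtinGroup

variable {S : Type u} {W : Type*} [Group W] {M : S → S → ℕ∞}

/-- Intersections of two parabolic subgroups are parabolic. -/
def InterParabolic (M : S → S → ℕ∞) : Prop :=
  ∀ P Q, IsParabolic M P → IsParabolic M Q → IsParabolic M (P ⊓ Q)

lemma isParabolic_conj {P : Subgroup (ArtinGroup M)} (h : IsParabolic M P) (g : ArtinGroup M) :
    IsParabolic M (conjSubgroup g P) := by
  obtain ⟨k, X, rfl⟩ := h
  exact ⟨g * k, X, (conjSubgroup_mul _ _ _).symm⟩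

lemma isParabolic_par (X : Set S) : IsParabolic M (par M X) := ⟨1, X, (conjSubgroup_one _).symm⟩

lemma isParabolic_bot : IsParabolic M ⊥ := by
  rw [← par_empty]
  exact isParabolic_par _

lemma par_singleton (s : S) : par M {s} = Subgroup.zpowers (gen M s) := by
  rw [par_eq, Set.image_singleton, Subgroup.zpowers_eq_closure]

/-- The exponent sum. -/
def deg (M : S → S → ℕ∞) : ArtinGroup M →* Multiplicative ℤ :=
  lift (fun _ => Multiplicative.ofAdd 1) fun _ _ _ _ _ => rfl

lemma deg_gen_zpow (s : S) (k : ℤ) : deg M (gen M s ^ k) = Multiplicative.ofAdd k := by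
  rw [map_zpow, deg, lift_gen, ← ofAdd_zsmul]
  simp

lemma eq_zero_of_gen_zpow_eq_one {s : S} {k : ℤ} (h : gen M s ^ k = 1) : k = 0 := by
  have := congrArg (deg M) h
  rw [deg_gen_zpow, map_one] at this
  exact this

lemma gen_mul_comm_of_zpow (hsymm : ∀ s t, M s t = M t s) {p q : S} (hpq : p ≠ q)
    (hS : ∀ r, r = p ∨ r = q) {m : ℕ} (hm : 2 ≤ m) (hM : M p q = m) {x y : S} {k : ℤ} (hk : k ≠ 0)
    {c : ArtinGroup M} (h : gen M x ^ k * c = c * gen M y ^ k) : gen M x * c = c * gen M y := by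
  classical
  let f : Bool → S := fun b => if b then p else q
  have hf : ∀ r, ∃ b, f b = r := fun r => (hS r).elim (fun h => ⟨true, h.symm⟩)
    fun h => ⟨false, h.symm⟩
  let φ : ArtinGroup M →* Equiv.Perm (Dihedral.NF m) :=
    lift (fun r => Dihedral.perm hm (decide (r = p))) (by
      intro s t hst l hl
      rcases hS s with rfl | rfl <;> rcases hS t with rfl | rfl
      · exact absurd rfl hst
      · rw [hM] at hl
        obtain rfl := Nat.cast_injective hl
        simpa [hst.symm] using Dihedral.perm_braid hm true
      · rw [hsymm, hM] at hl
        obtain rfl := Nat.cast_injective hl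
        simpa [hst] using Dihedral.perm_braid hm false
      · exact absurd rfl hst)
  obtain ⟨a, rfl⟩ := hf x
  obtain ⟨b, rfl⟩ := hf y
  refine Dihedral.root_zpow (g := fun b => gen M (f b)) (altProd_gen hpq hM) hm φ ?_ ?_ hk h
  · intro z
    change lift _ _ (gen M (f z)) = _
    rw [lift_gen]
    cases z
    · simp [f, hpq.symm]
    · simp [f]
  · rw [eq_top_iff, ← closure_gen]
    apply Subgroup.closure_mono
    rintro _ ⟨r, rfl⟩
    obtain ⟨b, rfl⟩ := hf r
    exact ⟨b, rfl⟩

lemma act_gen_zpow_even (K : CoxeterModel M W) {Y : Set S} {s : S} (hs : s ∉ Y) {k : ℤ}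
    (hk : Even k) (h : CoxeterModel.ASub M Y) : K.act Y (gen M s ^ k) (K.base Y, h) = (K.base Y, h) := by
  have hl : ¬ ∃ t : Y, K.σ s * K.base Y = K.base Y * K.σ t := by
    rintro ⟨t, ht⟩
    have h1 : K.σ s = K.σ t := by simpa [CoxeterModel.base] using ht
    exact hs (K.inj h1 ▸ t.2)
  obtain ⟨j, rfl⟩ := hk
  rw [← two_mul, zpow_mul, map_zpow]
  apply Equiv.Perm.zpow_apply_eq_self_of_apply_eq_self
  rw [zpow_two, map_mul, Equiv.Perm.mul_apply,
    CoxeterModel.act_gen, CoxeterModel.act_gen, CoxeterModel.step_step, CoxeterModel.out_step,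
    CoxeterModel.out_of_not_loop hl, one_mul, one_mul]

lemma coxeter_mul_pow_ne_one (K : CoxeterModel M W) {p q : S} (hpq : p ≠ q) {m : ℕ} (hm : 3 ≤ m)
    (hM : M p q = m) {k : ℕ} (hk : 0 < k) (hk' : k < 3) : (K.σ p * K.σ q) ^ k ≠ 1 := by
  intro h
  rcases K.order p q hpq k h with rfl | ⟨l, hl, hd⟩
  · omega
  · rw [hM] at hl
    obtain rfl := Nat.cast_injective hl
    have := Nat.le_of_dvd hk hd
    omega

lemma exponent_eq_zero_of_even (K : CoxeterModel M W) (hsymm : ∀ s t, M s t = M t s) {p q : S}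
    (hpq : p ≠ q) (hS : ∀ r, r = p ∨ r = q) {m : ℕ} (hm : 3 ≤ m) (hM : M p q = m) {i j k l : ℤ}
    (h : gen M q ^ i * gen M p ^ j * gen M q ^ k * gen M p ^ l = 1) (hj : Even j) (hl : Even l) :
    i = 0 ∨ j = 0 := by
  by_contra! hc
  have h1 : K.act {q} (gen M q ^ i * gen M p ^ j * gen M q ^ k * gen M p ^ l)
      (K.base {q}, 1) = (K.base {q}, gen _ ⟨q, Set.mem_singleton q⟩ ^ i * gen _ ⟨q, Set.mem_singleton q⟩ ^ k) := by
    have h2 : ∀ n : ℤ, gen M q ^ n = incl M {q} (gen _ ⟨q, Set.mem_singleton q⟩ ^ n) := fun n => by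
      rw [map_zpow, incl_gen]
    have hp : p ∉ ({q} : Set S) := hpq
    rw [map_mul, map_mul, map_mul, Equiv.Perm.mul_apply, Equiv.Perm.mul_apply,
      Equiv.Perm.mul_apply, act_gen_zpow_even K hp hl, h2 k, CoxeterModel.act_incl,
      act_gen_zpow_even K hp hj, h2 i, CoxeterModel.act_incl, mul_one]
  rw [h, map_one, Equiv.Perm.one_apply, Prod.mk.injEq, ← zpow_add] at h1
  have hik := eq_zero_of_gen_zpow_eq_one h1.2.symm
  have h3 := congrArg (fun z => Multiplicative.toAdd (deg M z)) h
  simp only [map_mul, deg_gen_zpow, map_one, toAdd_mul, toAdd_ofAdd, toAdd_one] at h3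
  obtain rfl : k = -i := by omega
  obtain rfl : l = -j := by omega
  have h4 : gen M p ^ j * gen M q ^ i = gen M q ^ i * gen M p ^ j := by
    rw [zpow_neg, zpow_neg, mul_inv_eq_one, mul_inv_eq_iff_eq_mul] at h
    exact h.symm
  have h5 := gen_mul_comm_of_zpow hsymm hpq hS (by omega) hM hc.2 h4
  have h6 := gen_mul_comm_of_zpow hsymm hpq hS (by omega) hM hc.1 h5.symm
  have h7 := congrArg K.proj h6
  rw [map_mul, map_mul, CoxeterModel.proj_gen, CoxeterModel.proj_gen] at h7
  apply coxeter_mul_pow_ne_one K hpq hm hM two_pos (by omega)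
  rw [pow_two]
  nth_rewrite 1 [← h7]
  rw [mul_assoc, ← mul_assoc (K.σ p), K.sq, one_mul, K.sq]

lemma exponent_eq_zero (K : CoxeterModel M W) (hsymm : ∀ s t, M s t = M t s) {p q : S}
    (hpq : p ≠ q) (hS : ∀ r, r = p ∨ r = q) {m : ℕ} (hm : 3 ≤ m) (hM : M p q = m) {i j k l : ℤ}
    (h : gen M q ^ i * gen M p ^ j * gen M q ^ k * gen M p ^ l = 1) :
    i = 0 ∨ j = 0 ∨ k = 0 := by
  have hcase : (Even j ∧ Even l) ∨ (Even i ∧ Even k) := by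
    have h1 := congrArg K.proj h
    have hσ : ∀ (s : S) (n : ℤ), Even n ∧ K.proj (gen M s ^ n) = 1 ∨
        Odd n ∧ K.proj (gen M s ^ n) = K.σ s := by
      intro s n
      rw [map_zpow, CoxeterModel.proj_gen]
      rcases Int.even_or_odd' n with ⟨a, rfl | rfl⟩
      · left
        exact ⟨even_two_mul a, by rw [zpow_mul, zpow_two, K.sq, one_zpow]⟩
      · right
        exact ⟨odd_two_mul_add_one a, by rw [zpow_add, zpow_mul, zpow_two, K.sq, one_zpow, zpow_one,
          one_mul]⟩
    have h3 := congrArg (fun z => Multiplicative.toAdd (deg M z)) h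
    simp only [map_mul, deg_gen_zpow, map_one, toAdd_mul, toAdd_ofAdd, toAdd_one] at h3
    have n1 := coxeter_mul_pow_ne_one K hpq hm hM one_pos (by omega)
    have n2 := coxeter_mul_pow_ne_one K hpq hm hM two_pos (by omega)
    have n3 := coxeter_mul_pow_ne_one K hpq.symm hm (by rw [hsymm, hM]) one_pos (by omega)
    have n4 := coxeter_mul_pow_ne_one K hpq.symm hm (by rw [hsymm, hM]) two_pos (by omega)
    rw [pow_one] at n1 n3
    rw [pow_two, ← mul_assoc] at n2 n4
    simp only [map_mul, map_one] at h1
    rcases hσ q i with ⟨ei, e1⟩ | ⟨ei, e1⟩ <;> rcases hσ p j with ⟨ej, e2⟩ | ⟨ej, e2⟩ <;>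
      rcases hσ q k with ⟨ek, e3⟩ | ⟨ek, e3⟩ <;> rcases hσ p l with ⟨el, e4⟩ | ⟨el, e4⟩ <;>
      rw [e1, e2, e3, e4] at h1 <;> try simp only [one_mul, mul_one] at h1
    all_goals
      first
        | exact Or.inl ⟨ej, el⟩
        | exact Or.inr ⟨ei, ek⟩
        | contradiction
        | (exfalso; simp only [Int.odd_iff, Int.even_iff] at ei ej ek el; omega)
  rcases hcase with ⟨hj, hl⟩ | ⟨hi, hk⟩
  · have := exponent_eq_zero_of_even K hsymm hpq hS hm hM h hj hl
    tauto
  · have h' : gen M p ^ j * gen M q ^ k * gen M p ^ l * gen M q ^ i = 1 := by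
      simpa [mul_assoc] using congrArg (fun z => (gen M q ^ i)⁻¹ * z * gen M q ^ i) h
    have := exponent_eq_zero_of_even K hsymm hpq.symm (fun r => (hS r).symm) hm (by rw [hsymm, hM])
      h' hk hi
    tauto

lemma fiveLarge_of_dihedral (K : CoxeterModel M W) (hsymm : ∀ s t, M s t = M t s) {p q : S}
    (hpq : p ≠ q) (hS : ∀ r, r = p ∨ r = q) {m : ℕ} (hm : 3 ≤ m) (hM : M p q = m) :
    (complex M).FiveLarge where
  four a b c d hab hbc hcd hda := by
    have key : ∀ {p q : S}, p ≠ q → (∀ r, r = p ∨ r = q) → M p q = m → a.1 = p → b.1 = q →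
        c.1 = p → d.1 = q → (complex M).Near a c ∨ (complex M).Near b d := by
      intro p q hpq hS hM ha hb hc hd
      obtain ⟨-, g₁, a1, b1⟩ := hab
      obtain ⟨-, g₂, b2, c2⟩ := hbc
      obtain ⟨-, g₃, c3, d3⟩ := hcd
      obtain ⟨-, g₄, d4, a4⟩ := hda
      rw [ha] at a1 a4
      rw [hb] at b1 b2
      rw [hc] at c2 c3
      rw [hd] at d3 d4
      have hp : ({p}ᶜ : Set S) = {q} := by
        ext r
        rcases hS r with rfl | rfl
        · simp [hpq]
        · simp [hpq.symm]
      have hq : ({q}ᶜ : Set S) = {p} := by rw [← hp, compl_compl]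
      have e1 := vtx_eq_iff.1 (a4.trans a1.symm)
      have e2 := vtx_eq_iff.1 (b1.trans b2.symm)
      have e3 := vtx_eq_iff.1 (c2.trans c3.symm)
      have e4 := vtx_eq_iff.1 (d3.trans d4.symm)
      rw [hp, par_singleton, Subgroup.mem_zpowers_iff] at e1 e3
      rw [hq, par_singleton, Subgroup.mem_zpowers_iff] at e2 e4
      obtain ⟨i, hi⟩ := e1
      obtain ⟨j, hj⟩ := e2
      obtain ⟨k, hk⟩ := e3
      obtain ⟨l, hl⟩ := e4
      rcases exponent_eq_zero K hsymm hpq hS hm hM (i := i) (j := j) (k := k) (l := l)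
        (by rw [hi, hj, hk, hl]; group) with rfl | rfl | rfl
      · rw [zpow_zero, eq_comm, inv_mul_eq_one] at hi
        subst hi
        exact Or.inr (Or.inl (b1.symm.trans d4))
      · rw [zpow_zero, eq_comm, inv_mul_eq_one] at hj
        subst hj
        exact Or.inl (Or.inl (a1.symm.trans c2))
      · rw [zpow_zero, eq_comm, inv_mul_eq_one] at hk
        subst hk
        exact Or.inr (Or.inl (b2.symm.trans d3))
    have h1 := hab.1
    have h2 := hbc.1
    have h3 := hcd.1
    rcases hS a.1 with ha | ha <;> rcases hS b.1 with hb | hb <;> rcases hS c.1 with hc | hc <;>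
      rcases hS d.1 with hd | hd <;> rw [ha, hb] at h1 <;> rw [hb, hc] at h2 <;>
      rw [hc, hd] at h3 <;> try contradiction
    · exact key hpq hS hM ha hb hc hd
    · exact key hpq.symm (fun r => (hS r).symm) (by rw [hsymm, hM]) ha hb hc hd
  five a b c d e hab hbc hcd hde hea := by
    exfalso
    have h1 := hab.1
    have h2 := hbc.1
    have h3 := hcd.1
    have h4 := hde.1
    have h5 := hea.1
    rcases hS a.1 with ha | ha <;> rcases hS b.1 with hb | hb <;> rcases hS c.1 with hc | hc <;>
      rcases hS d.1 with hd | hd <;> rcases hS e.1 with he | he <;> simp_all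

lemma interParabolic_of_dihedral (hsymm : ∀ s t, M s t = M t s) {p q : S} (hpq : p ≠ q)
    (hS : ∀ r, r = p ∨ r = q) {m : ℕ} (hm : 2 ≤ m) (hM : M p q = m) : InterParabolic M := by
  have hX : ∀ X : Set S, X = ∅ ∨ X = Set.univ ∨ ∃ x, X = {x} := by
    intro X
    by_cases hp : p ∈ X <;> by_cases hq : q ∈ X
    · right; left
      ext r
      rcases hS r with rfl | rfl <;> simp_all
    · right; right
      refine ⟨p, ?_⟩
      ext r
      rcases hS r with rfl | rfl <;> simp_all [Ne.symm]
    · right; right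
      refine ⟨q, ?_⟩
      ext r
      rcases hS r with rfl | rfl <;> simp_all
    · left
      ext r
      rcases hS r with rfl | rfl <;> simp_all
  rintro P Q ⟨g, X, rfl⟩ ⟨h, Y, rfl⟩
  change IsParabolic M (conjSubgroup g (par M X) ⊓ conjSubgroup h (par M Y))
  have hgX : IsParabolic M (conjSubgroup g (par M X)) := ⟨g, X, rfl⟩
  have hhY : IsParabolic M (conjSubgroup h (par M Y)) := ⟨h, Y, rfl⟩
  rcases hX X with rfl | rfl | ⟨x, rfl⟩
  · rw [par_empty, conjSubgroup_bot, bot_inf_eq]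
    exact isParabolic_bot
  · rwa [par_univ, conjSubgroup_top, top_inf_eq]
  rcases hX Y with rfl | rfl | ⟨y, rfl⟩
  · rw [par_empty, conjSubgroup_bot, inf_bot_eq]
    exact isParabolic_bot
  · rwa [par_univ, conjSubgroup_top, inf_top_eq]
  by_cases hbot : conjSubgroup g (par M {x}) ⊓ conjSubgroup h (par M {y}) = ⊥
  · rw [hbot]
    exact isParabolic_bot
  obtain ⟨⟨z, hz1, hz2⟩, hz⟩ := Subgroup.ne_bot_iff_exists_ne_one.1 hbot
  have hz1' : z ∈ conjSubgroup g (par M {x}) := hz1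
  have hz2' : z ∈ conjSubgroup h (par M {y}) := hz2
  rw [mem_conjSubgroup, par_singleton, Subgroup.mem_zpowers_iff] at hz1' hz2'
  obtain ⟨k, hk⟩ := hz1'
  obtain ⟨l, hl⟩ := hz2'
  have hkl : k = l := by
    have h1 := congrArg (deg M) hk
    have h2 := congrArg (deg M) hl
    rw [deg_gen_zpow, map_mul, map_mul, mul_right_comm, ← map_mul, inv_mul_cancel, map_one,
      one_mul] at h1 h2
    exact Multiplicative.ofAdd.injective (h1.trans h2.symm)
  subst hkl
  have hk0 : k ≠ 0 := by
    rintro rfl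
    rw [zpow_zero, eq_comm, mul_assoc, inv_mul_eq_one, eq_comm, mul_eq_right] at hk
    exact hz (Subtype.ext hk)
  have h1 : gen M x ^ k * (g⁻¹ * h) = g⁻¹ * h * gen M y ^ k := by
    rw [hk, hl]
    group
  have h2 := gen_mul_comm_of_zpow hsymm hpq hS hm hM hk0 h1
  have h3 : conjSubgroup (g⁻¹ * h) (par M {y}) = par M {x} := by
    rw [par_singleton, par_singleton, conjSubgroup, MonoidHom.map_zpowers]
    change Subgroup.zpowers (g⁻¹ * h * gen M y * (g⁻¹ * h)⁻¹) = _
    rw [← h2, mul_inv_cancel_right]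
  have h4 : conjSubgroup h (par M {y}) = conjSubgroup g (par M {x}) := by
    rw [← h3, ← conjSubgroup_mul, mul_inv_cancel_left]
  rwa [h4, inf_idem]

end ArtinGroup

/-! ### Intersections of parabolic subgroups -/

lemma SimpleGraph.IsRadial.apply_eq_of_equiv {V : Type*} {G : SimpleGraph V} {u : V} {l : V → ℕ}
    (hl : G.IsRadial u l) {f g : V → V} (hf : ∀ x y, G.Adj x y → G.Adj (f x) (f y))
    (hg : ∀ x y, G.Adj x y → G.Adj (g x) (g y)) (hgf : ∀ x, g (f x) = x) (hfu : f u = u) (x : V) :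
    l (f x) = l x := by
  have key : ∀ f : V → V, (∀ x y, G.Adj x y → G.Adj (f x) (f y)) → f u = u → ∀ n x, l x = n →
      l (f x) ≤ n := by
    intro f hf hfu n
    induction n with
    | zero =>
      intro x hx
      rw [(hl.eq_zero_iff x).1 hx, hfu, (hl.eq_zero_iff u).2 rfl]
    | succ n ih =>
      intro x hx
      obtain ⟨y, hyx, hy⟩ := hl.exists_pred x n hx
      have := hl.le_succ _ _ (hf _ _ hyx)
      have := ih y hy
      omega
  refine le_antisymm (key f hf hfu _ x rfl) ?_
  have h := key g hg (by rw [← hfu, hgf, hfu]) _ (f x) rfl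
  rwa [hgf] at h

namespace ArtinGroup

variable {S : Type u} {W : Type*} [Group W] {M : S → S → ℕ∞}

lemma mem_conjSubgroup_compl_iff {g r : ArtinGroup M} {s : S} :
    r ∈ conjSubgroup g (par M {s}ᶜ) ↔ move r (vtx g s) = vtx g s := by
  rw [mem_conjSubgroup, move_vtx, eq_comm, vtx_eq_iff, mul_assoc]

lemma exists_conjSubgroup_eq_map (K : CoxeterModel M W) {P : Subgroup (ArtinGroup M)}
    (hP : IsParabolic M P) {Y : Set S} (h : P ≤ par M Y) :
    ∃ P', IsParabolic (fun a b : Y => M a b) P' ∧ P'.map (incl M Y) = P := by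
  obtain ⟨g, X, rfl⟩ := hP
  obtain ⟨p, hp, Z, hZ, e⟩ := CoxeterModel.exists_conj_par K h
  obtain ⟨b, rfl⟩ := CoxeterModel.exists_incl hp
  refine ⟨conjSubgroup b (par _ (Subtype.val ⁻¹' Z)), ⟨b, _, rfl⟩, ?_⟩
  change _ = conjSubgroup g (par M X)
  rw [e, map_conjSubgroup, map_incl_par, Subtype.image_preimage_coe, Set.inter_eq_right.2 hZ]

lemma isParabolic_inf_of_le (K : CoxeterModel M W) {Y : Set S}
    (hY : InterParabolic fun a b : Y => M a b) {P Q : Subgroup (ArtinGroup M)}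
    (hP : IsParabolic M P) (hQ : IsParabolic M Q) {g : ArtinGroup M}
    (hPY : P ≤ conjSubgroup g (par M Y)) (hQY : Q ≤ conjSubgroup g (par M Y)) :
    IsParabolic M (P ⊓ Q) := by
  obtain ⟨P', hP', eP⟩ := exists_conjSubgroup_eq_map K (isParabolic_conj hP g⁻¹) (Y := Y)
    (by rwa [conjSubgroup_le_iff, inv_inv])
  obtain ⟨Q', hQ', eQ⟩ := exists_conjSubgroup_eq_map K (isParabolic_conj hQ g⁻¹) (Y := Y)
    (by rwa [conjSubgroup_le_iff, inv_inv])
  obtain ⟨b, Z, hZ⟩ := hY P' Q' hP' hQ'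
  change _ = conjSubgroup b (par _ Z) at hZ
  have h1 : conjSubgroup g⁻¹ (P ⊓ Q) = conjSubgroup (incl M Y b) (par M (Subtype.val '' Z)) := by
    rw [conjSubgroup_inf, ← eP, ← eQ, ← Subgroup.map_inf _ _ _ (CoxeterModel.incl_injective K Y), hZ,
      map_conjSubgroup, map_incl_par]
  rw [← conjSubgroup_conjSubgroup_inv g (P ⊓ Q), h1]
  exact isParabolic_conj (isParabolic_conj (isParabolic_par _) _) _

lemma isParabolic_inf_of_radial (K : CoxeterModel M W)
    (hloc : ∀ s : S, InterParabolic fun a b : ({s}ᶜ : Set S) => M a b) {P : Subgroup (ArtinGroup M)}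
    (hP : IsParabolic M P) {u : Vert M} (hPu : ∀ r ∈ P, move r u = u) {l : Vert M → ℕ}
    (hl : (complex M).IsRadial u l) (n : ℕ) : ∀ (Q : Subgroup (ArtinGroup M)) (v : Vert M),
      IsParabolic M Q → (∀ r ∈ Q, move r v = v) → l v = n → IsParabolic M (P ⊓ Q) := by
  induction n with
  | zero =>
    intro Q v hQ hQv hv
    obtain rfl := (hl.eq_zero_iff v).1 hv
    obtain ⟨g, hg⟩ := exists_vtx v
    rw [← hg] at hPu hQv
    exact isParabolic_inf_of_le K (hloc _) hP hQ
      (fun r hr => mem_conjSubgroup_compl_iff.2 (hPu r hr))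
      (fun r hr => mem_conjSubgroup_compl_iff.2 (hQv r hr))
  | succ n ih =>
    intro Q v hQ hQv hv
    obtain ⟨w, hwv, hw⟩ := hl.exists_pred v n hv
    obtain ⟨g, s, t, hst, rfl, rfl⟩ := exists_eq_vtx hwv
    have h1 : IsParabolic M (Q ⊓ conjSubgroup g (par M ({t}ᶜ ∩ {s}ᶜ))) :=
      isParabolic_inf_of_le K (hloc t) hQ (isParabolic_conj (isParabolic_par _) g)
        (fun r hr => mem_conjSubgroup_compl_iff.2 (hQv r hr))
        (conjSubgroup_mono _ (par_mono Set.inter_subset_left))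
    have h2 : P ⊓ Q = P ⊓ (Q ⊓ conjSubgroup g (par M ({t}ᶜ ∩ {s}ᶜ))) := by
      refine le_antisymm (le_inf inf_le_left (le_inf inf_le_right ?_))
        (inf_le_inf_left _ inf_le_left)
      rintro r ⟨hrP, hrQ⟩
      have hrt := mem_conjSubgroup_compl_iff.2 (hQv r hrQ)
      have hrw : l (move r (vtx g s)) = n := by
        rw [hl.apply_eq_of_equiv (fun _ _ => move_adj r) (fun _ _ => move_adj r⁻¹) (move_inv r)
          (hPu r hrP), hw]
      have hadj := move_adj r hwv
      rw [hQv r hrQ] at hadj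
      have hrs : move r (vtx g s) = vtx g s := by
        rcases hl.pred_near _ _ _ n hv hrw hw hadj hwv with h | h
        · exact h
        · exact absurd rfl h.1
      rw [mem_conjSubgroup] at hrt ⊢
      exact CoxeterModel.mem_par_inter K hrt (mem_conjSubgroup.1 (mem_conjSubgroup_compl_iff.2 hrs))
    rw [h2]
    refine ih _ (vtx g s) h1 ?_ hw
    rintro r ⟨-, hr⟩
    exact mem_conjSubgroup_compl_iff.1 (conjSubgroup_mono _ (par_mono Set.inter_subset_right) hr)

lemma Wide.interParabolic (hM : Wide M) (K : CoxeterModel M W)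
    (hfive : ∀ s : S, (complex fun a b : ({s}ᶜ : Set S) => M a b).FiveLarge)
    (hloc : ∀ s : S, InterParabolic fun a b : ({s}ᶜ : Set S) => M a b) : InterParabolic M := by
  rintro P Q hP hQ
  have hor : ∀ P, IsParabolic M P → P = ⊤ ∨ ∃ u, ∀ r ∈ P, move r u = u := by
    rintro _ ⟨g, X, rfl⟩
    by_cases hX : X = Set.univ
    · left
      change conjSubgroup g (par M X) = ⊤
      rw [hX, par_univ, conjSubgroup_top]
    · right
      obtain ⟨s, hs⟩ := (Set.ne_univ_iff_exists_notMem _).1 hX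
      refine ⟨vtx g s, fun r hr => mem_conjSubgroup_compl_iff.1 (conjSubgroup_mono g
        (par_mono ?_) hr)⟩
      exact Set.subset_compl_singleton_iff.2 hs
  rcases hor P hP with rfl | ⟨u, hu⟩
  · rwa [top_inf_eq]
  rcases hor Q hQ with rfl | ⟨v, hv⟩
  · rwa [inf_top_eq]
  obtain ⟨l, hl⟩ := (locallyLarge_of_links K hfive).exists_radial (complex_flagSimplyConnected hM) u
  exact isParabolic_inf_of_radial K hloc hP hu hl _ Q v hQ hv rfl

lemma fiveLarge_and_interParabolic (n : ℕ) : ∀ (S : Type u) [Finite S] (M : S → S → ℕ∞),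
    (∀ s t, M s t = M t s) → (∀ s t, s ≠ t → 3 ≤ M s t) → Nat.card S = n →
      (complex M).FiveLarge ∧ InterParabolic M := by
  induction n using Nat.strong_induction_on with
  | _ n ih =>
  intro S _ M hsymm hlarge hn
  have K := coxeterModelOf M hsymm hlarge
  have hsub : ∀ s : S, (complex fun a b : ({s}ᶜ : Set S) => M a b).FiveLarge ∧
      InterParabolic fun a b : ({s}ᶜ : Set S) => M a b := by
    intro s
    refine ih _ ?_ _ _ (fun a b => hsymm _ _) (fun a b h => hlarge _ _ (Subtype.coe_ne_coe.2 h)) rfl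
    rw [← hn]
    exact Finite.card_subtype_lt (x := s) (by simp)
  rcases subsingleton_or_nontrivial S with hS | hS
  · have hadj : ∀ x y, ¬ (complex M).Adj x y := fun x y h => h.1 (Subsingleton.elim _ _)
    refine ⟨⟨fun a b c d h => absurd h (hadj _ _), fun a b c d e h => absurd h (hadj _ _)⟩, ?_⟩
    have htriv : ∀ P, IsParabolic M P → P = ⊥ ∨ P = ⊤ := by
      rintro _ ⟨g, X, rfl⟩
      rcases Set.eq_empty_or_nonempty X with rfl | h
      · exact Or.inl ((congrArg _ par_empty).trans (conjSubgroup_bot g))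
      · obtain rfl := Subsingleton.eq_univ_of_nonempty h
        exact Or.inr ((congrArg _ par_univ).trans (conjSubgroup_top g))
    intro P Q hP hQ
    rcases htriv P hP with rfl | rfl
    · rwa [bot_inf_eq]
    · rwa [top_inf_eq]
  by_cases hd : ∃ s t : S, s ≠ t ∧ M s t ≠ ⊤ ∧ ∀ r, r = s ∨ r = t
  · obtain ⟨p, q, hpq, htop, hpq'⟩ := hd
    obtain ⟨m, hm⟩ := ENat.ne_top_iff_exists.1 htop
    have hm3 := three_le_of_eq_coe M hlarge hpq hm.symm
    exact ⟨fiveLarge_of_dihedral K hsymm hpq hpq' hm3 hm.symm,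
      interParabolic_of_dihedral hsymm hpq hpq' (by omega) hm.symm⟩
  · have hM : Wide M := by
      refine ⟨exists_ne, fun s t hst h => ?_⟩
      by_contra! hc
      exact hd ⟨s, t, hst, h, fun r => or_iff_not_imp_left.2 (hc r)⟩
    have hfive := fun s => (hsub s).1
    exact ⟨(locallyLarge_of_links K hfive).fiveLarge (complex_flagSimplyConnected hM),
      hM.interParabolic K hfive fun s => (hsub s).2⟩

end ArtinGroup

open ArtinGroup in
/-- In a large-type Artin group, every subset `B` is contained in a unique minimal
parabolic subgroup (its parabolic closure). -/
theorem parabolic_closure_exists_unique {S : Type*} [Finite S] (M : S → S → ℕ∞)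
    (hsymm : ∀ s t : S, M s t = M t s)
    (hlarge : ∀ s t : S, s ≠ t → 3 ≤ M s t)
    (B : Set (ArtinGroup M)) :
    ∃! P : Subgroup (ArtinGroup M), IsParabolic M P ∧ B ⊆ (P : Set (ArtinGroup M)) ∧
      ∀ Q : Subgroup (ArtinGroup M), IsParabolic M Q → B ⊆ (Q : Set (ArtinGroup M)) → P ≤ Q := by
  have K := coxeterModelOf M hsymm hlarge
  have hI : InterParabolic M := (fiveLarge_and_interParabolic _ S M hsymm hlarge rfl).2
  have hex : ∃ n, ∃ (X : Set S) (g : ArtinGroup M), X.ncard = n ∧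
      B ⊆ (conjSubgroup g (par M X) : Set (ArtinGroup M)) := by
    refine ⟨_, Set.univ, 1, rfl, ?_⟩
    rw [par_univ, conjSubgroup_top]
    exact fun _ _ => trivial
  classical
  obtain ⟨X, g, hX, hB⟩ := Nat.find_spec hex
  have hmin : ∀ (Z : Set S) (k : ArtinGroup M),
      B ⊆ (conjSubgroup k (par M Z) : Set (ArtinGroup M)) → X.ncard ≤ Z.ncard := fun Z k h =>
    hX.le.trans (Nat.find_min' hex ⟨Z, k, rfl, h⟩)
  have hle : ∀ Q : Subgroup (ArtinGroup M), IsParabolic M Q → B ⊆ (Q : Set (ArtinGroup M)) →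
      conjSubgroup g (par M X) ≤ Q := by
    intro Q hQ hBQ
    obtain ⟨h, Y, hY⟩ := isParabolic_conj (hI _ Q ⟨g, X, rfl⟩ hQ) g⁻¹
    change conjSubgroup g⁻¹ (conjSubgroup g (par M X) ⊓ Q) = conjSubgroup h (par M Y) at hY
    have h1 : conjSubgroup h (par M Y) ≤ par M X := by
      rw [← hY, conjSubgroup_le_iff, inv_inv]
      exact inf_le_left
    obtain ⟨p, hp, Z, hZ, e⟩ := CoxeterModel.exists_conj_par K h1
    have h2 : conjSubgroup g (par M X) ⊓ Q = conjSubgroup (g * p) (par M Z) := by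
      rw [conjSubgroup_mul, ← e, ← hY, conjSubgroup_conjSubgroup_inv]
    have h3 := hmin Z (g * p) (by rw [← h2]; exact fun b hb => ⟨hB hb, hBQ hb⟩)
    obtain rfl : Z = X := Set.eq_of_subset_of_ncard_le hZ h3
    rw [conjSubgroup_mul, conjSubgroup_of_mem hp] at h2
    exact inf_eq_left.1 h2
  refine ⟨conjSubgroup g (par M X), ⟨⟨g, X, rfl⟩, hB, hle⟩, ?_⟩
  rintro P ⟨hP, hBP, hPle⟩
  exact le_antisymm (hPle _ ⟨g, X, rfl⟩ hB) (hle P hP hBP)
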